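/- First Fundamental Theorem of Asset Pricing (nondominated, with options): In the multi-period market with semistatic trading, the following are equivalent: (i) NA(𝒫) holds; (ii) for every P ∈ 𝒫 there exists Q ∈ 𝒬 with P ≪ Q; (ii') 𝒫 and 𝒬 have the same polar sets (a set is 𝒫-polar iff it is 𝒬-polar). -/

import Mathlib

open MeasureTheory Set Filter Topology
open scoped ENNReal NNReal

noncomputable section

namespace BN

/-- The universal completion of the ambient measurable structure on `α`:
a set is measurable iff it is null-measurable for every probability measure. -/
def univComp (α : Type*) [MeasurableSpace α] : MeasurableSpace α where
  MeasurableSet' s := ∀ μ : Measure α, IsProbabilityMeasure μ → NullMeasurableSet s μ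
  measurableSet_empty := fun _ _ => MeasurableSet.empty.nullMeasurableSet
  measurableSet_compl := fun _ hs μ hμ => (hs μ hμ).compl
  measurableSet_iUnion := fun _ hf μ hμ => NullMeasurableSet.iUnion fun i => hf i μ hμ

/-- `N` is `PP`-polar: it is contained in an `m`-measurable set which is null under
every `P ∈ PP`. -/
def IsPolar {α : Type*} [MeasurableSpace α] (PP : Set (Measure α)) (m : MeasurableSpace α)
    (N : Set α) : Prop :=
  ∃ A : Set α, MeasurableSet[m] A ∧ N ⊆ A ∧ ∀ P ∈ PP, P A = 0

/-- A property holds `PP`-quasi surely if its complement is `PP`-polar. -/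
def QuasiSure {α : Type*} [mα : MeasurableSpace α] (PP : Set (Measure α))
    (m : MeasurableSpace α) (p : α → Prop) : Prop :=
  @IsPolar α mα PP m {ω | ¬ p ω}

/-- Expectation of a real random variable, with the convention
`E[f] = E[f⁺] - E[f⁻]` and `∞ - ∞ = -∞` (which holds in `EReal`). -/
def expec {α : Type*} [MeasurableSpace α] (Q : Measure α) (f : α → ℝ) : EReal :=
  ((∫⁻ x, ENNReal.ofReal (f x) ∂Q : ℝ≥0∞) : EReal)
    - ((∫⁻ x, ENNReal.ofReal (-f x) ∂Q : ℝ≥0∞) : EReal)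

/-- Positive part of an extended real, valued in `ℝ≥0∞`. -/
def posE (x : EReal) : ℝ≥0∞ := if x = ⊤ then ⊤ else ENNReal.ofReal x.toReal

/-- Expectation of an extended-real random variable, with the convention
`E[f] = E[f⁺] - E[f⁻]` and `∞ - ∞ = -∞`. -/
def eexpec {α : Type*} [MeasurableSpace α] (Q : Measure α) (f : α → EReal) : EReal :=
  ((∫⁻ x, posE (f x) ∂Q : ℝ≥0∞) : EReal) - ((∫⁻ x, posE (-(f x)) ∂Q : ℝ≥0∞) : EReal)

/-- A real-valued function is upper semianalytic if all its strict superlevel sets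
are analytic. -/
def UpperSemianalytic {α : Type*} [TopologicalSpace α] (f : α → ℝ) : Prop :=
  ∀ c : ℝ, AnalyticSet {x | c < f x}

/-- An extended-real-valued function is upper semianalytic if all its strict
superlevel sets `{f > c}`, `c ∈ ℝ`, are analytic. -/
def UpperSemianalyticE {α : Type*} [TopologicalSpace α] (f : α → EReal) : Prop :=
  ∀ c : ℝ, AnalyticSet {x | (c : EReal) < f x}

/-- Convexity of a set of probability measures. -/
def ConvexPM {α : Type*} [MeasurableSpace α] (C : Set (ProbabilityMeasure α)) : Prop :=
  ∀ μ ∈ C, ∀ ν ∈ C, ∀ a b : ℝ≥0∞, a + b = 1 →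
    ∀ ξ : ProbabilityMeasure α, (ξ : Measure α) = a • (μ : Measure α) + b • (ν : Measure α) →
      ξ ∈ C

/-! ### The general (non-Polish) setting of Section 2 -/

section General

variable {Ω : Type*} [MeasurableSpace Ω]

/-- Predictability of a trading strategy `H` with respect to a filtration `F`:
the holding `H (u+1)` over the period `(u, u+1]` is `F u`-measurable. -/
def PredictableF (F : ℕ → MeasurableSpace Ω) (T d : ℕ) (H : ℕ → Ω → Fin d → ℝ) : Prop :=
  ∀ u : ℕ, u < T → Measurable[F u] (H (u + 1))

/-- The final gain `(H · S)_T` from trading `H` in the stocks `S`. -/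
def gainF {d : ℕ} (S : ℕ → Ω → Fin d → ℝ) (H : ℕ → Ω → Fin d → ℝ) (T : ℕ) (ω : Ω) : ℝ :=
  ∑ u : Fin T, ∑ i : Fin d, H (u + 1) ω i * (S (u + 1) ω i - S u ω i)

/-- The no-arbitrage condition `NA(PP)` (no options). -/
def NAF (F : ℕ → MeasurableSpace Ω) (T d : ℕ) (S : ℕ → Ω → Fin d → ℝ)
    (PP : Set (Measure Ω)) : Prop :=
  ∀ H : ℕ → Ω → Fin d → ℝ, PredictableF F T d H →
    QuasiSure PP ‹MeasurableSpace Ω› (fun ω => 0 ≤ gainF S H T ω) →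
      QuasiSure PP ‹MeasurableSpace Ω› (fun ω => gainF S H T ω = 0)

/-- The cone `𝒞` of claims superreplicable from zero initial capital. -/
def Cset (F : ℕ → MeasurableSpace Ω) (T d : ℕ) (S : ℕ → Ω → Fin d → ℝ) : Set (Ω → ℝ) :=
  {W | ∃ H : ℕ → Ω → Fin d → ℝ, PredictableF F T d H ∧
    ∃ K : Ω → ℝ, Measurable K ∧ (∀ ω, 0 ≤ K ω) ∧ ∀ ω, W ω = gainF S H T ω - K ω}

/-- The superhedging price (no options), with values in `EReal` (`inf ∅ = +∞`). -/
def superPriceF (F : ℕ → MeasurableSpace Ω) (T d : ℕ) (S : ℕ → Ω → Fin d → ℝ)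
    (PP : Set (Measure Ω)) (f : Ω → ℝ) : EReal :=
  sInf ((fun x : ℝ => (x : EReal)) ''
    {x : ℝ | ∃ H : ℕ → Ω → Fin d → ℝ, PredictableF F T d H ∧
      QuasiSure PP ‹MeasurableSpace Ω› (fun ω => f ω ≤ x + gainF S H T ω)})

end General

/-! ### The one-period setting of Section 3 -/

section OnePeriod

variable {Ω : Type*} [MeasurableSpace Ω] {d : ℕ}

/-- One-period no-arbitrage condition `NA(PP)` for the increment `ΔS`. -/
def NA1 (PP : Set (Measure Ω)) (ΔS : Ω → Fin d → ℝ) : Prop :=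
  ∀ y : Fin d → ℝ,
    QuasiSure PP ‹MeasurableSpace Ω› (fun ω => 0 ≤ ∑ i, y i * ΔS ω i) →
      QuasiSure PP ‹MeasurableSpace Ω› (fun ω => ∑ i, y i * ΔS ω i = 0)

/-- The martingale measures dominated by `PP` in the one-period market:
`𝒬 = {Q : Q ⋘ 𝒫, E_Q[ΔS] = 0}`. -/
def Q1set (PP : Set (Measure Ω)) (ΔS : Ω → Fin d → ℝ) : Set (Measure Ω) :=
  {Q | IsProbabilityMeasure Q ∧ (∃ P ∈ PP, Q ≪ P) ∧
    ∀ i, expec Q (fun ω => ΔS ω i) = 0}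

/-- One-period superhedging price, with values in `EReal` (`inf ∅ = +∞`). -/
def superPrice1 (PP : Set (Measure Ω)) (ΔS : Ω → Fin d → ℝ) (f : Ω → ℝ) : EReal :=
  sInf ((fun x : ℝ => (x : EReal)) ''
    {x : ℝ | ∃ H : Fin d → ℝ,
      QuasiSure PP ‹MeasurableSpace Ω› (fun ω => f ω ≤ x + ∑ i, H i * ΔS ω i)})

end OnePeriod

/-! ### The Polish multi-period setting -/

section Polish

variable (Ω₁ : Type) [MeasurableSpace Ω₁]

/-- Restriction of a path up to time `t`. -/
def restr {T : ℕ} (t : ℕ) (h : t ≤ T) (ω : Fin T → Ω₁) : Fin t → Ω₁ :=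
  fun i => ω (Fin.castLE h i)

/-- Universally measurable predictability: `H u` (the holding over `(u, u+1]`)
is a universally measurable function of the first `u` coordinates. -/
def Pred (d : ℕ) (H : (u : ℕ) → (Fin u → Ω₁) → Fin d → ℝ) : Prop :=
  ∀ u : ℕ, @Measurable _ _ (univComp (Fin u → Ω₁)) _ (H u)

/-- The gain `(H · S)_t = ∑_{u=1}^t H_u (S_u - S_{u-1})` up to time `t ≤ T`. -/
def gain {T d : ℕ} (S : (t : ℕ) → (Fin t → Ω₁) → Fin d → ℝ)
    (H : (u : ℕ) → (Fin u → Ω₁) → Fin d → ℝ) (t : ℕ) (h : t ≤ T) (ω : Fin T → Ω₁) : ℝ :=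
  ∑ u : Fin t, ∑ i : Fin d,
    H u (restr Ω₁ u (u.2.le.trans h) ω) i *
      (S (u + 1) (restr Ω₁ (u + 1) (Nat.succ_le_of_lt (u.2.trans_le h)) ω) i
        - S u (restr Ω₁ u (u.2.le.trans h) ω) i)

variable [TopologicalSpace Ω₁] [OpensMeasurableSpace Ω₁]

/-- The set `PP = {P₀ ⊗ ⋯ ⊗ P_{t-1}}` of measures built from universally
measurable selectors of the one-step collections `𝒫_s(·)`. -/
def MeasFam (Pt : (t : ℕ) → (Fin t → Ω₁) → Set (ProbabilityMeasure Ω₁)) :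
    (t : ℕ) → Set (Measure (Fin t → Ω₁))
  | 0 => {μ | μ = Measure.dirac Fin.elim0}
  | (t + 1) => {μ | ∃ ν ∈ MeasFam Pt t, ∃ κ : (Fin t → Ω₁) → ProbabilityMeasure Ω₁,
      @Measurable _ _ (univComp (Fin t → Ω₁)) (borel (ProbabilityMeasure Ω₁)) κ ∧
      (∀ ω, κ ω ∈ Pt t ω) ∧
      μ = ν.bind (fun ω => Measure.map (Fin.snoc ω) (κ ω : Measure Ω₁))}

/-- The σ-field `ℱ_t` on `Ω = Ω₁^T`: the comap under the restriction map of the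
universal completion of the Borel σ-field of `Ω₁^t`. -/
def filtr (T : ℕ) (t : ℕ) (h : t ≤ T) : MeasurableSpace (Fin T → Ω₁) :=
  MeasurableSpace.comap (restr Ω₁ t h) (univComp (Fin t → Ω₁))

/-- `S` is a `Q`-martingale with respect to the filtration `(ℱ_t)`. -/
def IsMartMeas {T d : ℕ} (S : (t : ℕ) → (Fin t → Ω₁) → Fin d → ℝ)
    (Q : Measure (Fin T → Ω₁)) : Prop :=
  (∀ (t : ℕ) (h : t ≤ T) (i : Fin d), Integrable (fun ω => S t (restr Ω₁ t h ω) i) Q) ∧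
  (∀ (t : ℕ) (h : t + 1 ≤ T) (i : Fin d) (A : Set (Fin T → Ω₁)),
    MeasurableSet[filtr Ω₁ T t ((Nat.le_succ t).trans h)] A →
      ∫ ω in A, S (t + 1) (restr Ω₁ (t + 1) h ω) i ∂Q
        = ∫ ω in A, S t (restr Ω₁ t ((Nat.le_succ t).trans h) ω) i ∂Q)

/-- The martingale measures `Q ⋘ PP` consistent with the option prices:
`𝒬 = {Q ⋘ PP : S is a Q-martingale, E_Q[gⁱ] = 0}`. -/
def QSet {T d e : ℕ} (PP : Set (Measure (Fin T → Ω₁)))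
    (S : (t : ℕ) → (Fin t → Ω₁) → Fin d → ℝ) (g : Fin e → (Fin T → Ω₁) → ℝ) :
    Set (Measure (Fin T → Ω₁)) :=
  {Q | IsProbabilityMeasure Q ∧ (∃ P ∈ PP, Q ≪ P) ∧ IsMartMeas Ω₁ S Q ∧
    ∀ i : Fin e, expec Q (g i) = 0}

/-- The no-arbitrage condition `NA(PP)` with semistatic trading in the stocks `S`
and the options `g`. -/
def NA {T d e : ℕ} (PP : Set (Measure (Fin T → Ω₁)))
    (S : (t : ℕ) → (Fin t → Ω₁) → Fin d → ℝ) (g : Fin e → (Fin T → Ω₁) → ℝ) : Prop :=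
  ∀ H : (u : ℕ) → (Fin u → Ω₁) → Fin d → ℝ, Pred Ω₁ d H → ∀ h : Fin e → ℝ,
    QuasiSure PP (univComp (Fin T → Ω₁))
      (fun ω => 0 ≤ gain Ω₁ S H T le_rfl ω + ∑ i, h i * g i ω) →
    QuasiSure PP (univComp (Fin T → Ω₁))
      (fun ω => gain Ω₁ S H T le_rfl ω + ∑ i, h i * g i ω = 0)

/-- The minimal semistatic superhedging price, valued in `EReal` (`inf ∅ = +∞`). -/
def superPrice {T d e : ℕ} (PP : Set (Measure (Fin T → Ω₁)))
    (S : (t : ℕ) → (Fin t → Ω₁) → Fin d → ℝ) (g : Fin e → (Fin T → Ω₁) → ℝ)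
    (f : (Fin T → Ω₁) → ℝ) : EReal :=
  sInf ((fun x : ℝ => (x : EReal)) ''
    {x : ℝ | ∃ H : (u : ℕ) → (Fin u → Ω₁) → Fin d → ℝ, ∃ h : Fin e → ℝ, Pred Ω₁ d H ∧
      QuasiSure PP (univComp (Fin T → Ω₁))
        (fun ω => f ω ≤ x + gain Ω₁ S H T le_rfl ω + ∑ i, h i * g i ω)})

/-- `f` is replicable by semistatic trading. -/
def Replicable {T d e : ℕ} (PP : Set (Measure (Fin T → Ω₁)))
    (S : (t : ℕ) → (Fin t → Ω₁) → Fin d → ℝ) (g : Fin e → (Fin T → Ω₁) → ℝ)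
    (f : (Fin T → Ω₁) → ℝ) : Prop :=
  ∃ x : ℝ, ∃ H : (u : ℕ) → (Fin u → Ω₁) → Fin d → ℝ, ∃ h : Fin e → ℝ, Pred Ω₁ d H ∧
    QuasiSure PP (univComp (Fin T → Ω₁))
      (fun ω => x + gain Ω₁ S H T le_rfl ω + ∑ i, h i * g i ω = f ω)

/-- The one-period increment `ΔS_{t+1}(ω, ·)` of the stock, given history `ω ∈ Ω_t`. -/
def incr {d : ℕ} (S : (t : ℕ) → (Fin t → Ω₁) → Fin d → ℝ) (t : ℕ) (ω : Fin t → Ω₁)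
    (x : Ω₁) : Fin d → ℝ :=
  fun i => S (t + 1) (Fin.snoc ω x) i - S t ω i

/-- The one-step martingale measures `𝒬_t(ω)` dominated by `𝒫_t(ω)`. -/
def Q1fam {d : ℕ} (Pt : (t : ℕ) → (Fin t → Ω₁) → Set (ProbabilityMeasure Ω₁))
    (S : (t : ℕ) → (Fin t → Ω₁) → Fin d → ℝ) (t : ℕ) (ω : Fin t → Ω₁) :
    Set (ProbabilityMeasure Ω₁) :=
  {Q | (∃ P' ∈ Pt t ω, (Q : Measure Ω₁) ≪ (P' : Measure Ω₁)) ∧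
    ∀ i, expec (Q : Measure Ω₁) (fun x => incr Ω₁ S t ω x i) = 0}

/-- `V` is a `Q`-supermartingale with respect to the filtration `(ℱ_t)`:
each `V_t` is `Q`-integrable and `E_Q[V_{t+1} | ℱ_t] ≤ V_t`. -/
def IsSupermart {T : ℕ} (V : ℕ → (Fin T → Ω₁) → ℝ) (Q : Measure (Fin T → Ω₁)) : Prop :=
  (∀ t : ℕ, t ≤ T → Integrable (V t) Q) ∧
  ∀ (t : ℕ) (h : t + 1 ≤ T) (A : Set (Fin T → Ω₁)),
    MeasurableSet[filtr Ω₁ T t ((Nat.le_succ t).trans h)] A →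
      ∫ ω in A, V (t + 1) ω ∂Q ≤ ∫ ω in A, V t ω ∂Q

end Polish

/-! ### Quasi-sure supports -/

/-- The quasi-sure support of a family of measures on `ℝ^d`. -/
def qsSupp {d : ℕ} (Rs : Set (Measure (Fin d → ℝ))) : Set (Fin d → ℝ) :=
  ⋂₀ {A : Set (Fin d → ℝ) | IsClosed A ∧ ∀ R ∈ Rs, R A = 1}

end BN

set_option linter.unusedSectionVars false

namespace BN

/-! ### Universally measurable functions -/

/-- Measurability with respect to the universal completion of the source. -/
abbrev UMeas {α β : Type*} [MeasurableSpace α] [MeasurableSpace β] (f : α → β) : Prop :=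
  @Measurable α β (univComp α) _ f

section UMeas

variable {α β γ : Type*} [MeasurableSpace α] [MeasurableSpace β] [MeasurableSpace γ]

theorem measurableSet_univComp {s : Set α} (hs : MeasurableSet s) :
    MeasurableSet[univComp α] s :=
  fun _ _ => hs.nullMeasurableSet

theorem le_univComp : ‹MeasurableSpace α› ≤ univComp α := fun _ hs => measurableSet_univComp hs

theorem _root_.Measurable.uMeas {f : α → β} (hf : Measurable f) : UMeas f :=
  fun _ hs => measurableSet_univComp (hf hs)

theorem nullMeasurableSet_of_univComp {s : Set α} (hs : MeasurableSet[univComp α] s)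
    (μ : Measure α) [IsFiniteMeasure μ] : NullMeasurableSet s μ := by
  by_cases h0 : μ = 0
  · subst h0
    exact NullMeasurableSet.of_null (by simp)
  · have : NeZero μ := ⟨h0⟩
    have h := hs ((μ univ)⁻¹ • μ) inferInstance
    have h1 : μ ≪ (μ univ)⁻¹ • μ := by
      refine Measure.AbsolutelyContinuous.mk fun t _ ht => ?_
      simpa [measure_ne_top] using ht
    exact h.mono_ac h1

theorem UMeas.aemeasurable [MeasurableSpace.CountablyGenerated β] {f : α → β} (hf : UMeas f)
    (μ : Measure α) [IsFiniteMeasure μ] : AEMeasurable f μ :=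
  NullMeasurable.aemeasurable fun _ hs => nullMeasurableSet_of_univComp (hf hs) μ

theorem UMeas.measurableSet_preimage [MeasurableSpace.CountablyGenerated β] {f : α → β}
    (hf : UMeas f) {s : Set β} (hs : MeasurableSet[univComp β] s) :
    MeasurableSet[univComp α] (f ⁻¹' s) := by
  intro μ hμ
  obtain ⟨f', hf', he⟩ := hf.aemeasurable μ
  have h1 := nullMeasurableSet_of_univComp hs (μ.map f')
  have h2 : NullMeasurableSet (f' ⁻¹' s) μ := h1.preimage (hf'.quasiMeasurePreserving _)
  refine h2.congr (eventuallyEq_set.2 ?_)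
  filter_upwards [he] with x hx
  simp [hx]

theorem UMeas.comp [MeasurableSpace.CountablyGenerated β] {f : α → β} {g : β → γ}
    (hg : UMeas g) (hf : UMeas f) : UMeas fun x => g (f x) :=
  fun _ hs => hf.measurableSet_preimage (hg hs)

theorem UMeas.prodMk {f : α → β} {g : α → γ} (hf : UMeas f) (hg : UMeas g) :
    UMeas fun x => (f x, g x) := by
  let _ : MeasurableSpace α := univComp α
  exact Measurable.prodMk hf hg

theorem _root_.Measurable.comp_uMeas {f : α → β} {g : β → γ} (hg : Measurable g) (hf : UMeas f) :
    UMeas fun x => g (f x) :=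
  fun _ hs => hf (hg hs)

open Classical in
theorem UMeas.ite {f g : α → β} {s : Set α} (hs : MeasurableSet[univComp α] s)
    (hf : UMeas f) (hg : UMeas g) : UMeas fun x => if x ∈ s then f x else g x := by
  let _ : MeasurableSpace α := univComp α
  exact Measurable.ite hs hf hg

end UMeas

end BN

namespace BN

/-! ### Analytic sets are universally measurable -/

section Analytic

/-- Sequences whose first `n` entries are bounded by `β`. -/
def initBox (n : ℕ) (β : ℕ → ℕ) : Set (ℕ → ℕ) := {z | ∀ i < n, z i ≤ β i}

theorem initBox_congr {n : ℕ} {β β' : ℕ → ℕ} (h : ∀ i < n, β i = β' i) :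
    initBox n β = initBox n β' := by
  ext z
  simp only [initBox, Set.mem_ofPred_eq]
  exact forall₂_congr fun i hi => by rw [h i hi]

theorem exists_initBox_subset {β : ℕ → ℕ} {W : Set (ℕ → ℕ)} (hW : IsOpen W) (h : Iic β ⊆ W) :
    ∃ n, initBox n β ⊆ W := by
  have hK : IsCompact (Iic β) := by
    have : Iic β = Set.pi univ fun i => Iic (β i) := by ext; simp [Pi.le_def]
    rw [this]
    exact isCompact_univ_pi fun i => (finite_Iic (β i)).isCompact
  refine hK.induction_on (p := fun s => ∃ n, ∀ z, (fun i => min (z i) (β i)) ∈ s →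
      z ∈ initBox n β → z ∈ W) ?_ ?_ ?_ ?_ |>.imp fun n hn z hz => hn z ?_ hz
  · exact ⟨0, fun z hz => hz.elim⟩
  · rintro s t hst ⟨n, hn⟩
    exact ⟨n, fun z hz => hn z (hst hz)⟩
  · rintro s t ⟨n, hn⟩ ⟨m, hm⟩
    refine ⟨max n m, fun z hz hzn => ?_⟩
    rcases hz with hz | hz
    · exact hn z hz fun i hi => hzn i (lt_max_of_lt_left hi)
    · exact hm z hz fun i hi => hzn i (lt_max_of_lt_right hi)
  · intro x hx
    obtain ⟨s, ⟨y, n, rfl⟩, hxs, hsW⟩ :=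
      (PiNat.isTopologicalBasis_cylinders fun _ : ℕ => ℕ).exists_subset_of_mem_open (h hx) hW
    refine ⟨PiNat.cylinder y n, mem_nhdsWithin_of_mem_nhds
      ((PiNat.isOpen_cylinder _ y n).mem_nhds hxs), n, fun z hz hzn => hsW ?_⟩
    rw [PiNat.mem_cylinder_iff] at hz ⊢
    intro i hi
    rw [← hz i hi, min_eq_left (hzn i hi)]
  · exact fun i => min_le_right _ _

variable {X : Type*} [TopologicalSpace X]

theorem image_Iic_eq_iInter [T2Space X] {Φ : (ℕ → ℕ) → X} (hΦ : Continuous Φ) (β : ℕ → ℕ) :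
    Φ '' Iic β = ⋂ n, closure (Φ '' initBox n β) := by
  have hK : IsCompact (Φ '' Iic β) := by
    have : Iic β = Set.pi univ fun i => Iic (β i) := by ext; simp [Pi.le_def]
    rw [this]
    exact (isCompact_univ_pi fun i => (finite_Iic (β i)).isCompact).image hΦ
  refine Subset.antisymm (subset_iInter fun n => (image_mono ?_).trans subset_closure) ?_
  · exact fun z hz i _ => hz i
  · intro x hx
    by_contra hxK
    obtain ⟨U, V, hU, hV, hxU, hKV, hUV⟩ := hK.separation_of_notMem hxK
    obtain ⟨n, hn⟩ := exists_initBox_subset (hU.preimage hΦ) (image_subset_iff.1 hxU)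
    have hx' := mem_iInter.1 hx n
    obtain ⟨y, hy, z, hz, rfl⟩ := mem_closure_iff.1 hx' V hV hKV
    exact disjoint_left.1 hUV (hn hz) hy

theorem exists_le_measure_image_Iic [T2Space X] [MeasurableSpace X] [OpensMeasurableSpace X]
    {Φ : (ℕ → ℕ) → X} (hΦ : Continuous Φ) (μ : Measure X) [IsFiniteMeasure μ] {r : ℝ≥0∞}
    (hr : r < μ (range Φ)) : ∃ β, r ≤ μ (Φ '' Iic β) := by
  have step : ∀ n β, r < μ (Φ '' initBox n β) →
      ∃ m, r < μ (Φ '' initBox (n + 1) (Function.update β n m)) := by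
    intro n β h
    have hU : Φ '' initBox n β = ⋃ m, Φ '' initBox (n + 1) (Function.update β n m) := by
      rw [← image_iUnion]
      congr 1
      ext z
      simp only [initBox, Set.mem_ofPred_eq, mem_iUnion]
      constructor
      · intro hz
        refine ⟨z n, fun i hi => ?_⟩
        rcases eq_or_ne i n with rfl | hin
        · simp
        · rw [Function.update_of_ne hin]; exact hz i (by omega)
      · rintro ⟨m, hm⟩ i hi
        have := hm i (by omega)
        rwa [Function.update_of_ne (by omega)] at this
    have hmono : Monotone fun m => Φ '' initBox (n + 1) (Function.update β n m) := by
      intro m m' hmm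
      refine image_mono fun z hz i hi => (hz i hi).trans ?_
      rcases eq_or_ne i n with rfl | hin
      · simpa using hmm
      · simp [Function.update_of_ne hin]
    rw [hU, hmono.measure_iUnion] at h
    exact lt_iSup_iff.1 h
  choose! m hm using step
  let b : ℕ → ℕ → ℕ := fun n => Nat.rec (fun _ => 0) (fun n β => Function.update β n (m n β)) n
  have hb : ∀ n, r < μ (Φ '' initBox n (b n)) := by
    intro n
    induction n with
    | zero => simpa [initBox] using hr
    | succ n ih => exact hm n (b n) ih
  have hstab : ∀ i k, b (i + 1 + k) i = b (i + 1) i := by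
    intro i k
    induction k with
    | zero => rfl
    | succ k ih =>
      rw [← ih]
      change Function.update (b (i + 1 + k)) (i + 1 + k) _ i = _
      rw [Function.update_of_ne (by omega)]
  refine ⟨fun i => b (i + 1) i, ?_⟩
  set β : ℕ → ℕ := fun i => b (i + 1) i with hβ
  have hbox : ∀ n, initBox n (b n) = initBox n β := fun n => initBox_congr fun i hi => by
    obtain ⟨k, rfl⟩ := Nat.exists_eq_add_of_le (Nat.succ_le_of_lt hi)
    exact hstab i k
  rw [image_Iic_eq_iInter hΦ, Antitone.measure_iInter]
  · exact le_iInf fun n => (hb n).le.trans (by rw [hbox]; exact measure_mono subset_closure)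
  · intro n n' hnn
    exact closure_mono (image_mono fun z hz i hi => hz i (hi.trans_le hnn))
  · exact fun n => isClosed_closure.measurableSet.nullMeasurableSet
  · exact ⟨0, measure_ne_top _ _⟩

theorem measurableSet_image_Iic [T2Space X] [MeasurableSpace X] [OpensMeasurableSpace X]
    {Φ : (ℕ → ℕ) → X} (hΦ : Continuous Φ) (β : ℕ → ℕ) : MeasurableSet (Φ '' Iic β) := by
  rw [image_Iic_eq_iInter hΦ]
  exact MeasurableSet.iInter fun n => isClosed_closure.measurableSet

theorem _root_.MeasureTheory.AnalyticSet.univComp [T2Space X] [MeasurableSpace X]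
    [OpensMeasurableSpace X] {s : Set X} (hs : AnalyticSet s) : MeasurableSet[univComp X] s := by
  intro μ hμ
  rw [AnalyticSet] at hs
  rcases hs with rfl | ⟨Φ, hΦ, rfl⟩
  · exact MeasurableSet.empty.nullMeasurableSet
  by_cases h0 : μ (range Φ) = 0
  · exact NullMeasurableSet.of_null h0
  obtain ⟨u, -, hu, hlim⟩ := exists_seq_strictMono_tendsto' (pos_iff_ne_zero.2 h0)
  choose β hβ using fun n => exists_le_measure_image_Iic hΦ μ (hu n).2
  have hsub : (⋃ n, Φ '' Iic (β n)) ⊆ range Φ := iUnion_subset fun n => image_subset_range _ _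
  have hm : MeasurableSet (⋃ n, Φ '' Iic (β n)) :=
    MeasurableSet.iUnion fun n => measurableSet_image_Iic hΦ _
  have hle : μ (range Φ) ≤ μ (⋃ n, Φ '' Iic (β n)) :=
    le_of_tendsto' hlim fun n =>
      (hβ n).trans (measure_mono (subset_iUnion (fun n => Φ '' Iic (β n)) n))
  exact hm.nullMeasurableSet.congr
    (ae_eq_of_subset_of_measure_ge hsub hle hm.nullMeasurableSet (measure_ne_top _ _))

/-- Kernel sections of analytic sets have analytic superlevel sets. -/
theorem analyticSet_lt_kernel {Z Y : Type*} [TopologicalSpace Z] [PolishSpace Z]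
    [MeasurableSpace Z] [BorelSpace Z] [TopologicalSpace Y] [PolishSpace Y] [MeasurableSpace Y]
    [BorelSpace Y] (κ : ProbabilityTheory.Kernel Z Y) [ProbabilityTheory.IsMarkovKernel κ]
    {A : Set (Z × Y)} (hA : AnalyticSet A) (r : ℝ≥0∞) :
    AnalyticSet {z | r < κ z (Prod.mk z ⁻¹' A)} := by
  have hA' := hA.univComp
  rw [AnalyticSet] at hA
  rcases hA with rfl | ⟨Φ, hΦ, rfl⟩
  · simpa using analyticSet_empty
  let D : Set (((ℕ → ℕ) × Z) × Y) := {q | (q.1.2, q.2) ∈ Φ '' Iic q.1.1}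
  have hD : MeasurableSet D := by
    have : D = ⋂ n, ⋃ s : Fin n → ℕ, {q | (∀ i : Fin n, q.1.1 i = s i) ∧
        (q.1.2, q.2) ∈ closure (Φ '' initBox n (fun i => if h : i < n then s ⟨i, h⟩ else 0))} := by
      ext q
      simp only [D, image_Iic_eq_iInter hΦ, mem_iInter, mem_iUnion, Set.mem_ofPred_eq]
      refine forall_congr' fun n => ⟨fun h => ⟨fun i => q.1.1 i, fun i => rfl, ?_⟩, ?_⟩
      · rw [initBox_congr (β' := q.1.1)]
        · exact h
        · intro i hi; simp [hi]
      · rintro ⟨s, hs, h⟩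
        rw [initBox_congr (β' := q.1.1)] at h
        · exact h
        · intro i hi; simpa [hi] using (hs ⟨i, hi⟩).symm
    rw [this]
    refine MeasurableSet.iInter fun n => MeasurableSet.iUnion fun s => ?_
    have h1 : MeasurableSet {q : ((ℕ → ℕ) × Z) × Y | ∀ i : Fin n, q.1.1 i = s i} := by
      rw [ofPred_forall]
      exact MeasurableSet.iInter fun i => measurableSet_eq_fun
        ((measurable_pi_apply (i : ℕ)).comp (measurable_fst.comp measurable_fst)) measurable_const
    exact h1.inter (((measurable_snd.comp measurable_fst).prodMk measurable_snd)
        isClosed_closure.measurableSet)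
  let κ' : ProbabilityTheory.Kernel ((ℕ → ℕ) × Z) Y := κ.comap Prod.snd measurable_snd
  have hmeas : MeasurableSet {q : (ℕ → ℕ) × Z | r < κ' q (Prod.mk q ⁻¹' D)} :=
    measurableSet_lt measurable_const (ProbabilityTheory.Kernel.measurable_kernel_prodMk_left hD)
  have hset : {z | r < κ z (Prod.mk z ⁻¹' range Φ)}
      = Prod.snd '' {q : (ℕ → ℕ) × Z | r < κ' q (Prod.mk q ⁻¹' D)} := by
    ext z
    have hmap : ∀ s, MeasurableSet[univComp (Z × Y)] s →
        (κ z).map (Prod.mk z) s = κ z (Prod.mk z ⁻¹' s) := fun s hs =>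
      Measure.map_apply₀ measurable_prodMk_left.aemeasurable (nullMeasurableSet_of_univComp hs _)
    simp only [Set.mem_ofPred_eq, mem_image, Prod.exists, exists_eq_right]
    constructor
    · intro h
      rw [← hmap _ hA'] at h
      obtain ⟨r', hr, hr'⟩ := exists_between h
      obtain ⟨β, hβ⟩ := exists_le_measure_image_Iic hΦ _ hr'
      rw [hmap _ (measurableSet_univComp (measurableSet_image_Iic hΦ _))] at hβ
      exact ⟨β, hr.trans_le hβ⟩
    · rintro ⟨β, hβ⟩
      refine hβ.trans_le (measure_mono ?_)
      intro y hy
      exact image_subset_range _ _ hy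
  rw [hset]
  exact hmeas.analyticSet.image_of_continuous continuous_snd

end Analytic

end BN

namespace BN

/-! ### Measurable selection -/

section Selection

variable {X : Type*} [TopologicalSpace X] [T2Space X] [MeasurableSpace X] [OpensMeasurableSpace X]

theorem exists_uMeas_section {π : (ℕ → ℕ) → X} (hπ : Continuous π) :
    ∃ s : X → ℕ → ℕ, UMeas s ∧ ∀ x ∈ range π, π (s x) = x := by
  classical
  let G : List ℕ → Set X := fun l => π '' {z | PiNat.res z l.length = l}
  have hG : ∀ l, MeasurableSet[univComp X] (G l) := fun l => by
    have hcl : IsClosed {z : ℕ → ℕ | PiNat.res z l.length = l} := by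
      rw [← isOpen_compl_iff, isOpen_iff_mem_nhds]
      intro z hz
      filter_upwards [(PiNat.isOpen_cylinder _ z l.length).mem_nhds
        (PiNat.self_mem_cylinder _ _)] with y hy hy'
      rw [PiNat.cylinder_eq_res] at hy
      exact hz (hy.symm.trans hy')
    exact (hcl.analyticSet.image_of_continuous hπ).univComp
  have hex : ∀ (l : List ℕ) (x : X), ∃ m, x ∈ G (m :: l) ∨ ∀ j, x ∉ G (j :: l) := by
    intro l x
    by_cases h : ∃ m, x ∈ G (m :: l)
    · exact h.imp fun _ h => Or.inl h
    · exact ⟨0, Or.inr (by simpa using h)⟩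
  let m : List ℕ → X → ℕ := fun l x => Nat.find (hex l x)
  have hm : ∀ l, UMeas (m l) := by
    intro l
    let _ : MeasurableSpace X := univComp X
    refine measurable_find (hex l) fun k => ?_
    refine MeasurableSet.union (hG _) ?_
    change MeasurableSet {x | ∀ j, x ∉ G (j :: l)}
    rw [ofPred_forall]
    exact MeasurableSet.iInter fun j => (hG _).compl
  let L : X → ℕ → List ℕ := fun x n => Nat.rec [] (fun _ l => m l x :: l) n
  have hLs : ∀ x n, L x (n + 1) = m (L x n) x :: L x n := fun x n => rfl
  have hL : ∀ n l, MeasurableSet[univComp X] {x | L x n = l} := by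
    intro n
    let _ : MeasurableSpace X := univComp X
    induction n with
    | zero => intro l; exact MeasurableSet.const ([] = l)
    | succ n ih =>
      rintro (_ | ⟨k, l⟩)
      · simp only [hLs]
        simp
      · have : {x | L x (n + 1) = k :: l} = {x | L x n = l} ∩ {x | m l x = k} := by
          ext x
          simp only [hLs, List.cons.injEq, Set.mem_ofPred_eq, mem_inter_iff]
          constructor
          · rintro ⟨h1, h2⟩; exact ⟨h2, h2 ▸ h1⟩
          · rintro ⟨h1, h2⟩; exact ⟨h1 ▸ h2, h1⟩
        rw [this]
        exact (ih l).inter (hm l (measurableSet_singleton k))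
  refine ⟨fun x n => m (L x n) x, ?_, ?_⟩
  · let _ : MeasurableSpace X := univComp X
    refine measurable_pi_lambda _ fun n => measurable_to_countable' fun k => ?_
    have : (fun x => m (L x n) x) ⁻¹' {k} = ⋃ l, {x | L x n = l} ∩ {x | m l x = k} := by
      ext x; simp
    rw [this]
    exact MeasurableSet.iUnion fun l => (hL n l).inter (hm l (measurableSet_singleton k))
  · rintro x ⟨z₀, rfl⟩
    set x := π z₀
    set s : ℕ → ℕ := fun n => m (L x n) x with hs
    have hres : ∀ n, PiNat.res s n = L x n := by
      intro n
      induction n with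
      | zero => rfl
      | succ n ih => rw [PiNat.res_succ, ih]
    have hmem : ∀ n, x ∈ G (L x n) := by
      intro n
      induction n with
      | zero => exact ⟨z₀, rfl, rfl⟩
      | succ n ih =>
        have hlen : (L x n).length = n := by rw [← hres, PiNat.res_length]
        obtain ⟨z, hz, hzx⟩ := ih
        have h1 : x ∈ G (z n :: L x n) := by
          refine ⟨z, ?_, hzx⟩
          simp only [Set.mem_ofPred_eq, List.length_cons, PiNat.res_succ, hlen] at hz ⊢
          rw [hz]
        rcases Nat.find_spec (hex (L x n) x) with h | h
        · exact h
        · exact absurd h1 (h _)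
    choose z hz hzx using hmem
    have hlim : Tendsto z atTop (𝓝 s) := by
      refine tendsto_pi_nhds.2 fun i => tendsto_const_nhds.congr' ?_
      filter_upwards [eventually_gt_atTop i] with n hn
      have h := hz n
      have hlen : (L x n).length = n := by rw [← hres, PiNat.res_length]
      rw [Set.mem_ofPred_eq, hlen, ← hres n] at h
      exact (PiNat.res_eq_res.1 h hn).symm
    exact tendsto_nhds_unique ((hπ.tendsto s).comp hlim)
      (tendsto_const_nhds.congr fun n => (hzx n).symm)

variable {Z : Type*} [TopologicalSpace Z] [MeasurableSpace Z] [BorelSpace Z]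

/-- The Jankov–von Neumann selection theorem, with a default selector `σ₀`. -/
theorem exists_uMeas_selection {A : Set Z} (hA : AnalyticSet A) {p : Z → X} (hp : Continuous p)
    {σ₀ : X → Z} (hσ₀ : UMeas σ₀) :
    ∃ σ : X → Z, UMeas σ ∧ (∀ x ∈ p '' A, σ x ∈ A ∧ p (σ x) = x) ∧
      ∀ x ∉ p '' A, σ x = σ₀ x := by
  classical
  have hpA : MeasurableSet[univComp X] (p '' A) := (hA.image_of_continuous hp).univComp
  rw [AnalyticSet] at hA
  rcases hA with rfl | ⟨Φ, hΦ, rfl⟩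
  · exact ⟨σ₀, hσ₀, by simp, by simp⟩
  obtain ⟨s, hs, hsx⟩ := exists_uMeas_section (hp.comp hΦ)
  refine ⟨fun x => if x ∈ p '' range Φ then Φ (s x) else σ₀ x,
    UMeas.ite hpA (hΦ.measurable.comp_uMeas hs) hσ₀, fun x hx => ?_, fun x hx => if_neg hx⟩
  simp only [if_pos hx]
  exact ⟨mem_range_self _, hsx x (by rwa [range_comp])⟩

theorem exists_uMeas_selection' {A : Set Z} (hA : AnalyticSet A) {p : Z → X} (hp : Continuous p)
    (hpA : ∀ x, ∃ z ∈ A, p z = x) : ∃ σ : X → Z, UMeas σ ∧ ∀ x, σ x ∈ A ∧ p (σ x) = x := by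
  by_cases hX : Nonempty X
  · obtain ⟨z₀, -⟩ := hpA hX.some
    obtain ⟨σ, h1, h2, -⟩ := exists_uMeas_selection hA hp (σ₀ := fun _ => z₀)
      (measurable_const.uMeas)
    exact ⟨σ, h1, fun x => h2 x (hpA x)⟩
  · have := not_nonempty_iff.1 hX
    exact ⟨isEmptyElim, (measurable_of_empty _).uMeas, isEmptyElim⟩

end Selection

end BN

namespace BN

/-! ### Measures on Polish spaces -/

section Measures

variable {Y : Type*} [TopologicalSpace Y] [PolishSpace Y] [MeasurableSpace Y] [BorelSpace Y]

theorem measurable_coe_borel_probabilityMeasure :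
    @Measurable (ProbabilityMeasure Y) (Measure Y) (borel _) _ (fun P => (P : Measure Y)) := by
  let _ : MeasurableSpace (ProbabilityMeasure Y) := borel _
  have : BorelSpace (ProbabilityMeasure Y) := ⟨rfl⟩
  refine Measurable.measure_of_isPiSystem_of_isProbabilityMeasure (S := {s | IsClosed s})
    (by rw [BorelSpace.measurable_eq (α := Y), borel_eq_generateFrom_isClosed])
    isPiSystem_isClosed fun F (hF : IsClosed F) => ?_
  refine measurable_of_tendsto_metrizable (f := fun n (P : ProbabilityMeasure Y) =>
      ∫⁻ x, hF.apprSeq n x ∂(P : Measure Y)) (fun n => Continuous.measurable ?_)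
    (tendsto_pi_nhds.2 fun P => HasOuterApproxClosed.tendsto_lintegral_apprSeq hF _)
  exact continuous_iff_continuousAt.2 fun P =>
    ProbabilityMeasure.tendsto_iff_forall_lintegral_tendsto.1 tendsto_id (hF.apprSeq n)

variable (Y) in
/-- There is a countable family of open sets testing inequalities between finite measures. -/
theorem exists_open_testing_family : ∃ O : ℕ → Set Y, (∀ k, IsOpen (O k)) ∧
    ∀ μ ν : Measure Y, IsFiniteMeasure μ → IsFiniteMeasure ν → (∀ k, μ (O k) ≤ ν (O k)) →
      μ ≤ ν := by
  let B := TopologicalSpace.countableBasis Y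
  have hB : {s : Set (Set Y) | s.Finite ∧ s ⊆ B}.Countable :=
    countable_ofPred_finite_subset (TopologicalSpace.countable_countableBasis Y)
  obtain ⟨e, he⟩ := hB.exists_eq_range ⟨∅, finite_empty, empty_subset _⟩
  have hmem : ∀ k, (e k).Finite ∧ e k ⊆ B := fun k => he.symm.subset (mem_range_self k)
  refine ⟨fun k => ⋃₀ e k, fun k => ?_, fun μ ν _ _ h => ?_⟩
  · exact isOpen_sUnion fun s hs => TopologicalSpace.isOpen_of_mem_countableBasis ((hmem k).2 hs)
  have hopen : ∀ V : Set Y, IsOpen V → μ V ≤ ν V := by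
    intro V hV
    let C : Set (Set Y) := {s ∈ B | s ⊆ V}
    have hC : C.Countable := (TopologicalSpace.countable_countableBasis Y).mono (sep_subset _ _)
    have hVC : V = ⋃₀ C := (TopologicalSpace.isBasis_countableBasis Y).open_eq_sUnion' hV
    have hne : C.Nonempty ∨ C = ∅ := (eq_empty_or_nonempty C).symm
    rcases hne with hne | hne
    swap
    · rw [hVC, hne]; simp
    obtain ⟨c, hc⟩ := hC.exists_eq_range hne
    have hVU : V = ⋃ n, ⋃₀ (c '' Iio n) := by
      rw [hVC, hc]
      ext y
      simp only [mem_sUnion, mem_range, exists_exists_eq_and, mem_iUnion, mem_image, mem_Iio]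
      constructor
      · rintro ⟨i, hi⟩; exact ⟨i + 1, c i, ⟨i, by omega, rfl⟩, hi⟩
      · rintro ⟨n, -, ⟨i, -, rfl⟩, hi⟩; exact ⟨i, hi⟩
    have hmono : Monotone fun n => ⋃₀ (c '' Iio n) := fun n m hnm =>
      sUnion_subset_sUnion (image_mono (Iio_subset_Iio hnm))
    rw [hVU, hmono.measure_iUnion, hmono.measure_iUnion]
    refine iSup_mono fun n => ?_
    have : c '' Iio n ∈ range e := by
      rw [← he]
      refine ⟨(finite_Iio n).image c, ?_⟩
      rintro _ ⟨i, -, rfl⟩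
      have : c i ∈ C := hc ▸ mem_range_self i
      exact this.1
    obtain ⟨k, hk⟩ := this
    rw [← hk]
    exact h k
  refine Measure.le_iff'.2 fun s => ?_
  rw [s.measure_eq_iInf_isOpen ν]
  exact le_iInf₂ fun V hV => le_iInf fun hVo => (measure_mono hV).trans (hopen V hVo)

variable (Y) in
/-- A countable family of open sets testing inequalities between finite measures. -/
def testOpen : ℕ → Set Y := (exists_open_testing_family Y).choose

theorem isOpen_testOpen (k : ℕ) : IsOpen (testOpen Y k) :=
  (exists_open_testing_family Y).choose_spec.1 k

theorem measurableSet_testOpen (k : ℕ) : MeasurableSet (testOpen Y k) :=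
  (isOpen_testOpen k).measurableSet

theorem le_of_testOpen {μ ν : Measure Y} [IsFiniteMeasure μ] [IsFiniteMeasure ν]
    (h : ∀ k, μ (testOpen Y k) ≤ ν (testOpen Y k)) : μ ≤ ν :=
  (exists_open_testing_family Y).choose_spec.2 μ ν inferInstance inferInstance h

end Measures

/-- A parametrization of the one-step models: the models at `x` are the measures `k z` with
`p z = x`. -/
structure Step (X Y : Type) [TopologicalSpace X] [MeasurableSpace Y] where
  /-- the base point of a parameter -/
  p : (ℕ → ℕ) → X
  /-- the model with a given parameter -/
  k : ProbabilityTheory.Kernel (ℕ → ℕ) Y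
  continuous_p : Continuous p
  surj : ∀ x, ∃ z, p z = x
  markov : ProbabilityTheory.IsMarkovKernel k
  convex : ∀ z z', p z = p z' → ∀ a b : ℝ≥0∞, a + b = 1 →
    ∃ z'', p z'' = p z ∧ k z'' = a • k z + b • k z'

attribute [instance] Step.markov

section Step

variable {X Y : Type} [TopologicalSpace X] [PolishSpace X] [MeasurableSpace X] [BorelSpace X]
  [TopologicalSpace Y] [PolishSpace Y] [MeasurableSpace Y] [BorelSpace Y]

theorem exists_step {Pt : X → Set (ProbabilityMeasure Y)} (hne : ∀ x, (Pt x).Nonempty)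
    (hconv : ∀ x, ConvexPM (Pt x))
    (hgraph : AnalyticSet {q : X × ProbabilityMeasure Y | q.2 ∈ Pt q.1}) [Nonempty X] :
    ∃ s : Step X Y, (∀ z, ∃ P ∈ Pt (s.p z), (P : Measure Y) = s.k z) ∧
      (∀ x, ∀ P ∈ Pt x, ∃ z, s.p z = x ∧ s.k z = P) ∧
      ∀ σ : X → (ℕ → ℕ), UMeas σ → (∀ x, s.p (σ x) = x) →
        ∃ κ : X → ProbabilityMeasure Y, @Measurable _ _ (univComp X) (borel _) κ ∧
          (∀ x, κ x ∈ Pt x) ∧ ∀ x, (κ x : Measure Y) = s.k (σ x) := by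
  rw [AnalyticSet] at hgraph
  rcases hgraph with h | ⟨Φ, hΦ, hr⟩
  · obtain ⟨P, hP⟩ := hne (Classical.arbitrary X)
    have : (Classical.arbitrary X, P) ∈ (∅ : Set (X × ProbabilityMeasure Y)) := h ▸ hP
    exact this.elim
  have hmemΦ : ∀ z, (Φ z).2 ∈ Pt (Φ z).1 := fun z => hr.subset (mem_range_self z)
  have hsurjΦ : ∀ x, ∀ P ∈ Pt x, ∃ z, Φ z = (x, P) := fun x P hP =>
    hr.symm.subset (show (x, P) ∈ _ from hP)
  have hc2 : Continuous fun z => (Φ z).2 := continuous_snd.comp hΦ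
  let k : ProbabilityTheory.Kernel (ℕ → ℕ) Y := ⟨fun z => ((Φ z).2 : Measure Y), by
    let _ : MeasurableSpace (ProbabilityMeasure Y) := borel _
    have : BorelSpace (ProbabilityMeasure Y) := ⟨rfl⟩
    exact measurable_coe_borel_probabilityMeasure.comp hc2.measurable⟩
  have hk : ∀ z, k z = ((Φ z).2 : Measure Y) := fun z => rfl
  refine ⟨⟨fun z => (Φ z).1, k, continuous_fst.comp hΦ, ?_, ⟨fun z => ?_⟩, ?_⟩, ?_, ?_, ?_⟩
  · intro x
    obtain ⟨P, hP⟩ := hne x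
    obtain ⟨z, hz⟩ := hsurjΦ x P hP
    exact ⟨z, by rw [hz]⟩
  · rw [hk]; infer_instance
  · intro z z' hzz a b hab
    let ξ : ProbabilityMeasure Y := ⟨a • k z + b • k z', ⟨by simp [hk, hab]⟩⟩
    have hξ : ξ ∈ Pt (Φ z).1 :=
      hconv _ (Φ z).2 (hmemΦ z) (Φ z').2 (by rw [hzz]; exact hmemΦ z') a b hab ξ rfl
    obtain ⟨z'', hz''⟩ := hsurjΦ _ _ hξ
    refine ⟨z'', by rw [hz''], ?_⟩
    rw [hk, hz'']
    rfl
  · exact fun z => ⟨_, hmemΦ z, rfl⟩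
  · intro x P hP
    obtain ⟨z, hz⟩ := hsurjΦ x P hP
    exact ⟨z, by change (Φ z).1 = x; rw [hz], by change ((Φ z).2 : Measure Y) = P; rw [hz]⟩
  · intro σ hσ hσp
    refine ⟨fun x => (Φ (σ x)).2, ?_, fun x => ?_, fun x => rfl⟩
    · let _ : MeasurableSpace (ProbabilityMeasure Y) := borel _
      have : BorelSpace (ProbabilityMeasure Y) := ⟨rfl⟩
      exact hc2.measurable.comp_uMeas hσ
    · have := hmemΦ (σ x)
      rwa [show (Φ (σ x)).1 = x from hσp x] at this

/-- A universally measurable choice of models lifts to a choice of parameters. -/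
theorem Step.exists_lift (s : Step X Y) {κ : X → ProbabilityMeasure Y}
    (hκ : @Measurable _ _ (univComp X) (borel _) κ) (h : ∀ x, ∃ z, s.p z = x ∧ s.k z = κ x) :
    ∃ σ : X → (ℕ → ℕ), UMeas σ ∧ ∀ x, s.p (σ x) = x ∧ s.k (σ x) = κ x := by
  let A : Set ((ℕ → ℕ) × (ℕ → ℝ)) := {q | ∀ j, q.2 j = (s.k q.1).real (testOpen Y j)}
  have hA : MeasurableSet A := by
    simp only [A, ofPred_forall]
    refine MeasurableSet.iInter fun j => measurableSet_eq_fun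
      ((measurable_pi_apply j).comp measurable_snd) ?_
    exact ((s.k.measurable_coe (measurableSet_testOpen j)).comp measurable_fst).ennreal_toReal
  have hp : Continuous fun q : (ℕ → ℕ) × (ℕ → ℝ) => (s.p q.1, q.2) :=
    (s.continuous_p.comp continuous_fst).prodMk continuous_snd
  obtain ⟨σ, hσ, hσA, -⟩ := exists_uMeas_selection hA.analyticSet hp (σ₀ := fun _ => (0, 0))
    measurable_const.uMeas
  let v : X → ℕ → ℝ := fun x j => (κ x : Measure Y).real (testOpen Y j)
  have hv : UMeas v := by
    let _ : MeasurableSpace (ProbabilityMeasure Y) := borel _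
    have h1 : UMeas fun x => (κ x : Measure Y) := measurable_coe_borel_probabilityMeasure.comp hκ
    refine Measurable.comp_uMeas (g := fun (μ : Measure Y) j => μ.real (testOpen Y j)) ?_ h1
    exact measurable_pi_lambda _ fun j =>
      (Measure.measurable_coe (measurableSet_testOpen j)).ennreal_toReal
  refine ⟨fun x => (σ (x, v x)).1,
    measurable_fst.comp_uMeas (hσ.comp (measurable_id.uMeas.prodMk hv)), fun x => ?_⟩
  obtain ⟨z, hz, hzκ⟩ := h x
  have hmem := hσA (x, v x) ⟨(z, v x), fun j => by simp only [v, hzκ], by rw [← hz]⟩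
  obtain ⟨h1, h2⟩ := hmem
  rw [Prod.ext_iff] at h2
  refine ⟨h2.1, ?_⟩
  have heq : ∀ j, s.k (σ (x, v x)).1 (testOpen Y j) = (κ x : Measure Y) (testOpen Y j) := by
    intro j
    have h3 := h1 j
    rw [h2.2] at h3
    exact ((measureReal_eq_measureReal_iff).1 h3).symm
  exact le_antisymm (le_of_testOpen fun j => (heq j).le) (le_of_testOpen fun j => (heq j).ge)

end Step

end BN

namespace BN

/-! ### Separation and martingale densities in one step -/

/-- Proper separation of the origin from a convex set in finite dimension. -/
theorem exists_properly_separating {E : Type*} [NormedAddCommGroup E] [NormedSpace ℝ E]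
    [FiniteDimensional ℝ E] {C : Set E} (hC : Convex ℝ C) (hne : C.Nonempty) (h0 : (0 : E) ∉ C) :
    ∃ ℓ : E →ₗ[ℝ] ℝ, (∀ c ∈ C, 0 ≤ ℓ c) ∧ ∃ c ∈ C, 0 < ℓ c := by
  let V := Submodule.span ℝ C
  let K : Set V := {v | ∃ t : ℝ, 0 < t ∧ ∃ c ∈ C, (v : E) = t • c}
  have hmemV : ∀ c ∈ C, c ∈ V := fun c hc => Submodule.subset_span hc
  have hCK : ∀ c (hc : c ∈ C), (⟨c, hmemV c hc⟩ : V) ∈ K := fun c hc => ⟨1, one_pos, c, hc, by simp⟩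
  have hK : Convex ℝ K := by
    rintro v ⟨t, ht, c, hc, hv⟩ v' ⟨t', ht', c', hc', hv'⟩ a b ha hb hab
    have hpos : 0 < a * t + b * t' := by
      rcases ha.eq_or_lt with rfl | ha
      · have : b = 1 := by linarith
        subst this; simpa using ht'
      · have := mul_nonneg hb ht'.le
        have := mul_pos ha ht
        linarith
    refine ⟨a * t + b * t', hpos, ((a * t) / (a * t + b * t')) • c
      + ((b * t') / (a * t + b * t')) • c', ?_, ?_⟩
    · refine hC hc hc' (by positivity) (by positivity) ?_
      field_simp
    · simp only [Submodule.coe_add, Submodule.coe_smul, hv, hv', smul_add, smul_smul]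
      congr 2 <;> field_simp
  have h0K : (0 : V) ∉ K := by
    rintro ⟨t, ht, c, hc, h⟩
    have : c = 0 := by simpa [ht.ne'] using h.symm
    exact h0 (this ▸ hc)
  have hKne : K.Nonempty := hne.elim fun c hc => ⟨_, hCK c hc⟩
  have hInt : (interior K).Nonempty := by
    rw [hK.interior_nonempty_iff_affineSpan_eq_top,
      AffineSubspace.affineSpan_eq_top_iff_vectorSpan_eq_top_of_nonempty ℝ V V hKne, eq_top_iff,
      ← Submodule.span_span_coe_preimage (R := ℝ) (s := C), Submodule.span_le]
    intro v hv
    have h1 : v ∈ K := hCK v hv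
    have h2 : (2 : ℝ) • v ∈ K := ⟨2, two_pos, v, hv, rfl⟩
    have := vsub_mem_vectorSpan ℝ h2 h1
    rw [vsub_eq_sub, two_smul, add_sub_cancel_right] at this
    exact this
  obtain ⟨f, hf⟩ := geometric_hahn_banach_open_point hK.interior isOpen_interior
    (fun h => h0K (interior_subset h))
  simp only [map_zero] at hf
  have hle : ∀ v ∈ K, f v ≤ 0 := by
    intro v hv
    have h1 : v ∈ closure (interior K) :=
      (hK.closure_interior_eq_closure_of_nonempty_interior hInt).symm ▸ subset_closure hv
    exact closure_minimal (fun x hx => (hf x hx).le) (isClosed_Iic.preimage f.continuous) h1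
  obtain ⟨ℓ, hℓ⟩ := LinearMap.exists_extend (-(f : V →ₗ[ℝ] ℝ))
  have hℓV : ∀ v : V, ℓ v = - f v := fun v => by
    have := LinearMap.congr_fun hℓ v
    simpa using this
  refine ⟨ℓ, fun c hc => ?_, ?_⟩
  · have := hle _ (hCK c hc)
    have h2 := hℓV ⟨c, hmemV c hc⟩
    simp only at h2
    linarith
  · obtain ⟨v, hv⟩ := hInt
    obtain ⟨t, ht, c, hc, hvc⟩ := interior_subset hv
    refine ⟨c, hc, ?_⟩
    have h1 := hf v hv
    have h2 := hℓV v
    rw [hvc, map_smul, smul_eq_mul] at h2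
    by_contra hcon
    have := mul_nonpos_of_nonneg_of_nonpos ht.le (not_lt.1 hcon)
    linarith

section Density

variable {Y : Type*} [TopologicalSpace Y] [PolishSpace Y] [MeasurableSpace Y] [BorelSpace Y]

/-- A countably parametrized family of simple densities bounded below by one. -/
def dens (θ : ℕ × (ℕ → ℝ)) (y : Y) : ℝ :=
  1 + ∑ k ∈ Finset.range θ.1, |θ.2 k| * (testOpen Y k).indicator 1 y

theorem one_le_dens (θ : ℕ × (ℕ → ℝ)) (y : Y) : 1 ≤ dens θ y := by
  refine le_add_of_nonneg_right (Finset.sum_nonneg fun k _ => mul_nonneg (abs_nonneg _) ?_)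
  exact indicator_nonneg (fun _ _ => zero_le_one) _

theorem dens_pos (θ : ℕ × (ℕ → ℝ)) (y : Y) : 0 < dens θ y := zero_lt_one.trans_le (one_le_dens θ y)

theorem dens_le (θ : ℕ × (ℕ → ℝ)) (y : Y) :
    dens θ y ≤ 1 + ∑ k ∈ Finset.range θ.1, |θ.2 k| := by
  refine add_le_add_right (Finset.sum_le_sum fun k _ => ?_) 1
  refine mul_le_of_le_one_right (abs_nonneg _) ?_
  exact indicator_apply_le' (fun _ => le_rfl) fun _ => zero_le_one

theorem measurable_dens : Measurable fun q : (ℕ × (ℕ → ℝ)) × Y => dens q.1 q.2 := by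
  have h1 : Measurable fun q : ℕ × ((ℕ → ℝ) × Y) =>
      ∑ k ∈ Finset.range q.1, |q.2.1 k| * (testOpen Y k).indicator 1 q.2.2 := by
    refine measurable_from_prod_countable_right fun n => ?_
    have h3 : ∀ k, Measurable fun q : (ℕ → ℝ) × Y =>
        |q.1 k| * (testOpen Y k).indicator (1 : Y → ℝ) q.2 := fun k => by
      have h4 : Measurable fun q : (ℕ → ℝ) × Y => |q.1 k| := by fun_prop
      exact h4.mul ((measurable_one.indicator (measurableSet_testOpen k)).comp measurable_snd)
    exact Finset.measurable_fun_sum (Finset.range n) fun k _ => h3 k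
  have h2 : Measurable fun q : (ℕ × (ℕ → ℝ)) × Y => (q.1.1, (q.1.2, q.2)) :=
    measurable_fst.fst.prodMk (measurable_fst.snd.prodMk measurable_snd)
  exact (h1.comp h2).const_add 1

theorem integrable_dens_mul (θ : ℕ × (ℕ → ℝ)) {P : Measure Y} {h : Y → ℝ} (hh : Integrable h P) :
    Integrable (fun y => dens θ y * h y) P := by
  refine hh.bdd_mul (c := 1 + ∑ k ∈ Finset.range θ.1, |θ.2 k|)
    (measurable_dens.comp measurable_prodMk_left).aestronglyMeasurable (ae_of_all _ fun y => ?_)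
  rw [Real.norm_of_nonneg (dens_pos θ y).le]
  exact dens_le θ y

theorem ae_nonpos_of_testOpen {P : Measure Y} [IsFiniteMeasure P] {h : Y → ℝ}
    (hh : Integrable h P) (hO : ∀ j, ∫ y in testOpen Y j, h y ∂P ≤ 0) : ∀ᵐ y ∂P, h y ≤ 0 := by
  have hfin1 : IsFiniteMeasure (P.withDensity fun y => ENNReal.ofReal (h y)) :=
    isFiniteMeasure_withDensity_ofReal hh.2
  have hfin2 : IsFiniteMeasure (P.withDensity fun y => ENNReal.ofReal (-h y)) :=
    isFiniteMeasure_withDensity_ofReal hh.neg.2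
  have key : ∀ s, MeasurableSet s → (∫ y in s, h y ∂P ≤ 0 ↔
      P.withDensity (fun y => ENNReal.ofReal (h y)) s
        ≤ P.withDensity (fun y => ENNReal.ofReal (-h y)) s) := by
    intro s hs
    have h1 : ∫⁻ y in s, ENNReal.ofReal (h y) ∂P ≠ ∞ := by
      rw [← withDensity_apply _ hs]; exact measure_ne_top _ _
    have h2 : ∫⁻ y in s, ENNReal.ofReal (-h y) ∂P ≠ ∞ := by
      rw [← withDensity_apply _ hs]; exact measure_ne_top _ _
    rw [integral_eq_lintegral_pos_part_sub_lintegral_neg_part hh.restrict, sub_nonpos,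
      ENNReal.toReal_le_toReal h1 h2, withDensity_apply _ hs, withDensity_apply _ hs]
  have hle := le_of_testOpen fun j => (key _ (measurableSet_testOpen j)).1 (hO j)
  have h3 : 0 ≤ᵐ[P] fun y => -h y :=
    ae_nonneg_of_forall_setIntegral_nonneg hh.neg fun s hs _ => by
      rw [integral_neg, neg_nonneg]
      exact (key s hs).2 (hle s)
  filter_upwards [h3] with y hy
  simpa using hy

/-- The average of two densities is again a density. -/
theorem exists_dens_convex (θ θ' : ℕ × (ℕ → ℝ)) {a b : ℝ} (ha : 0 ≤ a) (hb : 0 ≤ b)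
    (hab : a + b = 1) : ∃ θ'', ∀ y : Y, dens θ'' y = a * dens θ y + b * dens θ' y := by
  have hext : ∀ (θ : ℕ × (ℕ → ℝ)) (N : ℕ), θ.1 ≤ N → ∀ y : Y,
      ∑ k ∈ Finset.range θ.1, |θ.2 k| * (testOpen Y k).indicator 1 y
        = ∑ k ∈ Finset.range N, (if k < θ.1 then |θ.2 k| else 0) * (testOpen Y k).indicator 1 y := by
    intro θ N hN y
    rw [← Finset.sum_subset (Finset.range_mono hN)]
    · refine Finset.sum_congr rfl fun k hk => ?_
      rw [if_pos (Finset.mem_range.1 hk)]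
    · intro k _ hk
      rw [if_neg (by simpa using hk), zero_mul]
  refine ⟨(max θ.1 θ'.1, fun k => a * (if k < θ.1 then |θ.2 k| else 0)
    + b * (if k < θ'.1 then |θ'.2 k| else 0)), fun y => ?_⟩
  have hnn : ∀ k, 0 ≤ a * (if k < θ.1 then |θ.2 k| else 0)
      + b * (if k < θ'.1 then |θ'.2 k| else 0) := fun k => by
    refine add_nonneg (mul_nonneg ha ?_) (mul_nonneg hb ?_) <;> split_ifs <;> positivity
  simp only [dens, abs_of_nonneg (hnn _)]
  rw [hext θ _ (le_max_left _ _), hext θ' _ (le_max_right _ _)]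
  simp only [add_mul, Finset.sum_add_distrib, mul_add, Finset.mul_sum, mul_assoc]
  linarith

/-- A one-step alternative: either a direction dominates, or a martingale density exists. -/
theorem exists_dens {d : ℕ} {P : Measure Y} [IsProbabilityMeasure P] {X : Y → Fin d → ℝ}
    {w : ℕ → Y → ℝ} (hX : ∀ i, Integrable (fun y => X y i) P) (hw : ∀ n, Integrable (w n) P)
    (hmono : ∀ y, Monotone fun n => w n y)
    (hyp : ∀ (u : Fin d → ℝ) (c : ℝ), 0 ≤ c →
      (∀ n, ∀ᵐ y ∂P, (∑ i, u i * X y i) + c * w n y ≤ 0) →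
        c = 0 ∧ ∀ᵐ y ∂P, ∑ i, u i * X y i = 0) :
    ∃ n θ, (∀ i, ∫ y, dens θ y * X y i ∂P = 0) ∧ 0 < ∫ y, dens θ y * w n y ∂P := by
  let Γ : Set ((Fin d → ℝ) × ℝ) := {v | ∃ n θ, (∀ i, v.1 i = ∫ y, dens θ y * X y i ∂P) ∧
    v.2 < ∫ y, dens θ y * w n y ∂P}
  by_cases h0 : (0 : (Fin d → ℝ) × ℝ) ∈ Γ
  · obtain ⟨n, θ, h1, h2⟩ := h0
    exact ⟨n, θ, fun i => (h1 i).symm, h2⟩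
  have hΓ : Convex ℝ Γ := by
    rintro v ⟨n, θ, h1, h2⟩ v' ⟨n', θ', h1', h2'⟩ a b ha hb hab
    obtain ⟨θ'', hθ⟩ := exists_dens_convex (Y := Y) θ θ' ha hb hab
    have hInt : ∀ {h : Y → ℝ}, Integrable h P → ∫ y, dens θ'' y * h y ∂P =
        a * ∫ y, dens θ y * h y ∂P + b * ∫ y, dens θ' y * h y ∂P := by
      intro h hh
      rw [← integral_const_mul, ← integral_const_mul,
        ← integral_add ((integrable_dens_mul θ hh).const_mul a)
          ((integrable_dens_mul θ' hh).const_mul b)]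
      refine integral_congr_ae (ae_of_all _ fun y => ?_)
      simp only [hθ]
      ring
    have hle : ∀ θ : ℕ × (ℕ → ℝ), ∀ {m m' : ℕ}, m ≤ m' →
        ∫ y, dens θ y * w m y ∂P ≤ ∫ y, dens θ y * w m' y ∂P := fun θ m m' hm =>
      integral_mono (integrable_dens_mul θ (hw m)) (integrable_dens_mul θ (hw m')) fun y =>
        mul_le_mul_of_nonneg_left (hmono y hm) (dens_pos θ y).le
    refine ⟨max n n', θ'', fun i => ?_, ?_⟩
    · rw [hInt (hX i), ← h1 i, ← h1' i]; rfl
    · rw [hInt (hw _)]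
      have g1 := h2.trans_le (hle θ (le_max_left n n'))
      have g2 := h2'.trans_le (hle θ' (le_max_right n n'))
      change a * v.2 + b * v'.2 < _
      rcases ha.eq_or_lt with rfl | ha
      · have : b = 1 := by linarith
        subst this; simpa using g2
      · have := mul_lt_mul_of_pos_left g1 ha
        have := mul_le_mul_of_nonneg_left g2.le hb
        linarith
  obtain ⟨ℓ, hℓ, v₀, ⟨n₀, θ₀, hv₀, hv₀'⟩, hpos⟩ := exists_properly_separating hΓ
    ⟨((fun i => ∫ y, dens (0, 0) y * X y i ∂P), (∫ y, dens (0, 0) y * w 0 y ∂P) - 1),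
      0, (0, 0), fun i => rfl, by simp⟩ h0
  let u : Fin d → ℝ := fun i => ℓ (Pi.single i 1, 0)
  let c : ℝ := ℓ (0, 1)
  have hℓv : ∀ v : (Fin d → ℝ) × ℝ, ℓ v = (∑ i, u i * v.1 i) + c * v.2 := by
    intro v
    have : v = (∑ i, v.1 i • ((Pi.single i 1, 0) : (Fin d → ℝ) × ℝ)) + v.2 • (0, 1) := by
      refine Prod.ext ?_ ?_
      · ext j
        simp [Prod.fst_sum, Finset.sum_apply, Pi.single_apply]
      · simp [Prod.snd_sum]
    conv_lhs => rw [this]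
    simp only [map_add, map_sum, map_smul, smul_eq_mul]
    simp only [u, c, mul_comm]
  have hgen : ∀ n θ, ∀ s > 0, 0 ≤ (∑ i, u i * ∫ y, dens θ y * X y i ∂P)
      + c * ((∫ y, dens θ y * w n y ∂P) - s) := fun n θ s hs => by
    have := hℓ ((fun i => ∫ y, dens θ y * X y i ∂P), (∫ y, dens θ y * w n y ∂P) - s)
      ⟨n, θ, fun i => rfl, by simpa using hs⟩
    rwa [hℓv] at this
  have hc : c ≤ 0 := by
    by_contra hcon
    push Not at hcon
    set A := ∑ i, u i * ∫ y, dens (0, 0) y * X y i ∂P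
    set B := ∫ y, dens (0, 0) y * w 0 y ∂P
    have h1 := hgen 0 (0, 0) ((|A| + c * |B| + 1) / c) (by positivity)
    rw [mul_sub, mul_div_cancel₀ _ hcon.ne'] at h1
    have h2 := le_abs_self A
    have h3 := mul_le_mul_of_nonneg_left (le_abs_self B) hcon.le
    linarith
  let h : ℕ → Y → ℝ := fun n y => (∑ i, -u i * X y i) + (-c) * w n y
  have hh : ∀ n, Integrable (h n) P := fun n =>
    (integrable_finsetSum _ fun i _ => (hX i).const_mul _).add ((hw n).const_mul _)
  have hlin : ∀ n θ, ∫ y, dens θ y * h n y ∂P ≤ 0 := by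
    intro n θ
    have heq : ∫ y, dens θ y * h n y ∂P = -((∑ i, u i * ∫ y, dens θ y * X y i ∂P)
        + c * ∫ y, dens θ y * w n y ∂P) := by
      rw [← integral_const_mul]
      simp_rw [← integral_const_mul]
      rw [← integral_finsetSum _ fun i _ => (integrable_dens_mul θ (hX i)).const_mul _,
        ← integral_add (integrable_finsetSum _ fun i _ =>
          (integrable_dens_mul θ (hX i)).const_mul _) ((integrable_dens_mul θ (hw n)).const_mul _),
        ← integral_neg]
      refine integral_congr_ae (ae_of_all _ fun y => ?_)
      simp only [h, mul_add, Finset.mul_sum, neg_add, ← Finset.sum_neg_distrib]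
      congr 1
      · exact Finset.sum_congr rfl fun i _ => by ring
      · ring
    rw [heq, neg_nonpos]
    refine le_of_forall_pos_le_add fun ε hε => ?_
    have h1 := hgen n θ (ε / (1 - c)) (div_pos hε (by linarith))
    have h2 : -c * (ε / (1 - c)) ≤ ε := by
      rw [mul_div_assoc', div_le_iff₀ (by linarith)]
      nlinarith
    linarith
  have hae : ∀ n, ∀ᵐ y ∂P, h n y ≤ 0 := by
    intro n
    refine ae_nonpos_of_testOpen (hh n) fun j => ?_
    by_contra hcon
    push Not at hcon
    set B := ∫ y in testOpen Y j, h n y ∂P with hB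
    set A := ∫ y, h n y ∂P with hA
    have h1 := hlin n (j + 1, Pi.single j ((|A| + 1) / B))
    have h2 : ∀ r : ℝ, 0 ≤ r → ∫ y, dens (j + 1, Pi.single j r) y * h n y ∂P = A + r * B := by
      intro r hr
      rw [hB, ← integral_indicator (measurableSet_testOpen j), ← integral_const_mul, hA,
        ← integral_add (hh n) (((hh n).indicator (measurableSet_testOpen j)).const_mul _)]
      refine integral_congr_ae (ae_of_all _ fun y => ?_)
      simp only [dens, add_mul, one_mul]
      congr 1
      rw [Finset.sum_eq_single j]
      · rw [Pi.single_eq_same, abs_of_nonneg hr, mul_assoc]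
        congr 1
        by_cases hy : y ∈ testOpen Y j <;> simp [hy]
      · intro k _ hk
        simp [Pi.single_eq_of_ne hk]
      · simp
    rw [h2 _ (by positivity), div_mul_cancel₀ _ hcon.ne'] at h1
    have := neg_abs_le A
    linarith
  obtain ⟨hc0, hu0⟩ := hyp (fun i => -u i) (-c) (by linarith) hae
  have hc0' : c = 0 := by linarith
  rw [hℓv, hc0', zero_mul, add_zero] at hpos
  have : ∑ i, u i * v₀.1 i = 0 := by
    simp_rw [hv₀, ← integral_const_mul]
    rw [← integral_finsetSum _ fun i _ => (integrable_dens_mul θ₀ (hX i)).const_mul _]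
    refine integral_eq_zero_of_ae ?_
    filter_upwards [hu0] with y hy
    simp only [neg_mul, Finset.sum_neg_distrib, neg_eq_zero] at hy
    simp only [mul_left_comm (u _), ← Finset.mul_sum, hy, mul_zero, Pi.zero_apply]
  linarith

end Density

end BN

namespace BN

/-! ### Analyticity of the set of successful one-step hedges -/

theorem isOpen_setOf_measure_ne_zero {V Y : Type*} [TopologicalSpace V]
    [SecondCountableTopology V] [MeasurableSpace Y] (P : Measure Y) {E : V → Set Y}
    (hE : ∀ w, IsOpen {v | w ∈ E v}) : IsOpen {v | P (E v) ≠ 0} := by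
  rw [isOpen_iff_forall_mem_open]
  intro v hv
  let B := TopologicalSpace.countableBasis V
  have hB := TopologicalSpace.isBasis_countableBasis V
  have hcount : (B ∩ {b | v ∈ b}).Countable :=
    (TopologicalSpace.countable_countableBasis V).mono inter_subset_left
  have hsub : E v ⊆ ⋃ b ∈ B ∩ {b | v ∈ b}, {w | ∀ v' ∈ b, w ∈ E v'} := by
    intro w hw
    obtain ⟨b, hbB, hvb, hb⟩ := hB.exists_subset_of_mem_open (show v ∈ {v | w ∈ E v} from hw) (hE w)
    exact mem_biUnion (show b ∈ B ∩ {b | v ∈ b} from ⟨hbB, hvb⟩) fun v' hv' => hb hv'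
  by_cases hall : ∀ b ∈ B ∩ {b | v ∈ b}, P {w | ∀ v' ∈ b, w ∈ E v'} = 0
  · exact (hv (measure_mono_null hsub ((measure_biUnion_null_iff hcount).2 hall))).elim
  · push Not at hall
    obtain ⟨b, ⟨hbB, hvb⟩, hb⟩ := hall
    exact ⟨b, fun v' hv' h0 => hb (measure_mono_null (fun w hw => hw v' hv') h0),
      hB.isOpen hbB, hvb⟩

theorem analyticSet_univ {α : Type*} [TopologicalSpace α] [PolishSpace α] :
    AnalyticSet (univ : Set α) := isClosed_univ.analyticSet

theorem AnalyticSet.inter' {α : Type*} [TopologicalSpace α] [T2Space α] {s t : Set α}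
    (hs : AnalyticSet s) (ht : AnalyticSet t) : AnalyticSet (s ∩ t) := by
  rw [inter_eq_iInter]
  exact AnalyticSet.iInter (by rintro (_ | _) <;> assumption)

theorem AnalyticSet.finset_inter {α ι : Type*} [TopologicalSpace α] [PolishSpace α]
    {J : ι → Set α} (hJ : ∀ i, AnalyticSet (J i)) (I : Finset ι) :
    AnalyticSet {a | ∀ i ∈ I, a ∈ J i} := by
  classical
  have hu : AnalyticSet (univ : Set α) := analyticSet_univ
  have : {a | ∀ i ∈ I, a ∈ J i} = univ ∩ ⋂ i : I, J i := by
    ext a; simp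
  rw [this]
  rcases isEmpty_or_nonempty I with h | h
  · simpa using hu
  · exact AnalyticSet.inter' hu (AnalyticSet.iInter fun i : I => hJ i)

/-- The parameters for which a compact set is covered by a countable analytic family of open
sets form an analytic set. -/
theorem analyticSet_compact_cover {α ι V : Type*} [TopologicalSpace α] [PolishSpace α]
    [Countable ι] [TopologicalSpace V] {J : ι → Set α} (hJ : ∀ i, AnalyticSet (J i))
    {U : ι → Set V} (hU : ∀ i, IsOpen (U i)) {C : Set V} (hC : IsCompact C) :
    AnalyticSet {a | ∀ u ∈ C, ∃ i, u ∈ U i ∧ a ∈ J i} := by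
  have : {a | ∀ u ∈ C, ∃ i, u ∈ U i ∧ a ∈ J i}
      = ⋃ I : {I : Finset ι // C ⊆ ⋃ i ∈ I, U i}, {a | ∀ i ∈ I.1, a ∈ J i} := by
    ext a
    simp only [mem_ofPred_eq, mem_iUnion]
    constructor
    · intro h
      obtain ⟨I, hI⟩ := hC.elim_finite_subcover (fun i : {i // a ∈ J i} => U i) (fun i => hU i)
        fun u hu => by
          obtain ⟨i, hi, ha⟩ := h u hu
          exact mem_iUnion.2 ⟨⟨i, ha⟩, hi⟩
      classical
      refine ⟨⟨I.image Subtype.val, ?_⟩, ?_⟩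
      · refine hI.trans fun u hu => ?_
        simp only [mem_iUnion] at hu ⊢
        obtain ⟨i, hi, hu⟩ := hu
        exact ⟨i, Finset.mem_image_of_mem _ hi, hu⟩
      · intro i hi
        obtain ⟨j, -, rfl⟩ := Finset.mem_image.1 hi
        exact j.2
    · rintro ⟨⟨I, hI⟩, h⟩ u hu
      obtain ⟨i, hi, hui⟩ : ∃ i, ∃ _ : i ∈ I, u ∈ U i := by simpa using hI hu
      exact ⟨i, hui, h i hi⟩
  rw [this]
  exact AnalyticSet.iUnion fun I => AnalyticSet.finset_inter hJ I.1

section Short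

variable {X Y : Type} {d : ℕ}

/-- The event that the hedge `c + u • Δ` falls short of `f`. -/
def short (Δ : X × Y → Fin d → ℝ) (f : X × Y → EReal) (x : X) (c : ℝ) (u : Fin d → ℝ) : Set Y :=
  {w | ((c + ∑ i, u i * Δ (x, w) i : ℝ) : EReal) < f (x, w)}

/-- A uniform version of `short` on a cube of directions. -/
def shortCube (Δ : X × Y → Fin d → ℝ) (f : X × Y → EReal) (x : X) (c : ℝ)
    (q : (Fin d → ℚ) × ℕ) : Set Y :=
  {w | ((c + ∑ i, (q.1 i * Δ (x, w) i + 1 / (q.2 + 1) * |Δ (x, w) i|) : ℝ) : EReal) < f (x, w)}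

/-- Cubes with rational center. -/
def ratCube (q : (Fin d → ℚ) × ℕ) : Set (Fin d → ℝ) := {u | ∀ i, |u i - q.1 i| < 1 / (q.2 + 1)}

theorem isOpen_ratCube (q : (Fin d → ℚ) × ℕ) : IsOpen (ratCube q) := by
  simp only [ratCube, ofPred_forall]
  exact isOpen_iInter_of_finite fun i => isOpen_lt (by fun_prop) continuous_const

theorem shortCube_subset {Δ : X × Y → Fin d → ℝ} {f : X × Y → EReal} {x : X} {c : ℝ}
    {q : (Fin d → ℚ) × ℕ} {u : Fin d → ℝ} (hu : u ∈ ratCube q) :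
    shortCube Δ f x c q ⊆ short Δ f x c u := by
  intro w hw
  refine lt_of_le_of_lt (EReal.coe_le_coe_iff.2 (add_le_add_right (Finset.sum_le_sum fun i _ => ?_) c)) hw
  have h1 : (u i - q.1 i) * Δ (x, w) i ≤ 1 / (q.2 + 1) * |Δ (x, w) i| :=
    (le_abs_self _).trans (by
      rw [abs_mul]; exact mul_le_mul_of_nonneg_right (hu i).le (abs_nonneg _))
  linarith

theorem short_subset {Δ : X × Y → Fin d → ℝ} {f : X × Y → EReal} {x : X} {c : ℝ}
    {u : Fin d → ℝ} : short Δ f x c u ⊆ ⋃ q : {q : (Fin d → ℚ) × ℕ // u ∈ ratCube q},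
      shortCube Δ f x c q.1 := by
  intro w hw
  obtain ⟨b, hb1, hb2⟩ := EReal.lt_iff_exists_real_btwn.1 hw
  rw [EReal.coe_lt_coe_iff] at hb1
  set D := ∑ i, |Δ (x, w) i|
  have hD : 0 ≤ D := Finset.sum_nonneg fun i _ => abs_nonneg _
  set a := c + ∑ i, u i * Δ (x, w) i with ha
  obtain ⟨m, hm⟩ := exists_nat_one_div_lt (show 0 < (b - a) / (2 * D + 1) by
    apply div_pos <;> linarith)
  have hm0 : (0 : ℝ) < 1 / (m + 1) := by positivity
  have hq : ∀ i, ∃ q : ℚ, |u i - q| < 1 / ((m : ℝ) + 1) := fun i => by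
    obtain ⟨q, hq1, hq2⟩ := exists_rat_btwn (show u i < u i + 1 / ((m : ℝ) + 1) by linarith)
    exact ⟨q, by rw [abs_lt]; constructor <;> linarith⟩
  choose q hq using hq
  refine mem_iUnion.2 ⟨⟨(q, m), hq⟩, lt_trans (EReal.coe_lt_coe_iff.2 ?_) hb2⟩
  have h2 : ∑ i, ((q i : ℝ) * Δ (x, w) i + 1 / ((m : ℝ) + 1) * |Δ (x, w) i|)
      ≤ ∑ i, (u i * Δ (x, w) i + 2 * (1 / ((m : ℝ) + 1)) * |Δ (x, w) i|) := by
    refine Finset.sum_le_sum fun i _ => ?_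
    have h1 : (q i - u i) * Δ (x, w) i ≤ 1 / ((m : ℝ) + 1) * |Δ (x, w) i| :=
      (le_abs_self _).trans (by
        rw [abs_mul, abs_sub_comm]; exact mul_le_mul_of_nonneg_right (hq i).le (abs_nonneg _))
    linarith
  rw [Finset.sum_add_distrib (f := fun i => u i * _), ← Finset.mul_sum] at h2
  rw [lt_div_iff₀ (by linarith)] at hm
  have h3 : a + 2 * (1 / ((m : ℝ) + 1)) * D < b := by linarith
  simp only
  linarith

theorem measure_short_ne_zero_iff [MeasurableSpace Y] {Δ : X × Y → Fin d → ℝ}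
    {f : X × Y → EReal} {x : X} {c : ℝ} {u : Fin d → ℝ} (P : Measure Y) :
    P (short Δ f x c u) ≠ 0 ↔ ∃ q, u ∈ ratCube q ∧ P (shortCube Δ f x c q) ≠ 0 := by
  constructor
  · intro h
    by_contra hcon
    push Not at hcon
    exact h (measure_mono_null short_subset (measure_iUnion_null fun q => hcon q.1 q.2))
  · rintro ⟨q, hu, hq⟩ h0
    exact hq (measure_mono_null (shortCube_subset hu) h0)

theorem isOpen_measure_short_ne_zero [MeasurableSpace Y] (Δ : X × Y → Fin d → ℝ)
    (f : X × Y → EReal) (x : X) (c : ℝ) (P : Measure Y) :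
    IsOpen {u | P (short Δ f x c u) ≠ 0} := by
  refine isOpen_setOf_measure_ne_zero P fun w => ?_
  simp only [short, mem_ofPred_eq]
  refine isOpen_lt (continuous_coe_real_ereal.comp ?_) continuous_const
  fun_prop

variable [TopologicalSpace X] [PolishSpace X] [MeasurableSpace X] [BorelSpace X]
  [TopologicalSpace Y] [PolishSpace Y] [MeasurableSpace Y] [BorelSpace Y]
  (s : Step X Y) {Δ : X × Y → Fin d → ℝ} {f : X × Y → EReal}

theorem analyticSet_lt_usa {α : Type*} [TopologicalSpace α] [PolishSpace α] [MeasurableSpace α]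
    [BorelSpace α] {h : α → ℝ} (hh : Measurable h) {f : α → EReal} (hf : UpperSemianalyticE f) :
    AnalyticSet {a | (h a : EReal) < f a} := by
  have : {a | (h a : EReal) < f a} = ⋃ b : ℚ, {a | h a < b} ∩ {a | ((b : ℝ) : EReal) < f a} := by
    ext a
    simp only [mem_ofPred_eq, mem_iUnion, mem_inter_iff]
    constructor
    · intro h
      obtain ⟨b, hb1, hb2⟩ := EReal.lt_iff_exists_rat_btwn.1 h
      exact ⟨b, EReal.coe_lt_coe_iff.1 hb1, hb2⟩
    · rintro ⟨b, hb1, hb2⟩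
      exact (EReal.coe_lt_coe_iff.2 hb1).trans hb2
  rw [this]
  exact AnalyticSet.iUnion fun b =>
    AnalyticSet.inter' (measurableSet_lt hh measurable_const).analyticSet (hf b)

theorem UpperSemianalyticE.comp_continuous {α β : Type*} [TopologicalSpace α] [PolishSpace α]
    [TopologicalSpace β] [PolishSpace β] {f : β → EReal} (hf : UpperSemianalyticE f) {g : α → β}
    (hg : Continuous g) : UpperSemianalyticE fun a => f (g a) :=
  fun c => (hf c).preimage hg

theorem UpperSemianalyticE.uMeas {α : Type*} [TopologicalSpace α] [PolishSpace α]
    [MeasurableSpace α] [BorelSpace α] {f : α → EReal} (hf : UpperSemianalyticE f) : UMeas f := by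
  have h := fun c => (hf c).univComp
  let _ : MeasurableSpace α := univComp α
  refine measurable_of_Ioi fun a => ?_
  have : f ⁻¹' Ioi a = ⋃ b : {b : ℚ // a < ((b : ℝ) : EReal)}, {x | ((b : ℝ) : EReal) < f x} := by
    ext x
    simp only [mem_preimage, mem_Ioi, mem_iUnion, mem_ofPred_eq, Subtype.exists, exists_prop]
    exact EReal.lt_iff_exists_rat_btwn
  rw [this]
  exact MeasurableSet.iUnion fun b => h b

theorem analyticSet_short (hΔ : Measurable Δ) (hf : UpperSemianalyticE f) {C : Set (Fin d → ℝ)}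
    (hC : IsCompact C) :
    AnalyticSet {q : (ℕ → ℕ) × ℝ | ∀ u ∈ C, s.k q.1 (short Δ f (s.p q.1) q.2 u) ≠ 0} := by
  simp only [measure_short_ne_zero_iff]
  refine analyticSet_compact_cover (J := fun i => {q : (ℕ → ℕ) × ℝ |
    s.k q.1 (shortCube Δ f (s.p q.1) q.2 i) ≠ 0}) (fun i => ?_) isOpen_ratCube hC
  let κ : ProbabilityTheory.Kernel ((ℕ → ℕ) × ℝ) Y := s.k.comap Prod.fst measurable_fst
  have hc : Continuous fun q : ((ℕ → ℕ) × ℝ) × Y => (s.p q.1.1, q.2) :=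
    (s.continuous_p.comp (continuous_fst.comp continuous_fst)).prodMk continuous_snd
  have hA : AnalyticSet {q : ((ℕ → ℕ) × ℝ) × Y |
      ((q.1.2 + ∑ j, (i.1 j * Δ (s.p q.1.1, q.2) j
        + 1 / (i.2 + 1) * |Δ (s.p q.1.1, q.2) j|) : ℝ) : EReal) < f (s.p q.1.1, q.2)} := by
    refine analyticSet_lt_usa ?_ (hf.comp_continuous hc)
    have hj : ∀ j, Measurable fun q : ((ℕ → ℕ) × ℝ) × Y => Δ (s.p q.1.1, q.2) j := fun j =>
      (measurable_pi_apply j).comp (hΔ.comp hc.measurable)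
    have := Finset.measurable_fun_sum (Finset.univ : Finset (Fin d)) fun j _ =>
      ((hj j).const_mul (i.1 j : ℝ)).add ((hj j).abs.const_mul (1 / ((i.2 : ℝ) + 1)))
    exact (measurable_snd.comp measurable_fst).add this
  have := analyticSet_lt_kernel κ hA 0
  simp only [pos_iff_ne_zero] at this
  exact this

end Short
end BN

namespace BN

/-! ### Measurable selection from closed convex sets -/

theorem isCompact_sum_sq_le {d : ℕ} (r : ℝ) : IsCompact {u : Fin d → ℝ | ∑ i, u i ^ 2 ≤ r} := by
  refine (isCompact_closedBall (0 : Fin d → ℝ) (1 + |r|)).of_isClosed_subset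
    (isClosed_le (by fun_prop) continuous_const) fun u hu => ?_
  rw [mem_closedBall_zero_iff, pi_norm_le_iff_of_nonneg (by positivity)]
  intro i
  have h1 : u i ^ 2 ≤ r :=
    (Finset.single_le_sum (f := fun i => u i ^ 2) (fun i _ => sq_nonneg _)
      (Finset.mem_univ i)).trans hu
  rw [Real.norm_eq_abs, abs_le]
  have := le_abs_self r
  constructor <;> nlinarith [sq_nonneg (u i - 1), sq_nonneg (u i + 1)]

/-- A closed convex valued map with measurable hitting times of compact sets has a measurable
selector. -/
theorem exists_measurable_selector {α : Type*} [MeasurableSpace α] {d : ℕ}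
    {K : α → Set (Fin d → ℝ)} (hcl : ∀ a, IsClosed (K a)) (hconv : ∀ a, Convex ℝ (K a))
    (hm : ∀ C, IsCompact C → MeasurableSet {a | (K a ∩ C).Nonempty}) :
    ∃ Y : α → Fin d → ℝ, Measurable Y ∧ ∀ a, (K a).Nonempty → Y a ∈ K a := by
  classical
  let N : (Fin d → ℝ) → ℝ := fun u => ∑ i, u i ^ 2
  have hN : Continuous N := by fun_prop
  have hex : ∀ a, (K a).Nonempty → ∃ u ∈ K a, ∀ v ∈ K a, N u ≤ N v := by
    rintro a ⟨u₀, hu₀⟩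
    obtain ⟨u, ⟨hu, hu'⟩, hmin⟩ := ((isCompact_sum_sq_le (N u₀)).inter_left (hcl a)).exists_isMinOn
      ⟨u₀, hu₀, le_refl (N u₀)⟩ hN.continuousOn
    refine ⟨u, hu, fun v hv => ?_⟩
    by_cases h : N v ≤ N u₀
    · exact hmin ⟨hv, h⟩
    · exact le_trans hu' (not_le.1 h).le
  have huniq : ∀ a, ∀ u ∈ K a, ∀ v ∈ K a, (∀ w ∈ K a, N u ≤ N w) → N v ≤ N u → v = u := by
    intro a u hu v hv hmin hvu
    have hmid := hmin _ (hconv a hu hv (show (0 : ℝ) ≤ 1 / 2 by norm_num)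
      (show (0 : ℝ) ≤ 1 / 2 by norm_num) (by norm_num))
    have hpar : N ((1 / 2 : ℝ) • u + (1 / 2 : ℝ) • v)
        = N u / 2 + N v / 2 - (∑ i, (v i - u i) ^ 2) / 4 := by
      simp only [N, Finset.sum_div, ← Finset.sum_add_distrib, ← Finset.sum_sub_distrib]
      refine Finset.sum_congr rfl fun i _ => ?_
      simp only [Pi.add_apply, Pi.smul_apply, smul_eq_mul]
      ring
    have h0 : ∑ i, (v i - u i) ^ 2 ≤ 0 := by linarith
    have h1 := (Finset.sum_eq_zero_iff_of_nonneg fun i _ => sq_nonneg (v i - u i)).1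
      (le_antisymm h0 (Finset.sum_nonneg fun i _ => sq_nonneg _))
    ext i
    have := h1 i (Finset.mem_univ i)
    rw [sq_eq_zero_iff] at this
    linarith
  have hne : MeasurableSet {a | (K a).Nonempty} := by
    have : {a | (K a).Nonempty} = ⋃ n : ℕ, {a | (K a ∩ {u | N u ≤ n}).Nonempty} := by
      ext a
      simp only [mem_ofPred_eq, mem_iUnion]
      constructor
      · rintro ⟨u, hu⟩
        obtain ⟨n, hn⟩ := exists_nat_ge (N u)
        exact ⟨n, u, hu, hn⟩
      · rintro ⟨n, u, hu, -⟩
        exact ⟨u, hu⟩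
    rw [this]
    exact MeasurableSet.iUnion fun n => hm _ (isCompact_sum_sq_le _)
  choose! Y hYK hYmin using hex
  refine ⟨fun a => if (K a).Nonempty then Y a else 0, ?_, fun a ha => by simp [ha, hYK a ha]⟩
  refine measurable_of_isClosed fun C hC => ?_
  have hset : (fun a => if (K a).Nonempty then Y a else 0) ⁻¹' C
      = ({a | (K a).Nonempty} ∩ ⋂ q : ℚ, ({a | (K a ∩ {u | N u ≤ q}).Nonempty}ᶜ
          ∪ {a | (K a ∩ ({u | N u ≤ q} ∩ C)).Nonempty}))
        ∪ ({a | (K a).Nonempty}ᶜ ∩ {_a | (0 : Fin d → ℝ) ∈ C}) := by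
    ext a
    by_cases ha : (K a).Nonempty
    swap
    · simp [ha]
    simp only [mem_preimage, mem_union, mem_inter_iff, mem_ofPred_eq, ha, true_and,
      mem_compl_iff, not_true_eq_false, false_and, or_false, mem_iInter]
    constructor
    · intro hY q
      by_cases hq : (K a ∩ {u | N u ≤ q}).Nonempty
      · obtain ⟨u, hu, huq⟩ := hq
        exact Or.inr ⟨Y a, hYK a ha, le_trans (hYmin a ha u hu) huq, hY⟩
      · exact Or.inl hq
    · intro h
      have hnon : (⋂ q : {q : ℚ // N (Y a) < q}, K a ∩ ({u | N u ≤ q} ∩ C)).Nonempty := by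
        have : Nonempty {q : ℚ // N (Y a) < q} := (exists_rat_gt (N (Y a))).elim fun q hq => ⟨q, hq⟩
        refine IsCompact.nonempty_iInter_of_directed_nonempty_isCompact_isClosed _ ?_ ?_ ?_ ?_
        · intro q q'
          refine ⟨⟨min q.1 q'.1, by push_cast; exact lt_min q.2 q'.2⟩, ?_, ?_⟩
          · rintro u ⟨h1, h2, h3⟩
            exact ⟨h1, show N u ≤ q from le_trans h2 (Rat.cast_le.2 (min_le_left _ _)), h3⟩
          · rintro u ⟨h1, h2, h3⟩
            exact ⟨h1, show N u ≤ q' from le_trans h2 (Rat.cast_le.2 (min_le_right _ _)), h3⟩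
        · intro q
          exact (h q).resolve_left fun hcon => hcon ⟨Y a, hYK a ha, q.2.le⟩
        · exact fun q => ((isCompact_sum_sq_le _).inter_right hC).inter_left (hcl a)
        · exact fun q => (hcl a).inter ((isClosed_le hN continuous_const).inter hC)
      obtain ⟨v, hv⟩ := hnon
      rw [mem_iInter] at hv
      obtain ⟨q₀, hq₀⟩ := exists_rat_gt (N (Y a))
      have hv0 := hv ⟨q₀, hq₀⟩
      have hle : N v ≤ N (Y a) := by
        refine le_of_forall_gt_imp_ge_of_dense fun r hr => ?_
        obtain ⟨q, hq1, hq2⟩ := exists_rat_btwn hr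
        exact (hv ⟨q, hq1⟩).2.1.trans hq2.le
      rw [← huniq a _ (hYK a ha) v hv0.1 (hYmin a ha) hle]
      exact hv0.2.2
  rw [hset]
  refine (hne.inter (MeasurableSet.iInter fun q => (hm _ (isCompact_sum_sq_le _)).compl.union
    (hm _ ((isCompact_sum_sq_le _).inter_right hC)))).union (hne.compl.inter ?_)
  exact MeasurableSet.const _

section Hedge

variable {X Y : Type} {d : ℕ} [TopologicalSpace X] [PolishSpace X] [MeasurableSpace X]
  [BorelSpace X] [TopologicalSpace Y] [PolishSpace Y] [MeasurableSpace Y] [BorelSpace Y]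
  (s : Step X Y) (Δ : X × Y → Fin d → ℝ) (f : X × Y → EReal)

/-- The one-step superhedging positions for the claim `f` at state `x` with capital `c`. -/
def hedge (x : X) (c : ℝ) : Set (Fin d → ℝ) :=
  {u | ∀ z, s.p z = x → s.k z (short Δ f x c u) = 0}

variable {Δ f}

theorem isClosed_hedge (x : X) (c : ℝ) : IsClosed (hedge s Δ f x c) := by
  simp only [hedge, ofPred_forall]
  refine isClosed_iInter fun z => isClosed_iInter fun _ => ?_
  have := isOpen_measure_short_ne_zero Δ f x c (s.k z)
  convert this.isClosed_compl using 1
  ext u; simp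

theorem convex_hedge (x : X) (c : ℝ) : Convex ℝ (hedge s Δ f x c) := by
  intro u hu v hv a b ha hb hab z hz
  refine measure_mono_null (fun w hw => ?_) (measure_union_null (hu z hz) (hv z hz))
  by_contra hcon
  simp only [mem_union, not_or, short, mem_ofPred_eq, not_lt] at hcon
  rw [short, mem_ofPred_eq] at hw
  refine absurd hw (not_lt.2 ?_)
  have heq : (c + ∑ i, (a • u + b • v) i * Δ (x, w) i)
      = a * (c + ∑ i, u i * Δ (x, w) i) + b * (c + ∑ i, v i * Δ (x, w) i) := by
    simp only [Pi.add_apply, Pi.smul_apply, smul_eq_mul, add_mul, Finset.sum_add_distrib,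
      mul_add, Finset.mul_sum, mul_assoc]
    linear_combination (-c) * hab
  rw [heq]
  rcases le_total (c + ∑ i, u i * Δ (x, w) i) (c + ∑ i, v i * Δ (x, w) i) with h | h
  · refine hcon.1.trans (EReal.coe_le_coe_iff.2 ?_)
    have := mul_le_mul_of_nonneg_left h hb
    rw [← eq_sub_iff_add_eq] at hab
    rw [hab]
    linarith
  · refine hcon.2.trans (EReal.coe_le_coe_iff.2 ?_)
    have := mul_le_mul_of_nonneg_left h ha
    rw [← eq_sub_iff_add_eq'] at hab
    rw [hab]
    linarith

theorem hedge_mono (x : X) {c c' : ℝ} (hc : c ≤ c') : hedge s Δ f x c ⊆ hedge s Δ f x c' := by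
  intro u hu z hz
  refine measure_mono_null (fun w hw => ?_) (hu z hz)
  exact lt_of_le_of_lt (EReal.coe_le_coe_iff.2 (add_le_add_left hc _)) hw

theorem Step.exists_half (z z' : ℕ → ℕ) (h : s.p z = s.p z') :
    ∃ z'', s.p z'' = s.p z ∧ (2⁻¹ : ℝ≥0∞) • s.k z ≤ s.k z'' ∧ (2⁻¹ : ℝ≥0∞) • s.k z' ≤ s.k z'' := by
  obtain ⟨z'', h1, h2⟩ := s.convex z z' h 2⁻¹ 2⁻¹ ENNReal.inv_two_add_inv_two
  exact ⟨z'', h1, h2 ▸ Measure.le_add_right le_rfl, h2 ▸ Measure.le_add_left le_rfl⟩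

theorem measure_ne_zero_of_half_le {P P' : Measure Y} (h : (2⁻¹ : ℝ≥0∞) • P ≤ P') {A : Set Y}
    (hA : P A ≠ 0) : P' A ≠ 0 := by
  intro h0
  have := h A
  simp [h0, hA] at this

theorem exists_short_of_disjoint {x : X} {c : ℝ} {C : Set (Fin d → ℝ)} (hC : IsCompact C)
    (hdis : ¬ (hedge s Δ f x c ∩ C).Nonempty) :
    ∃ z, s.p z = x ∧ ∀ u ∈ C, s.k z (short Δ f x c u) ≠ 0 := by
  have : Nonempty {z // s.p z = x} := (s.surj x).elim fun z hz => ⟨z, hz⟩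
  obtain ⟨z, hz⟩ := hC.elim_directed_cover
    (fun z : {z // s.p z = x} => {u | s.k z (short Δ f x c u) ≠ 0})
    (fun z => isOpen_measure_short_ne_zero Δ f x c _) (fun u hu => by
      by_contra hcon
      refine hdis ⟨u, fun z hz => ?_, hu⟩
      by_contra h0
      exact hcon (mem_iUnion.2 ⟨⟨z, hz⟩, h0⟩)) (by
      intro z z'
      obtain ⟨z'', h1, h2, h3⟩ := s.exists_half z z' (z.2.trans z'.2.symm)
      exact ⟨⟨z'', h1.trans z.2⟩, fun u hu => measure_ne_zero_of_half_le h2 hu,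
        fun u hu => measure_ne_zero_of_half_le h3 hu⟩)
  exact ⟨z, z.2, fun u hu => hz hu⟩

theorem hedge_disjoint_iff {x : X} {c : ℝ} {C : Set (Fin d → ℝ)} (hC : IsCompact C) :
    ¬ (hedge s Δ f x c ∩ C).Nonempty ↔ (x, c) ∈ (fun q : (ℕ → ℕ) × ℝ => (s.p q.1, q.2)) ''
      {q | ∀ u ∈ C, s.k q.1 (short Δ f (s.p q.1) q.2 u) ≠ 0} := by
  constructor
  · intro h
    obtain ⟨z, rfl, hz⟩ := exists_short_of_disjoint s hC h
    exact ⟨(z, c), hz, rfl⟩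
  · rintro ⟨⟨z, c'⟩, hz, h⟩ ⟨u, hu, huC⟩
    simp only [Prod.mk.injEq] at h
    obtain ⟨rfl, rfl⟩ := h
    exact hz u huC (hu z rfl)

theorem analyticSet_hedge_disjoint (hΔ : Measurable Δ) (hf : UpperSemianalyticE f)
    {C : Set (Fin d → ℝ)} (hC : IsCompact C) :
    AnalyticSet {q : X × ℝ | ¬ (hedge s Δ f q.1 q.2 ∩ C).Nonempty} := by
  have : {q : X × ℝ | ¬ (hedge s Δ f q.1 q.2 ∩ C).Nonempty}
      = (fun q : (ℕ → ℕ) × ℝ => (s.p q.1, q.2)) ''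
      {q | ∀ u ∈ C, s.k q.1 (short Δ f (s.p q.1) q.2 u) ≠ 0} :=
    ext fun q => hedge_disjoint_iff s hC
  rw [this]
  exact (analyticSet_short s hΔ hf hC).image_of_continuous
    ((s.continuous_p.comp continuous_fst).prodMk continuous_snd)

theorem exists_hedge_selector (hΔ : Measurable Δ) (hf : UpperSemianalyticE f)
    {B : Set (Fin d → ℝ)} (hB : IsClosed B) (hBc : Convex ℝ B) :
    ∃ U : X × ℝ → Fin d → ℝ, UMeas U ∧
      ∀ x c, (hedge s Δ f x c ∩ B).Nonempty → U (x, c) ∈ hedge s Δ f x c ∩ B := by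
  have hm := fun C (hC : IsCompact C) => (analyticSet_hedge_disjoint s hΔ hf hC).univComp
  let _ : MeasurableSpace (X × ℝ) := univComp _
  obtain ⟨U, hU, hU'⟩ := exists_measurable_selector
    (K := fun q : X × ℝ => hedge s Δ f q.1 q.2 ∩ B)
    (fun q => (isClosed_hedge s q.1 q.2).inter hB) (fun q => (convex_hedge s q.1 q.2).inter hBc)
    fun C hC => by
      have := (hm (B ∩ C) (hC.inter_left hB)).compl
      simpa only [inter_assoc, compl_ofPred, not_not] using this
  exact ⟨U, hU, fun x c => hU' (x, c)⟩

end Hedge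
end BN

namespace BN

/-! ### Sections and the pointwise one-step analysis -/

section Good

variable {X Y : Type} {d : ℕ} [TopologicalSpace X] [PolishSpace X] [MeasurableSpace X]
  [BorelSpace X] [TopologicalSpace Y] [PolishSpace Y] [MeasurableSpace Y] [BorelSpace Y]
  (s : Step X Y) (Δ : X × Y → Fin d → ℝ) (f : X × Y → EReal)

/-- Universally measurable sections of the parametrization. -/
structure Step.IsSection (σ : X → (ℕ → ℕ)) : Prop where
  uMeas : UMeas σ
  p_eq : ∀ x, s.p (σ x) = x

theorem Step.exists_isSection : ∃ σ, s.IsSection σ := by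
  obtain ⟨σ, h1, h2⟩ := exists_uMeas_selection' (analyticSet_univ (α := ℕ → ℕ)) s.continuous_p
    fun x => (s.surj x).elim fun z hz => ⟨z, mem_univ z, hz⟩
  exact ⟨σ, h1, fun x => (h2 x).2⟩

theorem Step.exists_section_mem {W : Type*} [TopologicalSpace W] [PolishSpace W]
    [MeasurableSpace W] [BorelSpace W] {σ₀ : X → (ℕ → ℕ)} (hσ₀ : s.IsSection σ₀)
    {R : Set ((ℕ → ℕ) × W)} (hR : AnalyticSet R) {w : X → W} (hw : UMeas w) :
    ∃ σ, s.IsSection σ ∧ ∀ x, ((∃ z, s.p z = x ∧ (z, w x) ∈ R) → (σ x, w x) ∈ R) ∧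
      ((¬ ∃ z, s.p z = x ∧ (z, w x) ∈ R) → σ x = σ₀ x) := by
  have hp : Continuous fun q : (ℕ → ℕ) × W => (s.p q.1, q.2) :=
    (s.continuous_p.comp continuous_fst).prodMk continuous_snd
  obtain ⟨τ, hτ, hτR, hτ0⟩ := exists_uMeas_selection hR hp
    (σ₀ := fun q : X × W => (σ₀ q.1, q.2))
    ((hσ₀.uMeas.comp measurable_fst.uMeas).prodMk measurable_snd.uMeas)
  have hmem : ∀ x, (∃ z, s.p z = x ∧ (z, w x) ∈ R) ↔
      (x, w x) ∈ (fun q : (ℕ → ℕ) × W => (s.p q.1, q.2)) '' R := by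
    intro x
    constructor
    · rintro ⟨z, rfl, hz⟩
      exact ⟨_, hz, rfl⟩
    · rintro ⟨⟨z, w'⟩, hz, h⟩
      simp only [Prod.mk.injEq] at h
      exact ⟨z, h.1, h.2 ▸ hz⟩
  refine ⟨fun x => (τ (x, w x)).1, ⟨measurable_fst.comp_uMeas
    (hτ.comp (measurable_id.uMeas.prodMk hw)), fun x => ?_⟩, fun x => ⟨fun h => ?_, fun h => ?_⟩⟩
  · by_cases h : (x, w x) ∈ (fun q : (ℕ → ℕ) × W => (s.p q.1, q.2)) '' R
    · exact congrArg Prod.fst (hτR _ h).2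
    · rw [hτ0 _ h]
      exact hσ₀.p_eq x
  · obtain ⟨h1, h2⟩ := hτR _ ((hmem x).1 h)
    have h3 : (τ (x, w x)).2 = w x := congrArg Prod.snd h2
    have h4 : τ (x, w x) = ((τ (x, w x)).1, w x) := Prod.ext rfl h3
    rwa [h4] at h1
  · simp only [hτ0 _ (mt (hmem x).2 h)]

theorem Step.exists_section_dominating {W : Type*} [TopologicalSpace W] [PolishSpace W]
    [MeasurableSpace W] [BorelSpace W] {σ₀ : X → (ℕ → ℕ)} (hσ₀ : s.IsSection σ₀)
    {R : Set ((ℕ → ℕ) × W)} (hR : AnalyticSet R) {w : X → W} (hw : UMeas w) :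
    ∃ σ, s.IsSection σ ∧ ∀ x, (2⁻¹ : ℝ≥0∞) • s.k (σ₀ x) ≤ s.k (σ x) ∧
      ((∃ z, s.p z = x ∧ (2⁻¹ : ℝ≥0∞) • s.k (σ₀ x) ≤ s.k z ∧ (z, w x) ∈ R) → (σ x, w x) ∈ R) := by
  let v : X → ℕ → ℝ := fun x j => ((2⁻¹ : ℝ≥0∞) • s.k (σ₀ x)).real (testOpen Y j)
  let R' : Set ((ℕ → ℕ) × (W × (ℕ → ℝ))) :=
    {q | (q.1, q.2.1) ∈ R} ∩ {q | ∀ j, q.2.2 j ≤ (s.k q.1).real (testOpen Y j)}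
  have hR' : AnalyticSet R' := by
    refine AnalyticSet.inter' (hR.preimage (by fun_prop)) (MeasurableSet.analyticSet ?_)
    simp only [ofPred_forall]
    refine MeasurableSet.iInter fun j => measurableSet_le
      ((measurable_pi_apply j).comp (measurable_snd.comp measurable_snd)) ?_
    exact ((s.k.measurable_coe (measurableSet_testOpen j)).comp measurable_fst).ennreal_toReal
  have hv : UMeas v := by
    have h1 : Measurable fun (z : ℕ → ℕ) (j : ℕ) =>
        ((2⁻¹ : ℝ≥0∞) • s.k z).real (testOpen Y j) := by
      refine measurable_pi_lambda _ fun j => ?_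
      simp only [measureReal_ennreal_smul_apply]
      exact ((s.k.measurable_coe (measurableSet_testOpen j)).ennreal_toReal).const_mul _
    exact h1.comp_uMeas hσ₀.uMeas
  have hle : ∀ x z, (2⁻¹ : ℝ≥0∞) • s.k (σ₀ x) ≤ s.k z ↔
      ∀ j, v x j ≤ (s.k z).real (testOpen Y j) := by
    intro x z
    have hfin : IsFiniteMeasure ((2⁻¹ : ℝ≥0∞) • s.k (σ₀ x)) := Measure.smul_finite _ (by simp)
    have key : ∀ j, v x j ≤ (s.k z).real (testOpen Y j) ↔
        ((2⁻¹ : ℝ≥0∞) • s.k (σ₀ x)) (testOpen Y j) ≤ s.k z (testOpen Y j) := fun j =>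
      ENNReal.toReal_le_toReal (measure_ne_top _ _) (measure_ne_top _ _)
    simp only [key]
    exact ⟨fun h j => h _, fun h => le_of_testOpen h⟩
  obtain ⟨σ, hσ, hσR⟩ := s.exists_section_mem hσ₀ hR' (hw.prodMk hv)
  refine ⟨σ, hσ, fun x => ?_⟩
  have hiff : ∀ z, (z, (w x, v x)) ∈ R' ↔
      (2⁻¹ : ℝ≥0∞) • s.k (σ₀ x) ≤ s.k z ∧ (z, w x) ∈ R := fun z => by
    rw [hle]; exact and_comm
  have := hσR x
  simp only [hiff] at this
  by_cases h : ∃ z, s.p z = x ∧ (2⁻¹ : ℝ≥0∞) • s.k (σ₀ x) ≤ s.k z ∧ (z, w x) ∈ R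
  · exact ⟨(this.1 h).1, fun _ => (this.1 h).2⟩
  · refine ⟨?_, fun h' => (h h').elim⟩
    rw [this.2 h]
    refine Measure.le_iff.2 fun A _ => ?_
    rw [Measure.smul_apply, smul_eq_mul]
    exact mul_le_of_le_one_left zero_le (by simp)

/-- The states at which the local market is free of arbitrage, as seen by the models
charging only `{f > ⊥}`. -/
def Good (x : X) : Prop :=
  (∃ z, s.p z = x ∧ ∀ᵐ w ∂s.k z, ⊥ < f (x, w)) ∧
  ∀ u : Fin d → ℝ, (∀ z, s.p z = x → (∀ᵐ w ∂s.k z, ⊥ < f (x, w)) →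
      ∀ᵐ w ∂s.k z, 0 ≤ ∑ i, u i * Δ (x, w) i) →
    ∀ z, s.p z = x → ∀ᵐ w ∂s.k z, ∑ i, u i * Δ (x, w) i = 0

variable {s Δ f}

theorem Good.exists_uniform {x : X} (hg : Good s Δ f x) {c : ℕ → ℝ} (hc : Antitone c)
    (h : ∀ u, ∃ n z, s.p z = x ∧ s.k z (short Δ f x (c n) u) ≠ 0) :
    ∃ n z, s.p z = x ∧ (∀ u, s.k z (short Δ f x (c n) u) ≠ 0) ∧
      ∀ u : Fin d → ℝ, (∀ᵐ w ∂s.k z, 0 ≤ ∑ i, u i * Δ (x, w) i) →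
        ∀ z', s.p z' = x → ∀ᵐ w ∂s.k z', ∑ i, u i * Δ (x, w) i = 0 := by
  let L : Submodule ℝ (Fin d → ℝ) :=
    { carrier := {u | ∀ z, s.p z = x → ∀ᵐ w ∂s.k z, ∑ i, u i * Δ (x, w) i = 0}
      add_mem' := fun {u v} hu hv z hz => by
        filter_upwards [hu z hz, hv z hz] with w h1 h2
        simp only [Pi.add_apply, add_mul, Finset.sum_add_distrib, h1, h2, add_zero]
      zero_mem' := fun z _ => by simp
      smul_mem' := fun a u hu z hz => by
        filter_upwards [hu z hz] with w h1
        simp only [Pi.smul_apply, smul_eq_mul, mul_assoc, ← Finset.mul_sum, h1, mul_zero] }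
  have hL : ∀ u, u ∈ L ↔ ∀ z, s.p z = x → ∀ᵐ w ∂s.k z, ∑ i, u i * Δ (x, w) i = 0 := fun u => Iff.rfl
  obtain ⟨M, hM⟩ := L.exists_isCompl
  let E : ℝ → (Fin d → ℝ) × ℝ → Set Y := fun a v =>
    {w | ∃ q : ℚ, ((q : ℝ) : EReal) < f (x, w) ∧ (∑ i, v.1 i * Δ (x, w) i) + v.2 * a < v.2 * q}
  have hEscale : ∀ a v (t : ℝ), 0 < t → E a (t • v) = E a v := by
    intro a v t ht
    ext w
    simp only [E, mem_ofPred_eq, Prod.smul_fst, Prod.smul_snd, Pi.smul_apply, smul_eq_mul,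
      mul_assoc, ← Finset.mul_sum, ← mul_add, mul_lt_mul_iff_right₀ ht]
  have hEanti : ∀ v : (Fin d → ℝ) × ℝ, 0 ≤ v.2 → ∀ {a b}, a ≤ b → E b v ⊆ E a v := by
    rintro v hv a b hab w ⟨q, h1, h2⟩
    exact ⟨q, h1, lt_of_le_of_lt (add_le_add_right (mul_le_mul_of_nonneg_left hab hv) _) h2⟩
  let C : Set ((Fin d → ℝ) × ℝ) := {v | v.1 ∈ M} ∩ {v | 0 ≤ v.2} ∩ Metric.sphere 0 1
  have hCc : IsCompact C := by
    refine (isCompact_sphere _ _).inter_left (IsClosed.inter ?_ ?_)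
    · exact M.closed_of_finiteDimensional.preimage continuous_fst
    · exact isClosed_le continuous_const continuous_snd
  have hEshort : ∀ u a, E a (u, 1) = short Δ f x a u := by
    intro u a
    ext w
    simp only [E, short, mem_ofPred_eq, one_mul]
    constructor
    · rintro ⟨q, h1, h2⟩
      exact lt_trans (EReal.coe_lt_coe_iff.2 (by linarith)) h1
    · intro h
      obtain ⟨q, h1, h2⟩ := EReal.lt_iff_exists_rat_btwn.1 h
      exact ⟨q, h2, by have := EReal.coe_lt_coe_iff.1 h1; linarith⟩
  have hcov : C ⊆ ⋃ j : ℕ × {z // s.p z = x}, {v | s.k j.2 (E (c j.1) v) ≠ 0} := by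
    rintro ⟨u, k⟩ ⟨⟨huM, hk⟩, hnorm⟩
    simp only [mem_ofPred_eq] at huM hk
    rcases hk.eq_or_lt with rfl | hk
    · have huL : u ∉ L := fun huL => by
        have h0 : u = 0 := by
          have : u ∈ L ⊓ M := ⟨huL, huM⟩
          rwa [hM.inf_eq_bot] at this
        subst h0
        simp at hnorm
      rw [hL] at huL
      have := mt (hg.2 u) huL
      push Not at this
      obtain ⟨z, hz, hzf, hz0⟩ := this
      refine mem_iUnion.2 ⟨(0, ⟨z, hz⟩), fun hnull => hz0 ?_⟩
      rw [measure_eq_zero_iff_ae_notMem] at hnull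
      filter_upwards [hnull, hzf] with w hw hwf
      by_contra hneg
      obtain ⟨q, -, hq⟩ := EReal.lt_iff_exists_rat_btwn.1 hwf
      exact hw ⟨q, hq, by simpa using hneg⟩
    · obtain ⟨n, z, hz, hn⟩ := h (k⁻¹ • u)
      refine mem_iUnion.2 ⟨(n, ⟨z, hz⟩), ?_⟩
      rw [← hEshort, ← hEscale _ _ k hk] at hn
      simpa [smul_smul, hk.ne'] using hn
  have hne : Nonempty (ℕ × {z // s.p z = x}) := (s.surj x).elim fun z hz => ⟨(0, ⟨z, hz⟩)⟩
  obtain ⟨⟨n, z, hz⟩, hnz⟩ := hCc.elim_directed_cover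
    (fun j : ℕ × {z // s.p z = x} =>
      {v | s.k j.2 (E (c j.1) v) ≠ 0} ∪ {v | v.2 < 0}) (fun j => IsOpen.union
        (isOpen_setOf_measure_ne_zero _ fun w => by
          have : {v | w ∈ E (c j.1) v} = ⋃ q : {q : ℚ // ((q : ℝ) : EReal) < f (x, w)},
              {v | (∑ i, v.1 i * Δ (x, w) i) + v.2 * c j.1 < v.2 * (q : ℚ)} := by
            ext v; simp [E]
          rw [this]
          exact isOpen_iUnion fun q => isOpen_lt (by fun_prop) (by fun_prop))
        (isOpen_lt continuous_snd continuous_const))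
    (hcov.trans (iUnion_mono fun j => subset_union_left)) (by
      rintro ⟨n, z⟩ ⟨n', z'⟩
      obtain ⟨z'', h1, h2, h3⟩ := s.exists_half z z' (z.2.trans z'.2.symm)
      refine ⟨(max n n', ⟨z'', h1.trans z.2⟩), ?_, ?_⟩
      · rintro v (hv | hv)
        · rcases lt_or_ge v.2 0 with h0 | h0
          · exact Or.inr h0
          · refine Or.inl (measure_ne_zero_of_half_le h2 fun h => hv ?_)
            exact measure_mono_null (hEanti v h0 (hc (le_max_left _ _))) h
        · exact Or.inr hv
      · rintro v (hv | hv)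
        · rcases lt_or_ge v.2 0 with h0 | h0
          · exact Or.inr h0
          · refine Or.inl (measure_ne_zero_of_half_le h3 fun h => hv ?_)
            exact measure_mono_null (hEanti v h0 (hc (le_max_right _ _))) h
        · exact Or.inr hv)
  have hpos : ∀ m ∈ M, ∀ k : ℝ, 0 ≤ k → (m, k) ≠ (0 : (Fin d → ℝ) × ℝ) →
      s.k z (E (c n) (m, k)) ≠ 0 := by
    intro m hm k hk h0
    have hn : 0 < ‖(m, k)‖⁻¹ := inv_pos.2 (norm_pos_iff.2 h0)
    have hmem : ‖(m, k)‖⁻¹ • (m, k) ∈ C := by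
      refine ⟨⟨M.smul_mem _ hm, mul_nonneg hn.le hk⟩, ?_⟩
      rw [mem_sphere_zero_iff_norm, norm_smul, norm_inv, norm_norm,
        inv_mul_cancel₀ (norm_ne_zero_iff.2 h0)]
    rcases hnz hmem with h1 | h1
    · rwa [mem_ofPred_eq, hEscale _ _ _ hn] at h1
    · exact absurd (show ‖(m, k)‖⁻¹ * k < 0 from h1) (not_lt.2 (mul_nonneg hn.le hk))
  have hdec : ∀ u : Fin d → ℝ, ∃ m ∈ M, u - m ∈ L ∧
      ∀ᵐ w ∂s.k z, ∑ i, u i * Δ (x, w) i = ∑ i, m i * Δ (x, w) i := by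
    intro u
    obtain ⟨l, hl, m, hm, rfl⟩ := Submodule.mem_sup.1 (hM.sup_eq_top ▸ Submodule.mem_top (x := u))
    refine ⟨m, hm, by simpa using hl, ?_⟩
    filter_upwards [hl z hz] with w hw
    simp only [Pi.add_apply, add_mul, Finset.sum_add_distrib, hw, zero_add]
  refine ⟨n, z, hz, fun u h0 => ?_, fun u hu => ?_⟩
  · obtain ⟨m, hm, -, hae⟩ := hdec u
    refine hpos m hm 1 zero_le_one (by simp [Prod.ext_iff]) ?_
    rw [hEshort]
    rw [measure_eq_zero_iff_ae_notMem] at h0 ⊢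
    filter_upwards [h0, hae] with w h1 h2
    simpa only [short, mem_ofPred_eq, h2] using h1
  · obtain ⟨m, hm, hum, hae⟩ := hdec u
    by_cases hm0 : m = 0
    · subst hm0
      rw [sub_zero] at hum
      exact hum
    · refine absurd ?_ (hpos m hm 0 le_rfl (by simpa [Prod.ext_iff] using hm0))
      rw [measure_eq_zero_iff_ae_notMem]
      filter_upwards [hu, hae] with w h1 h2 h3
      obtain ⟨q, -, h4⟩ := h3
      simp only [zero_mul, add_zero] at h4
      linarith

end Good
end BN

namespace BN

/-! ### Local no-arbitrage and superhedging prices -/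

section LocalNA

variable {X Y : Type} {d : ℕ} [TopologicalSpace X] [PolishSpace X] [MeasurableSpace X]
  [BorelSpace X] [TopologicalSpace Y] [PolishSpace Y] [MeasurableSpace Y] [BorelSpace Y]
  (s : Step X Y) (Δ : X × Y → Fin d → ℝ) (f : X × Y → EReal) (𝔑 : Set (Measure X))

/-- Validity almost surely under all one-step extensions of the measures in `𝔑`. -/
def Step.QS (R : X × Y → Prop) : Prop :=
  ∀ ν ∈ 𝔑, ∀ σ, s.IsSection σ → ∀ᵐ x ∂ν, ∀ᵐ w ∂s.k (σ x), R (x, w)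

/-- Absence of arbitrage in the last period. -/
def LocalNA : Prop :=
  ∀ y : X → Fin d → ℝ, UMeas y → s.QS 𝔑 (fun q => 0 ≤ ∑ i, y q.1 i * Δ q i) →
    s.QS 𝔑 (fun q => ∑ i, y q.1 i * Δ q i = 0)

variable {s Δ f 𝔑}

theorem mem_short_zero {x : X} {u : Fin d → ℝ} {w : Y} :
    w ∈ short Δ (fun _ => 0) x 0 u ↔ ∑ i, u i * Δ (x, w) i < 0 := by
  simp only [short, mem_ofPred_eq, zero_add]
  exact_mod_cast Iff.rfl

theorem mem_hedge_zero {x : X} {u : Fin d → ℝ} :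
    u ∈ hedge s Δ (fun _ => 0) x 0 ↔
      ∀ z, s.p z = x → ∀ᵐ w ∂s.k z, 0 ≤ ∑ i, u i * Δ (x, w) i := by
  simp only [hedge, mem_ofPred_eq, measure_eq_zero_iff_ae_notMem, mem_short_zero, not_lt]

theorem upperSemianalyticE_const {α : Type*} [TopologicalSpace α] [PolishSpace α] (a : EReal) :
    UpperSemianalyticE fun _ : α => a := by
  intro c
  by_cases h : (c : EReal) < a
  · simpa [h] using analyticSet_univ
  · simpa [h] using analyticSet_empty

theorem LocalNA.ae_hedge_neg (hNA : LocalNA s Δ 𝔑) (hΔ : Measurable Δ) {B : Set (Fin d → ℝ)}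
    (hB : IsCompact B) (hBc : Convex ℝ B) {ν : Measure X} (hν : ν ∈ 𝔑) :
    ∀ᵐ x ∂ν, (hedge s Δ (fun _ => 0) x 0 ∩ B).Nonempty →
      (hedge s Δ (fun _ => 0) x 0 ∩ -B).Nonempty := by
  classical
  have hzero := upperSemianalyticE_const (α := X × Y) 0
  obtain ⟨U, hU, hUB⟩ := exists_hedge_selector s hΔ hzero hB.isClosed hBc
  let D : Set X := {x | (hedge s Δ (fun _ => 0) x 0 ∩ B).Nonempty} ∩
    {x | ¬ (hedge s Δ (fun _ => 0) x 0 ∩ -B).Nonempty}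
  have hcont : Continuous fun x : X => (x, (0 : ℝ)) := by fun_prop
  have hD : MeasurableSet[univComp X] D := by
    have h1 := ((analyticSet_hedge_disjoint s hΔ hzero hB).preimage hcont).univComp
    have h2 := ((analyticSet_hedge_disjoint s hΔ hzero hB.neg).preimage hcont).univComp
    have h3 := (MeasurableSet.compl h1).inter h2
    convert h3 using 1
    ext x; simp [D]
  let y : X → Fin d → ℝ := fun x => if x ∈ D then U (x, 0) else 0
  have hy : UMeas y := by
    convert UMeas.ite hD (hU.comp hcont.measurable.uMeas)
      (measurable_const (a := (0 : Fin d → ℝ))).uMeas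
  have hy0 := hNA y hy fun ν _ σ hσ => ae_of_all _ fun x => by
    by_cases hx : x ∈ D
    · simp only [y, if_pos hx]
      exact mem_hedge_zero.1 (hUB x 0 hx.1).1 _ (hσ.p_eq x)
    · simp [y, if_neg hx]
  obtain ⟨σ₀, hσ₀⟩ := s.exists_isSection
  obtain ⟨σ, hσ, hσR⟩ := s.exists_section_mem hσ₀ (analyticSet_short s hΔ hzero hB.neg)
    (w := fun _ => (0 : ℝ)) measurable_const.uMeas
  filter_upwards [hy0 ν hν σ hσ] with x hx h1
  by_contra h2
  have hxD : x ∈ D := ⟨h1, h2⟩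
  obtain ⟨z, rfl, hz⟩ := exists_short_of_disjoint s hB.neg h2
  have h3 := (hσR _).1 ⟨z, rfl, hz⟩
  simp only [mem_ofPred_eq, hσ.p_eq] at h3
  refine h3 (-U (s.p z, 0)) (by simpa using (hUB _ 0 h1).2) ?_
  rw [measure_eq_zero_iff_ae_notMem]
  filter_upwards [hx] with w hw hws
  rw [mem_short_zero] at hws
  simp only [y, if_pos hxD] at hw
  simp [hw] at hws

theorem Step.QS.ae_exists_short (hf : s.QS 𝔑 fun q => ⊥ < f q) (hΔ : Measurable Δ)
    {B : Set (Fin d → ℝ)} (hB : IsCompact B) {ν : Measure X} (hν : ν ∈ 𝔑) :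
    ∀ᵐ x ∂ν, ¬ (hedge s Δ (fun _ => 0) x 0 ∩ B).Nonempty →
      ∃ z, s.p z = x ∧ (∀ᵐ w ∂s.k z, ⊥ < f (x, w)) ∧
        ∀ u ∈ B, s.k z (short Δ (fun _ => 0) x 0 u) ≠ 0 := by
  have hzero := upperSemianalyticE_const (α := X × Y) 0
  obtain ⟨σ₀, hσ₀⟩ := s.exists_isSection
  obtain ⟨σ, hσ, hσR⟩ := s.exists_section_mem hσ₀ (analyticSet_short s hΔ hzero hB)
    (w := fun _ => (0 : ℝ)) measurable_const.uMeas
  filter_upwards [hf ν hν σ hσ] with x hx h2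
  obtain ⟨z, rfl, hz⟩ := exists_short_of_disjoint s hB h2
  have h3 := (hσR _).1 ⟨z, rfl, hz⟩
  simp only [mem_ofPred_eq, hσ.p_eq] at h3
  exact ⟨σ (s.p z), hσ.p_eq _, hx, h3⟩

theorem mem_of_closedBall_inter {K : Set (Fin d → ℝ)} (hK : IsClosed K) {u : Fin d → ℝ}
    (h : ∀ n m : ℕ, u ∈ Metric.closedBall (TopologicalSpace.denseSeq (Fin d → ℝ) n) (1 / (m + 1)) →
      (K ∩ Metric.closedBall (TopologicalSpace.denseSeq (Fin d → ℝ) n) (1 / (m + 1))).Nonempty) :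
    u ∈ K := by
  rw [← hK.closure_eq, Metric.mem_closure_iff]
  intro ε hε
  obtain ⟨m, hm⟩ := exists_nat_one_div_lt (half_pos hε)
  obtain ⟨n, hn⟩ := (TopologicalSpace.denseRange_denseSeq (Fin d → ℝ)).exists_dist_lt u
    (show (0 : ℝ) < 1 / (m + 1) by positivity)
  obtain ⟨v, hv, hvb⟩ := h n m hn.le
  refine ⟨v, hv, lt_of_le_of_lt (dist_triangle_right u v (TopologicalSpace.denseSeq (Fin d → ℝ) n)) ?_⟩
  have : dist v (TopologicalSpace.denseSeq (Fin d → ℝ) n) ≤ 1 / ((m : ℝ) + 1) := hvb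
  linarith

theorem LocalNA.ae_good (hNA : LocalNA s Δ 𝔑) (hΔ : Measurable Δ)
    (hf : s.QS 𝔑 fun q => ⊥ < f q) {ν : Measure X} (hν : ν ∈ 𝔑) :
    ∀ᵐ x ∂ν, Good s Δ f x := by
  obtain ⟨σ₀, hσ₀⟩ := s.exists_isSection
  have h1 : ∀ᵐ x ∂ν, ∀ n m : ℕ, _ := ae_all_iff.2 fun n => ae_all_iff.2 fun m =>
    hNA.ae_hedge_neg hΔ (isCompact_closedBall (TopologicalSpace.denseSeq (Fin d → ℝ) n)
      (1 / ((m : ℝ) + 1))) (convex_closedBall _ _) hν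
  have h2 : ∀ᵐ x ∂ν, ∀ n m : ℕ, _ := ae_all_iff.2 fun n => ae_all_iff.2 fun m =>
    hf.ae_exists_short hΔ (isCompact_closedBall (TopologicalSpace.denseSeq (Fin d → ℝ) n)
      (1 / ((m : ℝ) + 1))) hν
  filter_upwards [h1, h2, hf ν hν σ₀ hσ₀] with x h1 h2 h3
  refine ⟨⟨σ₀ x, hσ₀.p_eq x, h3⟩, fun u hu z hz => ?_⟩
  have hmem : u ∈ hedge s Δ (fun _ => 0) x 0 := by
    refine mem_of_closedBall_inter (isClosed_hedge s x 0) fun n m hnm => ?_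
    by_contra hcon
    obtain ⟨z, hz, hzf, hzs⟩ := h2 n m hcon
    refine hzs u hnm ?_
    rw [measure_eq_zero_iff_ae_notMem]
    filter_upwards [hu z hz hzf] with w hw
    rwa [mem_short_zero, not_lt]
  have hneg : -u ∈ hedge s Δ (fun _ => 0) x 0 := by
    have : u ∈ -hedge s Δ (fun _ => 0) x 0 := by
      refine mem_of_closedBall_inter (isClosed_hedge s x 0).neg fun n m hnm => ?_
      obtain ⟨v, hv, hvb⟩ := h1 n m ⟨u, hmem, hnm⟩
      exact ⟨-v, by simpa using hv, hvb⟩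
    simpa using this
  filter_upwards [mem_hedge_zero.1 hmem z hz, mem_hedge_zero.1 hneg z hz] with w h4 h5
  simp only [Pi.neg_apply, neg_mul, Finset.sum_neg_distrib] at h5
  linarith

theorem Good.exists_price_lt {x : X} (hg : Good s Δ f x) : ∃ q : ℚ, hedge s Δ f x q = ∅ := by
  obtain ⟨z, hz, hzf⟩ := hg.1
  obtain ⟨n, z', hz', h1, -⟩ := hg.exists_uniform (c := fun n => -(n : ℝ))
    (fun a b hab => neg_le_neg (Nat.cast_le.2 hab)) fun u => by
      by_contra hcon
      push Not at hcon
      have h0 := fun n => measure_eq_zero_iff_ae_notMem.1 (hcon n z hz)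
      rw [← ae_all_iff] at h0
      obtain ⟨w, hw, hwf⟩ := (h0.and hzf).exists
      obtain ⟨q, -, hq⟩ := EReal.lt_iff_exists_rat_btwn.1 hwf
      obtain ⟨n, hn⟩ := exists_nat_ge ((∑ i, u i * Δ (x, w) i) - q)
      refine hw n (lt_of_le_of_lt (EReal.coe_le_coe_iff.2 ?_) hq)
      linarith
  refine ⟨-(n : ℚ), eq_empty_of_forall_notMem fun u hu => h1 u ?_⟩
  push_cast at hu
  exact hu z' hz'

theorem Good.hedge_eq_empty_of_lt {x : X} (hg : Good s Δ f x) {c : ℝ} (hc : hedge s Δ f x c = ∅) :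
    ∃ z, s.p z = x ∧ (∀ u, s.k z (short Δ f x c u) ≠ 0) ∧
      (∀ u : Fin d → ℝ, (∀ᵐ w ∂s.k z, 0 ≤ ∑ i, u i * Δ (x, w) i) →
        ∀ z', s.p z' = x → ∀ᵐ w ∂s.k z', ∑ i, u i * Δ (x, w) i = 0) ∧
      ∃ c' > c, hedge s Δ f x c' = ∅ := by
  obtain ⟨n, z, hz, h1, h2⟩ := hg.exists_uniform (c := fun n => c + 1 / ((n : ℝ) + 1))
    (fun a b hab => add_le_add_right (one_div_le_one_div_of_le (by positivity)
      (add_le_add_left (Nat.cast_le.2 hab) 1)) c) fun u => by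
      have hu : u ∉ hedge s Δ f x c := hc ▸ notMem_empty u
      simp only [hedge, mem_ofPred_eq] at hu
      push Not at hu
      obtain ⟨z, hz, hu⟩ := hu
      by_contra hcon
      push Not at hcon
      refine hu (measure_mono_null ?_ (measure_iUnion_null fun n => hcon n z hz))
      intro w hw
      obtain ⟨b, hb1, hb2⟩ := EReal.lt_iff_exists_real_btwn.1 (show _ < _ from hw)
      rw [EReal.coe_lt_coe_iff] at hb1
      obtain ⟨n, hn⟩ := exists_nat_one_div_lt (sub_pos.2 hb1)
      refine mem_iUnion.2 ⟨n, lt_trans (EReal.coe_lt_coe_iff.2 ?_) hb2⟩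
      linarith
  have hlt : (0 : ℝ) < 1 / (n + 1) := by positivity
  refine ⟨z, hz, fun u h0 => h1 u (measure_mono_null (fun w hw => ?_) h0), h2,
    c + 1 / (n + 1), by linarith, eq_empty_of_forall_notMem fun u hu => h1 u (hu z hz)⟩
  refine lt_trans (EReal.coe_lt_coe_iff.2 ?_) hw
  linarith

variable (s Δ f)

/-- The one-step superhedging price. -/
def price (x : X) : EReal := ⨆ q : {q : ℚ // hedge s Δ f x q = ∅}, ((q.1 : ℝ) : EReal)

variable {s Δ f}

theorem lt_price_iff {x : X} {a : EReal} :
    a < price s Δ f x ↔ ∃ q : ℚ, hedge s Δ f x q = ∅ ∧ a < ((q : ℝ) : EReal) := by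
  simp only [price, lt_iSup_iff, Subtype.exists, exists_prop]

theorem upperSemianalyticE_price (hΔ : Measurable Δ) (hf : UpperSemianalyticE f) :
    UpperSemianalyticE (price s Δ f) := by
  intro c
  have : {x | (c : EReal) < price s Δ f x} = ⋃ q : {q : ℚ // (c : EReal) < ((q : ℝ) : EReal)},
      ⋂ n : ℕ, (fun x => (x, (q.1 : ℝ))) ⁻¹'
        {r : X × ℝ | ¬ (hedge s Δ f r.1 r.2 ∩ Metric.closedBall 0 n).Nonempty} := by
    ext x
    simp only [mem_ofPred_eq, lt_price_iff, mem_iUnion, mem_iInter, mem_preimage, Subtype.exists]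
    refine exists_congr fun q => ?_
    rw [and_comm, exists_prop]
    refine and_congr_right fun _ => ⟨fun h n => by simp [h], fun h => ?_⟩
    refine eq_empty_of_forall_notMem fun u hu => ?_
    obtain ⟨n, hn⟩ := exists_nat_ge ‖u‖
    exact h n ⟨u, hu, by simpa using hn⟩
  rw [this]
  exact AnalyticSet.iUnion fun q => AnalyticSet.iInter fun n =>
    (analyticSet_hedge_disjoint s hΔ hf (isCompact_closedBall _ _)).preimage (by fun_prop)

theorem Good.bot_lt_price {x : X} (hg : Good s Δ f x) : ⊥ < price s Δ f x := by
  obtain ⟨q, hq⟩ := hg.exists_price_lt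
  exact lt_price_iff.2 ⟨q, hq, EReal.bot_lt_coe _⟩

theorem hedge_eq_empty_of_lt_price {x : X} {c : ℝ} (h : (c : EReal) < price s Δ f x) :
    hedge s Δ f x c = ∅ := by
  obtain ⟨q, hq, hc⟩ := lt_price_iff.1 h
  exact subset_empty_iff.1 ((hedge_mono s x (EReal.coe_lt_coe_iff.1 hc).le).trans hq.subset)

theorem Good.hedge_nonempty {x : X} (hg : Good s Δ f x) {c : ℝ}
    (h : price s Δ f x ≤ (c : EReal)) : (hedge s Δ f x c).Nonempty := by
  by_contra hcon
  rw [not_nonempty_iff_eq_empty] at hcon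
  obtain ⟨-, -, -, -, c', hc', he⟩ := hg.hedge_eq_empty_of_lt hcon
  obtain ⟨q, hq1, hq2⟩ := exists_rat_btwn hc'
  refine absurd (lt_price_iff.2 ⟨q, ?_, EReal.coe_lt_coe_iff.2 hq1⟩) (not_lt.2 h)
  exact subset_empty_iff.1 ((hedge_mono s x hq2.le).trans he.subset)

/-- Measurable one-step superhedging. -/
theorem exists_hedging_strategy (hΔ : Measurable Δ) (hf : UpperSemianalyticE f)
    {r : X → ℝ} (hr : UMeas r) : ∃ y : X → Fin d → ℝ, UMeas y ∧
      ∀ x, Good s Δ f x → price s Δ f x ≤ (r x : EReal) → ∀ z, s.p z = x →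
        ∀ᵐ w ∂s.k z, f (x, w) ≤ ((r x + ∑ i, y x i * Δ (x, w) i : ℝ) : EReal) := by
  obtain ⟨U, hU, hUh⟩ := exists_hedge_selector s hΔ hf isClosed_univ convex_univ
  refine ⟨fun x => U (x, r x), hU.comp (measurable_id.uMeas.prodMk hr), fun x hg hp z hz => ?_⟩
  have h1 := (hUh x (r x) (by simpa using hg.hedge_nonempty hp)).1 z hz
  rw [measure_eq_zero_iff_ae_notMem] at h1
  filter_upwards [h1] with w hw
  exact not_lt.1 hw

end LocalNA
end BN

namespace BN

/-! ### Measurable families of one-step martingale densities -/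

section Weight

variable {Y : Type*} [TopologicalSpace Y] [PolishSpace Y] [MeasurableSpace Y] [BorelSpace Y]
  {d : ℕ}

/-- A positive weight that makes increments and a given bound integrable. -/
def wt (v : Fin d → ℝ) (b : ℝ) : ℝ := (1 + ∑ i, |v i| + b)⁻¹

theorem wt_pos (v : Fin d → ℝ) {b : ℝ} (hb : 0 ≤ b) : 0 < wt v b := by
  unfold wt
  have : 0 ≤ ∑ i, |v i| := Finset.sum_nonneg fun _ _ => abs_nonneg _
  positivity

theorem wt_mul_abs_le {v : Fin d → ℝ} {b a B : ℝ} (hb : 0 ≤ b)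
    (h : |a| ≤ B * (1 + ∑ i, |v i| + b)) : |wt v b * a| ≤ B := by
  have hp := wt_pos v hb
  rw [abs_mul, abs_of_pos hp]
  calc wt v b * |a| ≤ wt v b * (B * (1 + ∑ i, |v i| + b)) := by gcongr
    _ = B * (wt v b * (wt v b)⁻¹) := by unfold wt; rw [inv_inv]; ring
    _ = B := by rw [mul_inv_cancel₀ hp.ne', mul_one]

theorem wt_le_one (v : Fin d → ℝ) {b : ℝ} (hb : 0 ≤ b) : wt v b ≤ 1 := by
  have : 0 ≤ ∑ i, |v i| := Finset.sum_nonneg fun _ _ => abs_nonneg _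
  exact inv_le_one_of_one_le₀ (by linarith)

theorem measurable_wt {α : Type*} [MeasurableSpace α] {v : α → Fin d → ℝ} {b : α → ℝ}
    (hv : Measurable v) (hb : Measurable b) : Measurable fun a => wt (v a) (b a) := by
  have h : Measurable fun a => ∑ i, |v a i| :=
    Finset.measurable_fun_sum _ fun i _ => ((measurable_pi_iff.1 hv) i).abs
  exact ((measurable_const.add h).add hb).inv

variable {P : Measure Y} [IsProbabilityMeasure P] {D : Y → Fin d → ℝ} {b : Y → ℝ}

theorem integrable_wt_mul (hD : Measurable D) (hb : Measurable b) (hb0 : ∀ y, 0 ≤ b y)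
    {a : Y → ℝ} (ha : Measurable a) {B : ℝ} (h : ∀ y, |a y| ≤ B * (1 + ∑ i, |D y i| + b y)) :
    Integrable (fun y => wt (D y) (b y) * a y) P :=
  Integrable.of_bound ((measurable_wt hD hb).mul ha).aestronglyMeasurable B
    (ae_of_all _ fun y => wt_mul_abs_le (hb0 y) (h y))

theorem integrable_wt_mul_incr (hD : Measurable D) (hb : Measurable b) (hb0 : ∀ y, 0 ≤ b y)
    (i : Fin d) : Integrable (fun y => wt (D y) (b y) * D y i) P :=
  integrable_wt_mul hD hb hb0 (measurable_pi_iff.1 hD i) (B := 1) fun y => by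
    have := Finset.single_le_sum (f := fun i => |D y i|) (fun _ _ => abs_nonneg _)
      (Finset.mem_univ i)
    have := hb0 y
    linarith

theorem integrable_wt (hD : Measurable D) (hb : Measurable b) (hb0 : ∀ y, 0 ≤ b y) :
    Integrable (fun y => wt (D y) (b y)) P :=
  Integrable.of_bound (measurable_wt hD hb).aestronglyMeasurable 1 (ae_of_all _ fun y => by
    rw [Real.norm_eq_abs, abs_of_pos (wt_pos _ (hb0 y))]
    exact wt_le_one _ (hb0 y))

theorem integral_dens_wt_sum_eq_zero (hD : Measurable D) (hb : Measurable b)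
    (hb0 : ∀ y, 0 ≤ b y) {θ : ℕ × (ℕ → ℝ)}
    (hθ : ∀ i, ∫ y, dens θ y * (wt (D y) (b y) * D y i) ∂P = 0) (u : Fin d → ℝ) :
    Integrable (fun y => dens θ y * (wt (D y) (b y) * ∑ i, u i * D y i)) P ∧
      ∫ y, dens θ y * (wt (D y) (b y) * ∑ i, u i * D y i) ∂P = 0 := by
  have hInt i : Integrable (fun y => u i * (dens θ y * (wt (D y) (b y) * D y i))) P :=
    (integrable_dens_mul θ (integrable_wt_mul_incr hD hb hb0 i)).const_mul _
  have heq : (fun y => dens θ y * (wt (D y) (b y) * ∑ i, u i * D y i)) =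
      fun y => ∑ i, u i * (dens θ y * (wt (D y) (b y) * D y i)) := by
    ext y
    simp only [Finset.mul_sum]
    exact Finset.sum_congr rfl fun i _ => by ring
  rw [heq]
  refine ⟨integrable_finsetSum _ fun i _ => hInt i, ?_⟩
  rw [integral_finsetSum _ fun i _ => hInt i]
  exact Finset.sum_eq_zero fun i _ => by rw [integral_const_mul, hθ i, mul_zero]

theorem ae_eq_zero_of_dens (hD : Measurable D) (hb : Measurable b) (hb0 : ∀ y, 0 ≤ b y)
    {θ : ℕ × (ℕ → ℝ)} (hθ : ∀ i, ∫ y, dens θ y * (wt (D y) (b y) * D y i) ∂P = 0)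
    {u : Fin d → ℝ} (hu : ∀ᵐ y ∂P, ∑ i, u i * D y i ≤ 0) : ∀ᵐ y ∂P, ∑ i, u i * D y i = 0 := by
  obtain ⟨h1, h2⟩ := integral_dens_wt_sum_eq_zero hD hb hb0 hθ u
  have h3 := (integral_eq_zero_iff_of_nonneg_ae (f := fun y =>
    -(dens θ y * (wt (D y) (b y) * ∑ i, u i * D y i))) (by
      filter_upwards [hu] with y hy
      have := dens_pos θ y
      have := wt_pos (D y) (hb0 y)
      have := mul_nonneg (dens_pos θ y).le (mul_nonneg (wt_pos (D y) (hb0 y)).le (neg_nonneg.2 hy))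
      simp only [Pi.zero_apply]
      linarith) h1.neg).1 (by rw [integral_neg, h2, neg_zero])
  filter_upwards [h3] with y hy
  simpa [(dens_pos θ y).ne', (wt_pos (D y) (hb0 y)).ne'] using hy

theorem not_ae_le_of_dens (hD : Measurable D) (hb : Measurable b) (hb0 : ∀ y, 0 ≤ b y)
    {θ : ℕ × (ℕ → ℝ)} (hθ : ∀ i, ∫ y, dens θ y * (wt (D y) (b y) * D y i) ∂P = 0)
    {a : Y → ℝ} (hpos : 0 < ∫ y, dens θ y * (wt (D y) (b y) * a y) ∂P) (u : Fin d → ℝ) :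
    ¬ ∀ᵐ y ∂P, a y ≤ ∑ i, u i * D y i := by
  intro h
  obtain ⟨h1, h2⟩ := integral_dens_wt_sum_eq_zero hD hb hb0 hθ u
  have hInt : Integrable (fun y => dens θ y * (wt (D y) (b y) * a y)) P := by
    by_contra hn
    rw [integral_undef hn] at hpos
    exact lt_irrefl _ hpos
  refine absurd (integral_mono_ae hInt h1 ?_) (by rw [h2]; exact not_le.2 hpos)
  filter_upwards [h] with y hy
  have := dens_pos θ y
  have := wt_pos (D y) (hb0 y)
  gcongr

/-- Pointwise existence of a martingale density under which `w n` is worth more than `c`. -/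
theorem exists_dens_wt (hD : Measurable D) (hb : Measurable b) (hb0 : ∀ y, 0 ≤ b y)
    (hNA : ∀ u : Fin d → ℝ, (∀ᵐ y ∂P, ∑ i, u i * D y i ≤ 0) → ∀ᵐ y ∂P, ∑ i, u i * D y i = 0)
    {w : ℕ → Y → ℝ} (hw : ∀ n, Measurable (w n)) (hmono : ∀ y, Monotone fun n => w n y)
    {B : ℕ → ℝ} (hB : ∀ n y, |w n y| ≤ B n * (1 + b y)) {c : ℝ}
    (hyp : ∀ u : Fin d → ℝ, ¬ ∀ n, ∀ᵐ y ∂P, w n y ≤ c + ∑ i, u i * D y i) :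
    ∃ n θ, (∀ i, ∫ y, dens θ y * (wt (D y) (b y) * D y i) ∂P = 0) ∧
      0 < ∫ y, dens θ y * (wt (D y) (b y) * (w n y - c)) ∂P := by
  refine exists_dens (X := fun y i => wt (D y) (b y) * D y i)
    (w := fun n y => wt (D y) (b y) * (w n y - c))
    (integrable_wt_mul_incr hD hb hb0) (fun n => ?_) (fun y n m hnm => ?_) fun u a ha h => ?_
  · refine integrable_wt_mul hD hb hb0 ((hw n).sub measurable_const) (B := |B n| + |c|) fun y => ?_
    have h1 : 0 ≤ ∑ i, |D y i| := Finset.sum_nonneg fun _ _ => abs_nonneg _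
    have h2 := hb0 y
    have h3 := hB n y
    have h4 : B n * (1 + b y) ≤ |B n| * (1 + ∑ i, |D y i| + b y) :=
      mul_le_mul (le_abs_self _) (by linarith) (by linarith) (abs_nonneg _)
    have h5 : |c| * 1 ≤ |c| * (1 + ∑ i, |D y i| + b y) := by gcongr; linarith
    have h6 := abs_sub (w n y) c
    nlinarith
  · have := wt_pos (D y) (hb0 y)
    have := hmono y hnm
    simp only at this ⊢
    gcongr
  have hfac : ∀ y, ∑ i, u i * (wt (D y) (b y) * D y i) = wt (D y) (b y) * ∑ i, u i * D y i := by
    intro y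
    rw [Finset.mul_sum]
    exact Finset.sum_congr rfl fun i _ => by ring
  have ha0 : a = 0 := by
    by_contra hne
    have hapos : 0 < a := lt_of_le_of_ne ha (Ne.symm hne)
    refine hyp (fun i => -(u i / a)) fun n => ?_
    filter_upwards [h n] with y hy
    rw [hfac] at hy
    have hp := wt_pos (D y) (hb0 y)
    have h1 : (∑ i, u i * D y i) + a * (w n y - c) ≤ 0 := by
      by_contra hcon
      push Not at hcon
      have := mul_pos hp hcon
      nlinarith
    have h2 : ∑ i, -(u i / a) * D y i = -((∑ i, u i * D y i) / a) := by
      rw [Finset.sum_div, ← Finset.sum_neg_distrib]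
      exact Finset.sum_congr rfl fun i _ => by ring
    rw [h2]
    have h3 : (∑ i, u i * D y i) / a + (w n y - c) ≤ 0 := by
      have : ((∑ i, u i * D y i) + a * (w n y - c)) / a ≤ 0 := div_nonpos_of_nonpos_of_nonneg h1 ha
      rwa [add_div, mul_div_cancel_left₀ _ hne] at this
    linarith
  refine ⟨ha0, ?_⟩
  have h1 : ∀ᵐ y ∂P, ∑ i, u i * D y i ≤ 0 := by
    filter_upwards [h 0] with y hy
    rw [hfac, ha0, zero_mul, add_zero] at hy
    have hp := wt_pos (D y) (hb0 y)
    by_contra hcon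
    push Not at hcon
    exact absurd hy (not_le.2 (mul_pos hp hcon))
  filter_upwards [hNA u h1] with y hy
  rw [hfac, hy, mul_zero]

end Weight

end BN

namespace BN

section Selection

open ProbabilityTheory

variable {X Y : Type} {d : ℕ} [TopologicalSpace X] [PolishSpace X] [MeasurableSpace X]
  [BorelSpace X] [TopologicalSpace Y] [PolishSpace Y] [MeasurableSpace Y] [BorelSpace Y]
  {Δ : X × Y → Fin d → ℝ} {b : X × Y → ℝ}

theorem measurable_integral_dens {α : Type*} [MeasurableSpace α] (κ : Kernel α Y)
    [IsMarkovKernel κ] {h : α × Y → ℝ} (hh : Measurable h) :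
    Measurable fun q : α × (ℕ × (ℕ → ℝ)) => ∫ y, dens q.2 y * h (q.1, y) ∂κ q.1 := by
  have h1 : Measurable fun r : (α × (ℕ × (ℕ → ℝ))) × Y => dens r.1.2 r.2 * h (r.1.1, r.2) := by
    have e1 : Measurable fun r : (α × (ℕ × (ℕ → ℝ))) × Y => dens r.1.2 r.2 :=
      measurable_dens.comp (measurable_fst.snd.prodMk measurable_snd)
    have e2 : Measurable fun r : (α × (ℕ × (ℕ → ℝ))) × Y => h (r.1.1, r.2) :=
      hh.comp (measurable_fst.fst.prodMk measurable_snd)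
    exact e1.mul e2
  exact (h1.stronglyMeasurable.integral_kernel_prod_right'
    (κ := κ.comap Prod.fst measurable_fst)).measurable

/-- Measurable selection of one-step martingale densities. -/
theorem exists_dens_selection (κ : Kernel X Y) [IsMarkovKernel κ] {ν : Measure X}
    [IsProbabilityMeasure ν] (hΔ : Measurable Δ) (hb : Measurable b) (hb0 : ∀ q, 0 ≤ b q)
    {w : ℕ → X × Y → ℝ} (hw : ∀ n, Measurable (w n)) (hmono : ∀ q, Monotone fun n => w n q)
    {B : ℕ → ℝ} (hB : ∀ n q, |w n q| ≤ B n * (1 + b q)) {c : X → ℝ} (hc : Measurable c)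
    (hNA : ∀ᵐ x ∂ν, ∀ u : Fin d → ℝ, (∀ᵐ y ∂κ x, ∑ i, u i * Δ (x, y) i ≤ 0) →
      ∀ᵐ y ∂κ x, ∑ i, u i * Δ (x, y) i = 0)
    (hyp : ∀ᵐ x ∂ν, ∀ u : Fin d → ℝ, ¬ ∀ n, ∀ᵐ y ∂κ x, w n (x, y) ≤ c x + ∑ i, u i * Δ (x, y) i) :
    ∃ N : X → ℕ, Measurable N ∧ ∃ Θ : X → ℕ × (ℕ → ℝ), Measurable Θ ∧ ∀ᵐ x ∂ν,
      (∀ i, ∫ y, dens (Θ x) y * (wt (Δ (x, y)) (b (x, y)) * Δ (x, y) i) ∂κ x = 0) ∧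
        0 < ∫ y, dens (Θ x) y * (wt (Δ (x, y)) (b (x, y)) * (w (N x) (x, y) - c x)) ∂κ x := by
  let A : Set (X × (ℕ × (ℕ × (ℕ → ℝ)))) := {a |
    (∀ i, ∫ y, dens a.2.2 y * (wt (Δ (a.1, y)) (b (a.1, y)) * Δ (a.1, y) i) ∂κ a.1 = 0) ∧
      0 < ∫ y, dens a.2.2 y * (wt (Δ (a.1, y)) (b (a.1, y)) * (w a.2.1 (a.1, y) - c a.1)) ∂κ a.1}
  have hwt : Measurable fun q : X × Y => wt (Δ q) (b q) := measurable_wt hΔ hb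
  have hA : MeasurableSet A := by
    refine MeasurableSet.inter (s₁ := {a : X × (ℕ × (ℕ × (ℕ → ℝ))) | ∀ i,
      ∫ y, dens a.2.2 y * (wt (Δ (a.1, y)) (b (a.1, y)) * Δ (a.1, y) i) ∂κ a.1 = 0}) ?_ ?_
    · rw [ofPred_forall]
      refine MeasurableSet.iInter fun i => ?_
      have h1 : Measurable fun q : X × Y => wt (Δ q) (b q) * Δ q i :=
        hwt.mul (measurable_pi_iff.1 hΔ i)
      have h2 := (measurable_integral_dens κ h1).comp
        (measurable_fst.prodMk measurable_snd.snd : Measurable fun a : X × (ℕ × (ℕ × (ℕ → ℝ))) =>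
          (a.1, a.2.2))
      exact h2 (measurableSet_singleton 0)
    · have h1 : Measurable fun q : (X × ℕ) × Y =>
          wt (Δ (q.1.1, q.2)) (b (q.1.1, q.2)) * (w q.1.2 (q.1.1, q.2) - c q.1.1) := by
        have e1 : Measurable fun q : (X × ℕ) × Y => (q.1.1, q.2) :=
          measurable_fst.fst.prodMk measurable_snd
        have e2 : Measurable fun q : (X × Y) × ℕ => w q.2 q.1 :=
          measurable_from_prod_countable_left fun n => hw n
        have e3 : Measurable fun q : (X × ℕ) × Y => w q.1.2 (q.1.1, q.2) :=
          e2.comp (e1.prodMk measurable_fst.snd)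
        have e4 : Measurable fun q : (X × ℕ) × Y => c q.1.1 := hc.comp measurable_fst.fst
        exact (hwt.comp e1).mul (e3.sub e4)
      have h2 := (measurable_integral_dens (κ.comap Prod.fst measurable_fst) h1).comp
        ((measurable_fst.prodMk measurable_snd.fst).prodMk measurable_snd.snd :
          Measurable fun a : X × (ℕ × (ℕ × (ℕ → ℝ))) => ((a.1, a.2.1), a.2.2))
      exact h2 measurableSet_Ioi
  obtain ⟨σ, hσ, hσA, -⟩ := exists_uMeas_selection hA.analyticSet continuous_fst
    (σ₀ := fun x => (x, (0, (0, 0)))) (measurable_id.prodMk measurable_const).uMeas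
  have hae := hσ.aemeasurable ν
  refine ⟨fun x => (hae.mk σ x).2.1, hae.measurable_mk.snd.fst, fun x => (hae.mk σ x).2.2,
    hae.measurable_mk.snd.snd, ?_⟩
  filter_upwards [hNA, hyp, hae.ae_eq_mk] with x h1 h2 h3
  have hsec : Measurable fun y : Y => (x, y) := measurable_prodMk_left
  obtain ⟨n, θ, h4, h5⟩ := exists_dens_wt (P := κ x) (hΔ.comp hsec) (hb.comp hsec)
    (fun y => hb0 (x, y)) h1 (fun n => (hw n).comp hsec) (fun y => hmono (x, y))
    (fun n y => hB n (x, y)) h2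
  obtain ⟨h6, h7⟩ := hσA x ⟨(x, (n, θ)), ⟨h4, h5⟩, rfl⟩
  rw [← h3]
  have h8 := h6
  simp only [A, mem_ofPred_eq, h7] at h8
  exact h8

/-- The kernel with a given density, normalised. -/
theorem exists_kernel_dens (κ : Kernel X Y) [IsMarkovKernel κ] (hΔ : Measurable Δ)
    (hb : Measurable b) (hb0 : ∀ q, 0 ≤ b q) {Θ : X → ℕ × (ℕ → ℝ)} (hΘ : Measurable Θ) :
    ∃ q : Kernel X Y, IsMarkovKernel q ∧ (∀ x, q x ≪ κ x ∧ κ x ≪ q x) ∧ ∃ Z : X → ℝ,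
      (∀ x, 0 < Z x) ∧ ∀ x (a : Y → ℝ),
        (Integrable (fun y => dens (Θ x) y * (wt (Δ (x, y)) (b (x, y)) * a y)) (κ x) →
          Integrable a (q x)) ∧
        ∫ y, a y ∂q x = Z x * ∫ y, dens (Θ x) y * (wt (Δ (x, y)) (b (x, y)) * a y) ∂κ x := by
  have hwt : Measurable fun q : X × Y => wt (Δ q) (b q) := measurable_wt hΔ hb
  let D : X → Y → ℝ := fun x y => dens (Θ x) y * wt (Δ (x, y)) (b (x, y))
  have hD : Measurable (Function.uncurry D) :=
    (measurable_dens.comp ((hΘ.comp measurable_fst).prodMk measurable_snd)).mul hwt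
  have hDpos x y : 0 < D x y := mul_pos (dens_pos _ _) (wt_pos _ (hb0 _))
  have hsec (x : X) : Measurable fun y : Y => (x, y) := measurable_prodMk_left
  have hDint x : Integrable (D x) (κ x) :=
    integrable_dens_mul _ (integrable_wt (hΔ.comp (hsec x)) (hb.comp (hsec x)) fun y => hb0 _)
  let I : X → ℝ := fun x => ∫ y, D x y ∂κ x
  have hI : Measurable I := (hD.stronglyMeasurable.integral_kernel_prod_right' (κ := κ)).measurable
  have hIpos x : 0 < I x := by
    rw [integral_pos_iff_support_of_nonneg (fun y => (hDpos x y).le) (hDint x)]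
    have : Function.support (D x) = univ := by
      ext y; simp [(hDpos x y).ne']
    simp [this]
  let G : X → Y → ℝ := fun x y => (I x)⁻¹ * D x y
  have hG : Measurable (Function.uncurry G) := (hI.comp measurable_fst).inv.mul hD
  have hGpos x y : 0 < G x y := mul_pos (inv_pos.2 (hIpos x)) (hDpos x y)
  let E : X → Y → ℝ≥0∞ := fun x y => ENNReal.ofReal (G x y)
  have hE : Measurable (Function.uncurry E) := ENNReal.measurable_ofReal.comp hG
  have hEx x : Measurable (E x) := hE.comp (hsec x)
  have hq x : Kernel.withDensity κ E x = (κ x).withDensity (E x) := Kernel.withDensity_apply _ hE x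
  have htoReal x y : (E x y).toReal = G x y := ENNReal.toReal_ofReal (hGpos x y).le
  refine ⟨Kernel.withDensity κ E, ⟨fun x => ⟨?_⟩⟩, fun x => ⟨?_, ?_⟩, fun x => (I x)⁻¹,
    fun x => inv_pos.2 (hIpos x), fun x a => ⟨fun ha => ?_, ?_⟩⟩
  · rw [hq, withDensity_apply _ MeasurableSet.univ, Measure.restrict_univ,
      ← ofReal_integral_eq_lintegral_ofReal ((hDint x).const_mul _)
        (ae_of_all _ fun y => (hGpos x y).le), integral_const_mul]
    rw [show ∫ y, D x y ∂κ x = I x from rfl, inv_mul_cancel₀ (hIpos x).ne', ENNReal.ofReal_one]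
  · rw [hq]; exact withDensity_absolutelyContinuous _ _
  · rw [hq]
    refine withDensity_absolutelyContinuous' (hEx x).aemeasurable (ae_of_all _ fun y => ?_)
    simpa [E] using hGpos x y
  · rw [hq, integrable_withDensity_iff_integrable_smul' (hEx x)
      (ae_of_all _ fun y => ENNReal.ofReal_lt_top)]
    refine (ha.const_mul (I x)⁻¹).congr (ae_of_all _ fun y => ?_)
    simp only [htoReal, smul_eq_mul, G, D]
    ring
  · rw [hq, integral_withDensity_eq_integral_toReal_smul (hEx x)
      (ae_of_all _ fun y => ENNReal.ofReal_lt_top), ← integral_const_mul]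
    refine integral_congr_ae (ae_of_all _ fun y => ?_)
    simp only [htoReal, smul_eq_mul, G, D]
    ring

/-- Real approximations from below of an extended real. -/
def lowerApprox (n : ℕ) (a : EReal) : ℝ := (min a ((n : ℝ) : EReal)).toReal - 1 / (n + 1)

theorem measurable_lowerApprox (n : ℕ) : Measurable (lowerApprox n) :=
  ((measurable_id.min measurable_const).ereal_toReal).sub measurable_const

theorem lowerApprox_eq {a : EReal} (ha : ⊥ < a) (n : ℕ) :
    ((lowerApprox n a + 1 / (n + 1) : ℝ) : EReal) = min a ((n : ℝ) : EReal) := by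
  rw [lowerApprox, sub_add_cancel]
  refine EReal.coe_toReal (ne_top_of_le_ne_top (EReal.coe_ne_top (n : ℝ)) (min_le_right _ _)) ?_
  exact (lt_min ha (EReal.bot_lt_coe _)).ne'

theorem lowerApprox_bot (n : ℕ) : lowerApprox n ⊥ = - (1 / (n + 1)) := by
  simp [lowerApprox]

theorem monotone_lowerApprox (a : EReal) : Monotone fun n => lowerApprox n a := by
  intro n m hnm
  have h2 : (1 : ℝ) / (m + 1) ≤ 1 / (n + 1) := by gcongr
  rcases bot_le (a := a) |>.eq_or_lt with rfl | ha
  · simp only [lowerApprox_bot]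
    linarith
  · have h1 : min a ((n : ℝ) : EReal) ≤ min a ((m : ℝ) : EReal) :=
      min_le_min le_rfl (EReal.coe_le_coe_iff.2 (by exact_mod_cast hnm))
    rw [← lowerApprox_eq ha, ← lowerApprox_eq ha, EReal.coe_le_coe_iff] at h1
    simp only
    linarith

theorem lowerApprox_le (n : ℕ) (a : EReal) : lowerApprox n a ≤ n := by
  have h2 : (0 : ℝ) < 1 / (n + 1) := by positivity
  rcases bot_le (a := a) |>.eq_or_lt with rfl | ha
  · rw [lowerApprox_bot]
    have : (0 : ℝ) ≤ n := Nat.cast_nonneg n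
    linarith
  · have h1 := min_le_right a ((n : ℝ) : EReal)
    rw [← lowerApprox_eq ha, EReal.coe_le_coe_iff] at h1
    linarith

theorem abs_lowerApprox_le (n : ℕ) (a : EReal) :
    |lowerApprox n a| ≤ (n + 1) * (1 + |lowerApprox 0 a|) := by
  have h1 := lowerApprox_le n a
  have h2 : lowerApprox 0 a ≤ lowerApprox n a := monotone_lowerApprox a (Nat.zero_le n)
  have h3 := neg_abs_le (lowerApprox 0 a)
  have h4 : (0 : ℝ) ≤ n := Nat.cast_nonneg n
  have h5 := abs_nonneg (lowerApprox 0 a)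
  rw [abs_le]
  constructor <;> nlinarith

theorem lowerApprox_lt {a : EReal} (ha : ⊥ < a) (n : ℕ) : (lowerApprox n a : EReal) < a := by
  have h2 : (0 : ℝ) < 1 / (n + 1) := by positivity
  refine lt_of_lt_of_le (EReal.coe_lt_coe_iff.2 (lt_add_of_pos_right _ h2)) ?_
  rw [lowerApprox_eq ha]
  exact min_le_left _ _

theorem le_of_lowerApprox_le {a : EReal} {r : ℝ} (h : ∀ n, lowerApprox n a ≤ r) :
    a ≤ (r : EReal) := by
  rcases bot_le (a := a) |>.eq_or_lt with rfl | ha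
  · exact bot_le
  by_contra hcon
  push Not at hcon
  obtain ⟨r', h1, h2⟩ := EReal.lt_iff_exists_real_btwn.1 hcon
  rw [EReal.coe_lt_coe_iff] at h1
  obtain ⟨m, hm⟩ := exists_nat_one_div_lt (sub_pos.2 h1)
  obtain ⟨k, hk⟩ := exists_nat_ge r'
  have h3 : (1 : ℝ) / ((max m k : ℕ) + 1) ≤ 1 / (m + 1) := by
    gcongr
    exact_mod_cast le_max_left m k
  have h4 : (r' : EReal) ≤ min a (((max m k : ℕ) : ℝ) : EReal) :=
    le_min h2.le (EReal.coe_le_coe_iff.2 (hk.trans (by exact_mod_cast le_max_right m k)))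
  rw [← lowerApprox_eq ha, EReal.coe_le_coe_iff] at h4
  have := h (max m k)
  linarith

end Selection

end BN

namespace BN

section MartingaleStep

open ProbabilityTheory

variable {X Y : Type} {d : ℕ} [TopologicalSpace X] [PolishSpace X] [MeasurableSpace X]
  [BorelSpace X] [TopologicalSpace Y] [PolishSpace Y] [MeasurableSpace Y] [BorelSpace Y]
  (s : Step X Y) {Δ : X × Y → Fin d → ℝ} {f : X × Y → EReal} {𝔑 : Set (Measure X)}

theorem analyticSet_short_univ (hΔ : Measurable Δ) (hf : UpperSemianalyticE f) :
    AnalyticSet {q : (ℕ → ℕ) × ℝ | ∀ u, s.k q.1 (short Δ f (s.p q.1) q.2 u) ≠ 0} := by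
  have h := AnalyticSet.iInter fun n : ℕ =>
    analyticSet_short s hΔ hf (isCompact_closedBall (0 : Fin d → ℝ) n)
  convert h using 1
  ext q
  simp only [mem_ofPred_eq, mem_iInter]
  refine ⟨fun h n u _ => h u, fun h u => ?_⟩
  obtain ⟨n, hn⟩ := exists_nat_ge (dist u 0)
  exact h n u hn

theorem analyticSet_exists_dens (hΔ : Measurable Δ) :
    AnalyticSet {q : (ℕ → ℕ) × ℝ | ∃ θ, ∀ i, ∫ y, dens θ y *
      (wt (Δ (s.p q.1, y)) 1 * Δ (s.p q.1, y) i) ∂s.k q.1 = 0} := by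
  have _ := s.markov
  let A : Set (((ℕ → ℕ) × ℝ) × (ℕ × (ℕ → ℝ))) := {a | ∀ i, ∫ y, dens a.2 y *
      (wt (Δ (s.p a.1.1, y)) 1 * Δ (s.p a.1.1, y) i) ∂s.k a.1.1 = 0}
  have hA : MeasurableSet A := by
    simp only [A]
    rw [ofPred_forall]
    refine MeasurableSet.iInter fun i => ?_
    have e1 : Measurable fun q : (ℕ → ℕ) × Y => Δ (s.p q.1, q.2) :=
      hΔ.comp ((s.continuous_p.measurable.comp measurable_fst).prodMk measurable_snd)
    have e2 : Measurable fun q : (ℕ → ℕ) × Y =>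
        wt (Δ (s.p q.1, q.2)) 1 * Δ (s.p q.1, q.2) i :=
      (measurable_wt e1 measurable_const).mul (measurable_pi_iff.1 e1 i)
    have h2 := (measurable_integral_dens s.k e2).comp
      (measurable_fst.fst.prodMk measurable_snd :
        Measurable fun a : ((ℕ → ℕ) × ℝ) × (ℕ × (ℕ → ℝ)) => (a.1.1, a.2))
    exact h2 (measurableSet_singleton 0)
  convert hA.analyticSet.image_of_continuous continuous_fst using 1
  ext q
  simp [A]

theorem absolutelyContinuous_of_half_le {P P' : Measure Y} (h : (2⁻¹ : ℝ≥0∞) • P ≤ P') :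
    P ≪ P' := by
  refine Measure.AbsolutelyContinuous.mk fun A _ hA => ?_
  by_contra hne
  exact measure_ne_zero_of_half_le h hne hA

variable {s}

/-- At a point with a good local market and capital below the superhedging price, every model is
dominated by one which is arbitrage free and under which the claim cannot be superhedged. -/
theorem Good.exists_dominating {x : X} (hg : Good s Δ f x) (hΔ : Measurable Δ) {c : ℝ}
    (hc : (c : EReal) < price s Δ f x) {z₀ : ℕ → ℕ} (hz₀ : s.p z₀ = x) :
    ∃ z, s.p z = x ∧ (2⁻¹ : ℝ≥0∞) • s.k z₀ ≤ s.k z ∧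
      (∀ u, s.k z (short Δ f x c u) ≠ 0) ∧
      ∃ θ, ∀ i, ∫ y, dens θ y * (wt (Δ (x, y)) 1 * Δ (x, y) i) ∂s.k z = 0 := by
  have _ := s.markov
  obtain ⟨z₁, hz₁, hshort, hNA, -⟩ := hg.hedge_eq_empty_of_lt (hedge_eq_empty_of_lt_price hc)
  obtain ⟨z, hz, h0, h1⟩ := s.exists_half z₀ z₁ (hz₀.trans hz₁.symm)
  have hzx : s.p z = x := hz.trans hz₀
  refine ⟨z, hzx, h0, fun u => measure_ne_zero_of_half_le h1 (hshort u), ?_⟩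
  have hNA' : ∀ u : Fin d → ℝ, (∀ᵐ y ∂s.k z, ∑ i, u i * Δ (x, y) i ≤ 0) →
      ∀ᵐ y ∂s.k z, ∑ i, u i * Δ (x, y) i = 0 := by
    intro u hu
    have h2 := hNA (-u) (by
      filter_upwards [(absolutelyContinuous_of_half_le h1).ae_le hu] with y hy
      simpa using hy) z hzx
    filter_upwards [h2] with y hy
    simpa using hy
  have hsec : Measurable fun y : Y => (x, y) := measurable_prodMk_left
  obtain ⟨n, θ, h, -⟩ := exists_dens_wt (P := s.k z) (D := fun y => Δ (x, y)) (b := fun _ => 1)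
    (hΔ.comp hsec) measurable_const (fun _ => zero_le_one) hNA' (w := fun _ _ => 1) (c := 0)
    (B := fun _ => 1) (fun _ => measurable_const) (fun _ => monotone_const) (by norm_num)
    fun u hu => by
      have h3 := hNA' (-u) (by
        filter_upwards [hu 0] with y hy
        simp only [Pi.neg_apply, neg_mul, Finset.sum_neg_distrib]
        linarith)
      have h4 : ∀ᵐ y ∂s.k z, False := by
        filter_upwards [hu 0, h3] with y hy hy'
        simp only [Pi.neg_apply, neg_mul, Finset.sum_neg_distrib] at hy'
        linarith
      exact (IsProbabilityMeasure.ne_zero (s.k z)) (ae_eq_bot.1 (by simpa using h4))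
  exact ⟨θ, h⟩

/-- The one-step construction of martingale kernels pricing a claim above a given level. -/
theorem exists_martingale_step (hNA : LocalNA s Δ 𝔑) (hΔ : Measurable Δ)
    (hf : UpperSemianalyticE f) (hbot : s.QS 𝔑 fun q => ⊥ < f q) {ν : Measure X} (hν : ν ∈ 𝔑)
    [IsProbabilityMeasure ν] {c : X → ℝ} (hc : Measurable c)
    (hlt : ∀ᵐ x ∂ν, (c x : EReal) < price s Δ f x) {σ₀ : X → (ℕ → ℕ)} (hσ₀ : s.IsSection σ₀) :
    ∃ σ, s.IsSection σ ∧ (∀ x, s.k (σ₀ x) ≪ s.k (σ x)) ∧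
      ∃ κ : Kernel X Y, IsMarkovKernel κ ∧ (∀ᵐ x ∂ν, κ x = s.k (σ x)) ∧
      ∃ c' : X × Y → ℝ, Measurable c' ∧ (∀ᵐ x ∂ν, ∀ᵐ y ∂κ x, (c' (x, y) : EReal) < f (x, y)) ∧
      ∀ φ : X × Y → ℝ, Measurable φ → (∀ q, 0 ≤ φ q) →
        ∃ q : Kernel X Y, IsMarkovKernel q ∧ (∀ x, q x ≪ κ x ∧ κ x ≪ q x) ∧
          ∀ᵐ x ∂ν, Integrable (fun y => φ (x, y)) (q x) ∧
            (∀ i, Integrable (fun y => Δ (x, y) i) (q x) ∧ ∫ y, Δ (x, y) i ∂q x = 0) ∧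
            Integrable (fun y => c' (x, y)) (q x) ∧ c x < ∫ y, c' (x, y) ∂q x := by
  have _ := s.markov
  obtain ⟨σ, hσ, hdom⟩ := s.exists_section_dominating hσ₀
    (AnalyticSet.inter' (analyticSet_short_univ s hΔ hf) (analyticSet_exists_dens s hΔ)) hc.uMeas
  have hae := hσ.uMeas.aemeasurable ν
  let κ : Kernel X Y := s.k.comap (hae.mk σ) hae.measurable_mk
  have hκ : ∀ᵐ x ∂ν, κ x = s.k (σ x) := by
    filter_upwards [hae.ae_eq_mk] with x hx
    rw [Kernel.comap_apply, ← hx]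
  have hfae := hf.uMeas.aemeasurable (ν ⊗ₘ κ)
  set f' := hfae.mk f with hf'
  have hf'm : Measurable f' := hfae.measurable_mk
  have hff' : ∀ᵐ x ∂ν, ∀ᵐ y ∂κ x, f (x, y) = f' (x, y) :=
    Measure.ae_ae_of_ae_compProd hfae.ae_eq_mk
  have hfbot : ∀ᵐ x ∂ν, ∀ᵐ y ∂κ x, ⊥ < f (x, y) := by
    filter_upwards [hbot ν hν σ hσ, hκ] with x h1 h2
    rwa [h2]
  have hR : ∀ᵐ x ∂ν, (∀ u, κ x (short Δ f x (c x) u) ≠ 0) ∧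
      ∃ θ, ∀ i, ∫ y, dens θ y * (wt (Δ (x, y)) 1 * Δ (x, y) i) ∂κ x = 0 := by
    filter_upwards [hNA.ae_good hΔ hbot hν, hlt, hκ] with x h1 h2 h3
    obtain ⟨z, hz, hz0, hz1, hz2⟩ := h1.exists_dominating hΔ h2 (hσ₀.p_eq x)
    have h4 := (hdom x).2 ⟨z, hz, hz0, by subst hz; exact ⟨hz1, hz2⟩⟩
    obtain ⟨h5, h6⟩ := h4
    simp only [mem_ofPred_eq, hσ.p_eq] at h5 h6
    rw [h3]
    exact ⟨h5, h6⟩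
  have hsec (x : X) : Measurable fun y : Y => (x, y) := measurable_prodMk_left
  have hNA' : ∀ᵐ x ∂ν, ∀ u : Fin d → ℝ, (∀ᵐ y ∂κ x, ∑ i, u i * Δ (x, y) i ≤ 0) →
      ∀ᵐ y ∂κ x, ∑ i, u i * Δ (x, y) i = 0 := by
    filter_upwards [hR] with x ⟨_, θ, hθ⟩ u hu
    exact ae_eq_zero_of_dens (hΔ.comp (hsec x)) measurable_const (fun _ => zero_le_one) hθ hu
  have hw n : Measurable fun q : X × Y => lowerApprox n (f' q) :=
    (measurable_lowerApprox n).comp hf'm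
  have hb₁ : Measurable fun q : X × Y => |lowerApprox 0 (f' q)| := (hw 0).abs
  obtain ⟨N, hN, Θ₁, -, hΘ₁⟩ := exists_dens_selection κ (ν := ν) hΔ hb₁ (fun _ => abs_nonneg _)
    hw (fun q => monotone_lowerApprox _) (B := fun n => n + 1)
    (fun n q => abs_lowerApprox_le n _) hc hNA' (by
      filter_upwards [hR, hff'] with x ⟨h1, _⟩ h2 u hu
      refine h1 u ?_
      rw [measure_eq_zero_iff_ae_notMem]
      filter_upwards [ae_all_iff.2 hu, h2] with y hy hy2
      simp only [short, mem_ofPred_eq, not_lt]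
      rw [hy2]
      exact le_of_lowerApprox_le hy)
  let c' : X × Y → ℝ := fun q => lowerApprox (N q.1) (f' q)
  have hc' : Measurable c' := by
    have e2 : Measurable fun q : (X × Y) × ℕ => lowerApprox q.2 (f' q.1) :=
      measurable_from_prod_countable_left fun n => hw n
    exact e2.comp (measurable_id.prodMk (hN.comp measurable_fst))
  refine ⟨σ, hσ, fun x => absolutelyContinuous_of_half_le (hdom x).1, κ, inferInstance, hκ, c', hc',
    ?_, fun φ hφ hφ0 => ?_⟩
  · filter_upwards [hff', hfbot] with x h1 h2
    filter_upwards [h1, h2] with y hy1 hy2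
    rw [hy1] at hy2 ⊢
    exact lowerApprox_lt hy2 _
  have hb : Measurable fun q : X × Y => |c' q| + φ q := hc'.abs.add hφ
  have hb0 q : 0 ≤ |c' q| + φ q := add_nonneg (abs_nonneg _) (hφ0 q)
  obtain ⟨-, -, Θ, hΘ, hΘ'⟩ := exists_dens_selection κ (ν := ν) hΔ hb hb0 (w := fun _ => c')
    (fun _ => hc') (fun q => monotone_const) (B := fun _ => 1)
    (fun n q => by have := hφ0 q; linarith) hc hNA' (by
      filter_upwards [hΘ₁] with x ⟨h1, h2⟩ u hu
      refine not_ae_le_of_dens (hΔ.comp (hsec x)) (hb₁.comp (hsec x)) (fun _ => abs_nonneg _)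
        h1 h2 u ?_
      filter_upwards [hu 0] with y hy
      simp only [c'] at hy
      simp only [Function.comp_apply]
      linarith)
  obtain ⟨q, hq, hqκ, Z, hZ, hInt⟩ := exists_kernel_dens κ hΔ hb hb0 hΘ
  refine ⟨q, hq, hqκ, ?_⟩
  have hI (x : X) {a : Y → ℝ} (ha : Measurable a) {B : ℝ}
      (h : ∀ y, |a y| ≤ B * (1 + ∑ i, |Δ (x, y) i| + (|c' (x, y)| + φ (x, y)))) :
      Integrable a (q x) :=
    (hInt x a).1 (integrable_dens_mul _ (integrable_wt_mul (P := κ x) (hΔ.comp (hsec x))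
      (hb.comp (hsec x)) (fun y => hb0 _) ha h))
  have hsum (x y) : 0 ≤ ∑ i, |Δ (x, y) i| := Finset.sum_nonneg fun _ _ => abs_nonneg _
  have hIc x : Integrable (fun y => c' (x, y)) (q x) :=
    hI x (hc'.comp (hsec x)) (B := 1) fun y => by
      have := hφ0 (x, y); have := hsum x y; linarith
  filter_upwards [hΘ'] with x ⟨h1, h2⟩
  refine ⟨hI x (hφ.comp (hsec x)) (B := 1) fun y => ?_, fun i => ⟨hI x
    ((measurable_pi_iff.1 hΔ i).comp (hsec x)) (B := 1) fun y => ?_, ?_⟩, hIc x, ?_⟩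
  · rw [abs_of_nonneg (hφ0 (x, y))]
    have := hsum x y; have := abs_nonneg (c' (x, y)); linarith
  · have := Finset.single_le_sum (f := fun i => |Δ (x, y) i|) (fun _ _ => abs_nonneg _)
      (Finset.mem_univ i)
    have := hb0 (x, y)
    linarith
  · rw [(hInt x _).2, h1 i, mul_zero]
  · have h3 := (hInt x fun y => c' (x, y) - c x).2
    rw [integral_sub (hIc x) (integrable_const _)] at h3
    have h4 := mul_pos (hZ x) h2
    simp only [integral_const, probReal_univ, smul_eq_mul, one_mul] at h3
    linarith

end MartingaleStep

end BN

namespace BN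

/-! ### From one step to the path space -/

theorem UMeas.sum {α ι : Type*} [MeasurableSpace α] [Fintype ι] {f : ι → α → ℝ}
    (hf : ∀ i, UMeas (f i)) : UMeas fun x => ∑ i, f i x := by
  let _ : MeasurableSpace α := univComp α
  exact Finset.measurable_fun_sum _ fun i _ => hf i

theorem UMeas.mul {α : Type*} [MeasurableSpace α] {f g : α → ℝ} (hf : UMeas f) (hg : UMeas g) :
    UMeas fun x => f x * g x := by
  let _ : MeasurableSpace α := univComp α
  exact Measurable.mul hf hg

theorem UMeas.add {α : Type*} [MeasurableSpace α] {f g : α → ℝ} (hf : UMeas f) (hg : UMeas g) :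
    UMeas fun x => f x + g x := by
  let _ : MeasurableSpace α := univComp α
  exact Measurable.add hf hg

section PathSpace

open ProbabilityTheory

variable {Ω₁ : Type} [MeasurableSpace Ω₁]

variable (Ω₁) in
/-- Appending a coordinate to a path. -/
def snocE (t : ℕ) (q : (Fin t → Ω₁) × Ω₁) : Fin (t + 1) → Ω₁ := Fin.snoc (α := fun _ => Ω₁) q.1 q.2

theorem snocE_castSucc {t : ℕ} (q : (Fin t → Ω₁) × Ω₁) (i : Fin t) :
    snocE Ω₁ t q i.castSucc = q.1 i := by simp [snocE]

theorem snocE_last {t : ℕ} (q : (Fin t → Ω₁) × Ω₁) : snocE Ω₁ t q (Fin.last t) = q.2 := by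
  simp [snocE]

theorem restr_self {t : ℕ} (ω : Fin t → Ω₁) : restr Ω₁ t le_rfl ω = ω := rfl

theorem restr_snocE {t u : ℕ} (h : u ≤ t) (h' : u ≤ t + 1) (q : (Fin t → Ω₁) × Ω₁) :
    restr Ω₁ u h' (snocE Ω₁ t q) = restr Ω₁ u h q.1 := by
  ext i
  exact snocE_castSucc q (Fin.castLE h i)

theorem snocE_restr {t : ℕ} (ω : Fin (t + 1) → Ω₁) :
    snocE Ω₁ t (restr Ω₁ t (Nat.le_succ t) ω, ω (Fin.last t)) = ω := by
  ext i
  refine Fin.lastCases ?_ (fun i => ?_) i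
  · rw [snocE_last]
  · rw [snocE_castSucc]; rfl

theorem measurable_restr {T t : ℕ} (h : t ≤ T) : Measurable (restr Ω₁ t h) :=
  measurable_pi_iff.2 fun i => measurable_pi_apply (Fin.castLE h i)

theorem measurable_snocE (t : ℕ) : Measurable (snocE Ω₁ t) := by
  refine measurable_pi_iff.2 fun i => ?_
  refine Fin.lastCases ?_ (fun i => ?_) i
  · simpa only [snocE_last] using measurable_snd
  · simp only [snocE_castSucc]
    exact (measurable_pi_apply i).comp measurable_fst

theorem measurable_unsnoc (t : ℕ) : Measurable fun ω : Fin (t + 1) → Ω₁ =>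
    (restr Ω₁ t (Nat.le_succ t) ω, ω (Fin.last t)) :=
  (measurable_restr _).prodMk (measurable_pi_apply _)

theorem measurable_incr {d : ℕ} {S : (t : ℕ) → (Fin t → Ω₁) → Fin d → ℝ} {t : ℕ}
    (h : Measurable (S t)) (h' : Measurable (S (t + 1))) :
    Measurable fun q : (Fin t → Ω₁) × Ω₁ => incr Ω₁ S t q.1 q.2 := by
  refine measurable_pi_iff.2 fun i => ?_
  exact ((measurable_pi_apply i).comp (h'.comp (measurable_snocE t))).sub
    ((measurable_pi_apply i).comp (h.comp measurable_fst))

section Gain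

variable {d T : ℕ} {S : (t : ℕ) → (Fin t → Ω₁) → Fin d → ℝ}
  {H : (u : ℕ) → (Fin u → Ω₁) → Fin d → ℝ}

theorem gain_succ {t : ℕ} (h : t + 1 ≤ T) (ω : Fin T → Ω₁) :
    gain Ω₁ S H (t + 1) h ω = gain Ω₁ S H t ((Nat.le_succ t).trans h) ω +
      ∑ i, H t (restr Ω₁ t ((Nat.le_succ t).trans h) ω) i *
        (S (t + 1) (restr Ω₁ (t + 1) h ω) i -
          S t (restr Ω₁ t ((Nat.le_succ t).trans h) ω) i) := by
  rw [gain, Fin.sum_univ_castSucc]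
  rfl

theorem gain_snocE {t : ℕ} (q : (Fin t → Ω₁) × Ω₁) :
    gain Ω₁ S H (t + 1) le_rfl (snocE Ω₁ t q) =
      gain Ω₁ S H t le_rfl q.1 + ∑ i, H t q.1 i * incr Ω₁ S t q.1 q.2 i := by
  rw [gain_succ]
  congr 1
  · refine Finset.sum_congr rfl fun u _ => Finset.sum_congr rfl fun i _ => ?_
    rw [restr_snocE u.2.le, restr_snocE u.2]
  · refine Finset.sum_congr rfl fun i _ => ?_
    rw [restr_snocE le_rfl, restr_self, restr_self]
    rfl

theorem gain_update {t : ℕ} (y : (Fin t → Ω₁) → Fin d → ℝ) (ω : Fin t → Ω₁) :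
    gain Ω₁ S (Function.update H t y) t le_rfl ω = gain Ω₁ S H t le_rfl ω := by
  refine Finset.sum_congr rfl fun u _ => Finset.sum_congr rfl fun i _ => ?_
  rw [Function.update_of_ne u.2.ne]

theorem Pred.update (hH : Pred Ω₁ d H) {t : ℕ} {y : (Fin t → Ω₁) → Fin d → ℝ} (hy : UMeas y) :
    Pred Ω₁ d (Function.update H t y) := by
  intro u
  rcases eq_or_ne u t with rfl | h
  · rw [Function.update_self]; exact hy
  · rw [Function.update_of_ne h]; exact hH u

theorem pred_zero : Pred Ω₁ d fun _ _ => 0 := fun _ => measurable_const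

theorem uMeas_gain [TopologicalSpace Ω₁] [PolishSpace Ω₁] [BorelSpace Ω₁]
    (hH : Pred Ω₁ d H) {t : ℕ} (h : t ≤ T) (hS : ∀ u ≤ t, Measurable (S u)) :
    UMeas (gain Ω₁ S H t h) := by
  have h1 : ∀ (u : Fin t) (i : Fin d), UMeas fun ω : Fin T → Ω₁ =>
      H u (restr Ω₁ u (u.2.le.trans h) ω) i *
        (S (u + 1) (restr Ω₁ (u + 1) (Nat.succ_le_of_lt (u.2.trans_le h)) ω) i
          - S u (restr Ω₁ u (u.2.le.trans h) ω) i) := by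
    intro u i
    have e1 : UMeas fun ω : Fin T → Ω₁ => H u (restr Ω₁ u (u.2.le.trans h) ω) i :=
      (measurable_pi_apply i).comp_uMeas (UMeas.comp (hH u) (measurable_restr _).uMeas)
    have e2 : Measurable fun ω : Fin T → Ω₁ =>
        (S (u + 1) (restr Ω₁ (u + 1) (Nat.succ_le_of_lt (u.2.trans_le h)) ω) i
          - S u (restr Ω₁ u (u.2.le.trans h) ω) i) :=
      ((measurable_pi_apply i).comp ((hS _ u.2).comp (measurable_restr _))).sub
        ((measurable_pi_apply i).comp ((hS _ u.2.le).comp (measurable_restr _)))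
    exact e1.mul e2.uMeas
  exact UMeas.sum fun u => UMeas.sum fun i => h1 u i

end Gain

/-- Almost sure validity under all measures of a family is quasi-sure validity for universally
measurable properties. -/
theorem quasiSure_iff {α : Type*} [MeasurableSpace α] {PP : Set (Measure α)} {R : α → Prop}
    (hR : MeasurableSet[univComp α] {a | R a}) :
    QuasiSure PP (univComp α) R ↔ ∀ P ∈ PP, ∀ᵐ a ∂P, R a := by
  refine ⟨fun ⟨A, _, hsub, h0⟩ P hP => measure_mono_null hsub (h0 P hP), fun h => ?_⟩
  refine ⟨{a | ¬ R a}, ?_, subset_rfl, fun P hP => h P hP⟩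
  rw [← compl_ofPred]
  exact MeasurableSet.compl hR

section Family

variable [TopologicalSpace Ω₁] [PolishSpace Ω₁] [BorelSpace Ω₁]

theorem continuous_snocE (t : ℕ) : Continuous (snocE Ω₁ t) := by
  refine continuous_pi fun i => ?_
  refine Fin.lastCases ?_ (fun i => ?_) i
  · simpa only [snocE_last] using continuous_snd
  · simp only [snocE_castSucc]
    exact (continuous_apply i).comp continuous_fst

/-- A parametrised step represents a family of sets of models. -/
structure Step.Represents {X Y : Type} [TopologicalSpace X] [MeasurableSpace X]
    [TopologicalSpace Y] [MeasurableSpace Y] [OpensMeasurableSpace Y]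
    (s : Step X Y) (Pt : X → Set (ProbabilityMeasure Y)) : Prop where
  exists_param : ∀ x, ∀ P ∈ Pt x, ∃ z, s.p z = x ∧ s.k z = P
  exists_model : ∀ σ : X → (ℕ → ℕ), UMeas σ → (∀ x, s.p (σ x) = x) →
    ∃ κ : X → ProbabilityMeasure Y, @Measurable _ _ (univComp X) (borel _) κ ∧
      (∀ x, κ x ∈ Pt x) ∧ ∀ x, (κ x : Measure Y) = s.k (σ x)

variable {Pt : (t : ℕ) → (Fin t → Ω₁) → Set (ProbabilityMeasure Ω₁)} {t : ℕ}
  {s : Step (Fin t → Ω₁) Ω₁}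

theorem bind_snoc_eq {ν : Measure (Fin t → Ω₁)} [IsProbabilityMeasure ν]
    {κ : (Fin t → Ω₁) → ProbabilityMeasure Ω₁} {κ' : Kernel (Fin t → Ω₁) Ω₁} [IsMarkovKernel κ']
    (h : ∀ᵐ x ∂ν, κ' x = κ x) :
    ν.bind (fun ω => Measure.map (Fin.snoc ω) (κ ω : Measure Ω₁)) =
      (ν ⊗ₘ κ').map (snocE Ω₁ t) := by
  have hm (ω : Fin t → Ω₁) : Measurable fun y : Ω₁ => snocE Ω₁ t (ω, y) :=
    (measurable_snocE t).comp measurable_prodMk_left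
  have happ (ω) {A : Set (Fin (t + 1) → Ω₁)} (hA : MeasurableSet A) :
      Measure.map (fun y => snocE Ω₁ t (ω, y)) (κ' ω) A =
        κ' ω (Prod.mk ω ⁻¹' (snocE Ω₁ t ⁻¹' A)) := Measure.map_apply (hm ω) hA
  have hmeas : Measurable fun ω => Measure.map (fun y => snocE Ω₁ t (ω, y)) (κ' ω) := by
    refine Measure.measurable_of_measurable_coe _ fun A hA => ?_
    simp only [happ _ hA]
    exact Kernel.measurable_kernel_prodMk_left (measurable_snocE t hA)
  have h1 : ν.bind (fun ω => Measure.map (Fin.snoc ω) (κ ω : Measure Ω₁)) =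
      ν.bind fun ω => Measure.map (fun y => snocE Ω₁ t (ω, y)) (κ' ω) := by
    refine Measure.bind_congr_right ?_
    filter_upwards [h] with x hx
    rw [hx]
    rfl
  rw [h1]
  ext A hA
  rw [Measure.bind_apply hA hmeas.aemeasurable, Measure.map_apply (measurable_snocE t) hA,
    Measure.compProd_apply (measurable_snocE t hA)]
  exact lintegral_congr fun ω => happ ω hA

theorem Step.IsSection.exists_kernel {σ : (Fin t → Ω₁) → (ℕ → ℕ)} (hσ : s.IsSection σ)
    (ν : Measure (Fin t → Ω₁)) [IsProbabilityMeasure ν] :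
    ∃ κ : Kernel (Fin t → Ω₁) Ω₁, IsMarkovKernel κ ∧ ∀ᵐ x ∂ν, κ x = s.k (σ x) := by
  have _ := s.markov
  have hae := hσ.uMeas.aemeasurable ν
  refine ⟨s.k.comap (hae.mk σ) hae.measurable_mk, inferInstance, ?_⟩
  filter_upwards [hae.ae_eq_mk] with x hx
  rw [Kernel.comap_apply, ← hx]

theorem Step.Represents.map_mem (hs : s.Represents (Pt t)) {ν : Measure (Fin t → Ω₁)}
    (hν : ν ∈ MeasFam Ω₁ Pt t) [IsProbabilityMeasure ν] {σ : (Fin t → Ω₁) → (ℕ → ℕ)}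
    (hσ : s.IsSection σ) {κ : Kernel (Fin t → Ω₁) Ω₁} [IsMarkovKernel κ]
    (hκ : ∀ᵐ x ∂ν, κ x = s.k (σ x)) :
    (ν ⊗ₘ κ).map (snocE Ω₁ t) ∈ MeasFam Ω₁ Pt (t + 1) := by
  obtain ⟨κ', h1, h2, h3⟩ := hs.exists_model σ hσ.uMeas hσ.p_eq
  refine ⟨ν, hν, κ', h1, h2, (bind_snoc_eq ?_).symm⟩
  filter_upwards [hκ] with x hx
  rw [hx, h3]

theorem Step.Represents.exists_of_mem (hs : s.Represents (Pt t))
    (hprob : ∀ ν ∈ MeasFam Ω₁ Pt t, IsProbabilityMeasure ν)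
    {μ : Measure (Fin (t + 1) → Ω₁)} (hμ : μ ∈ MeasFam Ω₁ Pt (t + 1)) :
    ∃ ν ∈ MeasFam Ω₁ Pt t, ∃ σ, s.IsSection σ ∧ ∃ κ : Kernel (Fin t → Ω₁) Ω₁, IsMarkovKernel κ ∧
      (∀ᵐ x ∂ν, κ x = s.k (σ x)) ∧ μ = (ν ⊗ₘ κ).map (snocE Ω₁ t) := by
  obtain ⟨ν, hν, κ', h1, h2, rfl⟩ := hμ
  have := hprob ν hν
  obtain ⟨σ, hσ, hσ'⟩ := s.exists_lift h1 fun x => hs.exists_param x _ (h2 x)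
  have hsec : s.IsSection σ := ⟨hσ, fun x => (hσ' x).1⟩
  obtain ⟨κ, hκ, hκσ⟩ := hsec.exists_kernel ν
  refine ⟨ν, hν, σ, hsec, κ, hκ, hκσ, bind_snoc_eq ?_⟩
  filter_upwards [hκσ] with x hx
  rw [hx, (hσ' x).2]

theorem Step.Represents.isProbabilityMeasure (hs : s.Represents (Pt t))
    (hprob : ∀ ν ∈ MeasFam Ω₁ Pt t, IsProbabilityMeasure ν) :
    ∀ μ ∈ MeasFam Ω₁ Pt (t + 1), IsProbabilityMeasure μ := by
  intro μ hμ
  obtain ⟨ν, hν, σ, hσ, κ, hκ, -, rfl⟩ := hs.exists_of_mem hprob hμ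
  have := hprob ν hν
  exact Measure.isProbabilityMeasure_map (measurable_snocE t).aemeasurable

theorem Step.Represents.qs_of_forall (hs : s.Represents (Pt t))
    (hprob : ∀ ν ∈ MeasFam Ω₁ Pt t, IsProbabilityMeasure ν) {R : (Fin (t + 1) → Ω₁) → Prop}
    (h : ∀ P ∈ MeasFam Ω₁ Pt (t + 1), ∀ᵐ ω ∂P, R ω) :
    s.QS (MeasFam Ω₁ Pt t) fun q => R (snocE Ω₁ t q) := by
  intro ν hν σ hσ
  have := hprob ν hν
  obtain ⟨κ, hκ, hκσ⟩ := hσ.exists_kernel ν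
  have h1 := Measure.ae_ae_of_ae_compProd (ae_of_ae_map (measurable_snocE t).aemeasurable
    (h _ (hs.map_mem hν hσ hκσ)))
  filter_upwards [h1, hκσ] with x hx hx'
  rwa [← hx']

theorem ae_map_snocE {ν : Measure (Fin t → Ω₁)} [IsProbabilityMeasure ν]
    {κ : Kernel (Fin t → Ω₁) Ω₁} [IsMarkovKernel κ] {R : (Fin (t + 1) → Ω₁) → Prop}
    (hR : MeasurableSet[univComp (Fin (t + 1) → Ω₁)] {ω | R ω})
    (h : ∀ᵐ x ∂ν, ∀ᵐ y ∂κ x, R (snocE Ω₁ t (x, y))) :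
    ∀ᵐ ω ∂(ν ⊗ₘ κ).map (snocE Ω₁ t), R ω := by
  have _ := Measure.isProbabilityMeasure_map (μ := ν ⊗ₘ κ) (measurable_snocE (Ω₁ := Ω₁) t).aemeasurable
  obtain ⟨B, hBsub, hB, hBae⟩ := (nullMeasurableSet_of_univComp (MeasurableSet.compl hR)
    ((ν ⊗ₘ κ).map (snocE Ω₁ t))).exists_measurable_subset_ae_eq
  change (ν ⊗ₘ κ).map (snocE Ω₁ t) {ω | R ω}ᶜ = 0
  rw [← measure_congr hBae, Measure.map_apply (measurable_snocE t) hB,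
    measure_eq_zero_iff_ae_notMem]
  refine Measure.ae_compProd_of_ae_ae (measurable_snocE t hB).compl ?_
  filter_upwards [h] with x hx
  filter_upwards [hx] with y hy hyB
  exact hBsub hyB hy

theorem Step.Represents.forall_of_qs (hs : s.Represents (Pt t))
    (hprob : ∀ ν ∈ MeasFam Ω₁ Pt t, IsProbabilityMeasure ν) {R : (Fin (t + 1) → Ω₁) → Prop}
    (hR : MeasurableSet[univComp (Fin (t + 1) → Ω₁)] {ω | R ω})
    (h : s.QS (MeasFam Ω₁ Pt t) fun q => R (snocE Ω₁ t q)) :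
    ∀ P ∈ MeasFam Ω₁ Pt (t + 1), ∀ᵐ ω ∂P, R ω := by
  intro P hP
  obtain ⟨ν, hν, σ, hσ, κ, hκ, hκσ, rfl⟩ := hs.exists_of_mem hprob hP
  have := hprob ν hν
  refine ae_map_snocE hR ?_
  filter_upwards [h ν hν σ hσ, hκσ] with x hx hx'
  rwa [hx']

end Family

end PathSpace

end BN

namespace BN

/-! ### Directedness and localisation of no-arbitrage -/

section Directed

open ProbabilityTheory

variable {X Y : Type} [TopologicalSpace X] [MeasurableSpace X] [PolishSpace X] [BorelSpace X]
  [TopologicalSpace Y] [MeasurableSpace Y] [PolishSpace Y] [BorelSpace Y]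

theorem Step.exists_section_dominating_both {s : Step X Y} {σ₁ σ₂ : X → (ℕ → ℕ)}
    (h₁ : s.IsSection σ₁) (h₂ : s.IsSection σ₂) :
    ∃ σ, s.IsSection σ ∧ ∀ x, s.k (σ₁ x) ≪ s.k (σ x) ∧ s.k (σ₂ x) ≪ s.k (σ x) := by
  let R : Set ((ℕ → ℕ) × (ℕ → ℕ)) :=
    {q | ∀ j, 2⁻¹ * s.k q.2 (testOpen Y j) ≤ s.k q.1 (testOpen Y j)}
  have hR : MeasurableSet R := by
    simp only [R, ofPred_forall]
    refine MeasurableSet.iInter fun j => measurableSet_le ?_ ?_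
    · exact ((s.k.measurable_coe (measurableSet_testOpen j)).comp measurable_snd).const_mul _
    · exact (s.k.measurable_coe (measurableSet_testOpen j)).comp measurable_fst
  obtain ⟨σ, hσ, hσ'⟩ := s.exists_section_dominating h₁ hR.analyticSet h₂.uMeas
  refine ⟨σ, hσ, fun x => ⟨absolutelyContinuous_of_half_le (hσ' x).1, ?_⟩⟩
  obtain ⟨z, hz, hz1, hz2⟩ := s.exists_half (σ₁ x) (σ₂ x) (by rw [h₁.p_eq, h₂.p_eq])
  have hmem := (hσ' x).2 ⟨z, by rw [hz, h₁.p_eq], hz1, fun j => by simpa using hz2 (testOpen Y j)⟩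
  have : IsFiniteMeasure ((2⁻¹ : ℝ≥0∞) • s.k (σ₂ x)) :=
    (s.k (σ₂ x)).smul_finite (ENNReal.inv_ne_top.2 two_ne_zero)
  exact absolutelyContinuous_of_half_le (le_of_testOpen fun j => by simpa using hmem j)

end Directed

section Family

open ProbabilityTheory

variable {Ω₁ : Type} [MeasurableSpace Ω₁] [TopologicalSpace Ω₁] [PolishSpace Ω₁] [BorelSpace Ω₁]
  {Pt : (t : ℕ) → (Fin t → Ω₁) → Set (ProbabilityMeasure Ω₁)} {t : ℕ}
  {s : Step (Fin t → Ω₁) Ω₁}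

theorem exists_represents [Nonempty Ω₁] (hne : ∀ ω, (Pt t ω).Nonempty)
    (hconv : ∀ ω, ConvexPM (Pt t ω))
    (hgraph : AnalyticSet {p : (Fin t → Ω₁) × ProbabilityMeasure Ω₁ | p.2 ∈ Pt t p.1}) :
    ∃ s : Step (Fin t → Ω₁) Ω₁, s.Represents (Pt t) := by
  obtain ⟨s, -, h1, h2⟩ := exists_step hne hconv hgraph
  exact ⟨s, h1, h2⟩

theorem isProbabilityMeasure_of_mem (hs : ∀ u < t, ∃ s : Step (Fin u → Ω₁) Ω₁,
    s.Represents (Pt u)) : ∀ P ∈ MeasFam Ω₁ Pt t, IsProbabilityMeasure P := by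
  induction t with
  | zero =>
    rintro P (rfl : P = _)
    infer_instance
  | succ t ih =>
    obtain ⟨s, h⟩ := hs t t.lt_succ_self
    exact h.isProbabilityMeasure (ih fun u hu => hs u (hu.trans t.lt_succ_self))

theorem measFam_directed (hs : ∀ u < t, ∃ s : Step (Fin u → Ω₁) Ω₁, s.Represents (Pt u)) :
    ∀ P₁ ∈ MeasFam Ω₁ Pt t, ∀ P₂ ∈ MeasFam Ω₁ Pt t,
      ∃ P ∈ MeasFam Ω₁ Pt t, P₁ ≪ P ∧ P₂ ≪ P := by
  induction t with
  | zero =>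
    rintro P₁ (rfl : P₁ = _) P₂ (rfl : P₂ = _)
    exact ⟨_, rfl, .rfl, .rfl⟩
  | succ t ih =>
    obtain ⟨s, h⟩ := hs t t.lt_succ_self
    have hs' := fun u hu => hs u (Nat.lt_trans hu t.lt_succ_self)
    have hprob := isProbabilityMeasure_of_mem hs'
    intro P₁ hP₁ P₂ hP₂
    obtain ⟨ν₁, hν₁, σ₁, hσ₁, κ₁, hκ₁, hκσ₁, rfl⟩ := h.exists_of_mem hprob hP₁
    obtain ⟨ν₂, hν₂, σ₂, hσ₂, κ₂, hκ₂, hκσ₂, rfl⟩ := h.exists_of_mem hprob hP₂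
    obtain ⟨ν, hν, h1, h2⟩ := ih hs' ν₁ hν₁ ν₂ hν₂
    obtain ⟨σ, hσ, hdom⟩ := Step.exists_section_dominating_both hσ₁ hσ₂
    have := hprob ν hν
    have := hprob ν₁ hν₁
    have := hprob ν₂ hν₂
    obtain ⟨κ, hκ, hκσ⟩ := hσ.exists_kernel ν
    refine ⟨_, h.map_mem hν hσ hκσ, ?_, ?_⟩
    · refine Measure.AbsolutelyContinuous.map ?_ (measurable_snocE t)
      refine Measure.AbsolutelyContinuous.compProd h1 ?_
      filter_upwards [hκσ₁, h1.ae_le hκσ] with x h3 h4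
      rw [h3, h4]
      exact (hdom x).1
    · refine Measure.AbsolutelyContinuous.map ?_ (measurable_snocE t)
      refine Measure.AbsolutelyContinuous.compProd h2 ?_
      filter_upwards [hκσ₂, h2.ae_le hκσ] with x h3 h4
      rw [h3, h4]
      exact (hdom x).2

variable {d : ℕ} {S : (t : ℕ) → (Fin t → Ω₁) → Fin d → ℝ}

/-- No arbitrage by dynamic trading up to time `t`. -/
def NoArb (Pt : (t : ℕ) → (Fin t → Ω₁) → Set (ProbabilityMeasure Ω₁))
    (S : (t : ℕ) → (Fin t → Ω₁) → Fin d → ℝ) (t : ℕ) : Prop :=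
  ∀ H : (u : ℕ) → (Fin u → Ω₁) → Fin d → ℝ, Pred Ω₁ d H →
    (∀ P ∈ MeasFam Ω₁ Pt t, ∀ᵐ ω ∂P, 0 ≤ gain Ω₁ S H t le_rfl ω) →
      ∀ P ∈ MeasFam Ω₁ Pt t, ∀ᵐ ω ∂P, gain Ω₁ S H t le_rfl ω = 0

theorem measurableSet_gain_nonneg {H : (u : ℕ) → (Fin u → Ω₁) → Fin d → ℝ} (hH : Pred Ω₁ d H)
    (hS : ∀ u ≤ t, Measurable (S u)) :
    MeasurableSet[univComp _] {ω | 0 ≤ gain Ω₁ S H t le_rfl ω} :=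
  uMeas_gain hH le_rfl hS measurableSet_Ici

theorem NoArb.localNA (hs : s.Represents (Pt t))
    (hprob : ∀ ν ∈ MeasFam Ω₁ Pt t, IsProbabilityMeasure ν)
    (hS : ∀ u ≤ t + 1, Measurable (S u)) (h : NoArb Pt S (t + 1)) :
    LocalNA s (fun q => incr Ω₁ S t q.1 q.2) (MeasFam Ω₁ Pt t) := by
  intro y hy hqs
  have hpred : Pred Ω₁ d (Function.update (fun _ _ => 0) t y) := pred_zero.update hy
  have hgain (q : (Fin t → Ω₁) × Ω₁) :
      gain Ω₁ S (Function.update (fun _ _ => 0) t y) (t + 1) le_rfl (snocE Ω₁ t q) =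
        ∑ i, y q.1 i * incr Ω₁ S t q.1 q.2 i := by
    rw [gain_snocE, gain_update, Function.update_self]
    simp [gain]
  have := hs.qs_of_forall hprob (h _ hpred (hs.forall_of_qs hprob
    (measurableSet_gain_nonneg hpred hS) (by simpa only [hgain] using hqs)))
  simpa only [hgain] using this

theorem NoArb.of_succ (hs : s.Represents (Pt t))
    (hprob : ∀ ν ∈ MeasFam Ω₁ Pt t, IsProbabilityMeasure ν)
    (hS : ∀ u ≤ t + 1, Measurable (S u)) (h : NoArb Pt S (t + 1)) : NoArb Pt S t := by
  intro H hH h0 P hP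
  have hpred : Pred Ω₁ d (Function.update H t 0) :=
    hH.update (y := 0) (measurable_const (a := (0 : Fin d → ℝ))).uMeas
  have hgain (q : (Fin t → Ω₁) × Ω₁) :
      gain Ω₁ S (Function.update H t 0) (t + 1) le_rfl (snocE Ω₁ t q) =
        gain Ω₁ S H t le_rfl q.1 := by
    rw [gain_snocE, gain_update, Function.update_self]
    simp
  have hqs := hs.qs_of_forall hprob (h _ hpred (hs.forall_of_qs hprob
    (measurableSet_gain_nonneg hpred hS) (by
      intro ν hν σ hσ
      filter_upwards [h0 ν hν] with x hx
      exact .of_forall fun w => by rwa [hgain])))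
  obtain ⟨σ, hσ⟩ := s.exists_isSection
  filter_upwards [hqs P hP σ hσ] with x hx
  simp only [hgain, eventually_const] at hx
  exact hx

end Family

end BN

namespace BN

/-! ### Concatenation of martingale measures -/

section Martingale

open ProbabilityTheory

variable {Ω₁ : Type} [MeasurableSpace Ω₁] [TopologicalSpace Ω₁] [OpensMeasurableSpace Ω₁]
  {d T t : ℕ} {S : (t : ℕ) → (Fin t → Ω₁) → Fin d → ℝ}

theorem exists_borel_of_filtr {Q : Measure (Fin T → Ω₁)} [IsFiniteMeasure Q] {u : ℕ} {h : u ≤ T}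
    {A : Set (Fin T → Ω₁)} (hA : MeasurableSet[filtr Ω₁ T u h] A) :
    ∃ B : Set (Fin u → Ω₁), MeasurableSet B ∧ A =ᵐ[Q] restr Ω₁ u h ⁻¹' B := by
  obtain ⟨B', hB', rfl⟩ := hA
  obtain ⟨B, -, hB, hBB'⟩ := (nullMeasurableSet_of_univComp hB'
    (Q.map (restr Ω₁ u h))).exists_measurable_superset_ae_eq
  exact ⟨B, hB, (ae_eq_comp (measurable_restr h).aemeasurable hBB').symm⟩

theorem isMartMeas_of_borel {Q : Measure (Fin T → Ω₁)} [IsFiniteMeasure Q]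
    (hInt : ∀ (u : ℕ) (h : u ≤ T) (i : Fin d), Integrable (fun ω => S u (restr Ω₁ u h ω) i) Q)
    (h : ∀ (u : ℕ) (h : u + 1 ≤ T) (i : Fin d) (B : Set (Fin u → Ω₁)), MeasurableSet B →
      ∫ ω in restr Ω₁ u ((Nat.le_succ u).trans h) ⁻¹' B,
          S (u + 1) (restr Ω₁ (u + 1) h ω) i ∂Q
        = ∫ ω in restr Ω₁ u ((Nat.le_succ u).trans h) ⁻¹' B,
          S u (restr Ω₁ u ((Nat.le_succ u).trans h) ω) i ∂Q) :
    IsMartMeas Ω₁ S Q := by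
  refine ⟨hInt, fun u hu i A hA => ?_⟩
  obtain ⟨B, hB, hAB⟩ := exists_borel_of_filtr (Q := Q) hA
  rw [setIntegral_congr_set hAB, setIntegral_congr_set hAB]
  exact h u hu i B hB

theorem map_restr_snoc {Q₀ : Measure (Fin t → Ω₁)} [IsProbabilityMeasure Q₀]
    {q : Kernel (Fin t → Ω₁) Ω₁} [IsMarkovKernel q] :
    ((Q₀ ⊗ₘ q).map (snocE Ω₁ t)).map (restr Ω₁ t (Nat.le_succ t)) = Q₀ := by
  rw [Measure.map_map (measurable_restr _) (measurable_snocE t)]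
  have : restr Ω₁ t (Nat.le_succ t) ∘ snocE Ω₁ t = Prod.fst := by
    ext1 x
    rw [Function.comp_apply, restr_snocE le_rfl, restr_self]
  rw [this]
  exact Measure.fst_compProd Q₀ q

theorem isMartMeas_snoc (hS : ∀ u ≤ t + 1, Measurable (S u)) {Q₀ : Measure (Fin t → Ω₁)}
    [IsProbabilityMeasure Q₀] (hQ₀ : IsMartMeas Ω₁ S Q₀)
    {q : Kernel (Fin t → Ω₁) Ω₁} [IsMarkovKernel q]
    (hInt : ∀ i, Integrable (fun x => incr Ω₁ S t x.1 x.2 i) (Q₀ ⊗ₘ q))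
    (hzero : ∀ᵐ x ∂Q₀, ∀ i, ∫ y, incr Ω₁ S t x y i ∂q x = 0) :
    IsMartMeas Ω₁ S ((Q₀ ⊗ₘ q).map (snocE Ω₁ t)) := by
  have _ := Measure.isProbabilityMeasure_map (μ := Q₀ ⊗ₘ q)
    (measurable_snocE (Ω₁ := Ω₁) t).aemeasurable
  have hSi : ∀ u ≤ t + 1, ∀ i, Measurable fun x => S u x i := fun u hu i =>
    (measurable_pi_apply i).comp (hS u hu)
  have hmp : MeasurePreserving (restr Ω₁ t (Nat.le_succ t)) ((Q₀ ⊗ₘ q).map (snocE Ω₁ t)) Q₀ :=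
    ⟨measurable_restr _, map_restr_snoc⟩
  have hlow : ∀ u (h : u ≤ t) i, Integrable
      (fun ω => S u (restr Ω₁ u (h.trans (Nat.le_succ t)) ω) i) ((Q₀ ⊗ₘ q).map (snocE Ω₁ t)) :=
    fun u h i => hmp.integrable_comp_of_integrable (hQ₀.1 u h i)
  have hdiff : ∀ ω i, S (t + 1) ω i = S t (restr Ω₁ t (Nat.le_succ t) ω) i +
      incr Ω₁ S t (restr Ω₁ t (Nat.le_succ t) ω) (ω (Fin.last t)) i := by
    intro ω i
    have := snocE_restr ω
    simp only [snocE] at this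
    simp only [incr, this]
    ring
  have hincm : ∀ i, Measurable fun ω : Fin (t + 1) → Ω₁ =>
      incr Ω₁ S t (restr Ω₁ t (Nat.le_succ t) ω) (ω (Fin.last t)) i := fun i =>
    (measurable_pi_apply i).comp ((measurable_incr (hS t (Nat.le_succ t)) (hS _ le_rfl)).comp
      (measurable_unsnoc t))
  have hunsnoc : ∀ x : (Fin t → Ω₁) × Ω₁, incr Ω₁ S t (restr Ω₁ t (Nat.le_succ t)
      (snocE Ω₁ t x)) (snocE Ω₁ t x (Fin.last t)) = incr Ω₁ S t x.1 x.2 := by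
    intro x
    rw [restr_snocE le_rfl, restr_self, snocE_last]
  have hinc : ∀ i, Integrable (fun ω : Fin (t + 1) → Ω₁ =>
      incr Ω₁ S t (restr Ω₁ t (Nat.le_succ t) ω) (ω (Fin.last t)) i)
        ((Q₀ ⊗ₘ q).map (snocE Ω₁ t)) := by
    intro i
    rw [integrable_map_measure (hincm i).aestronglyMeasurable (measurable_snocE t).aemeasurable]
    simpa only [Function.comp_def, hunsnoc] using hInt i
  refine isMartMeas_of_borel ?_ ?_
  · intro u h i
    rcases Nat.lt_succ_iff_lt_or_eq.1 (Nat.lt_succ_of_le h) with h' | rfl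
    · exact hlow u (Nat.lt_succ_iff.1 h') i
    · simp only [restr_self, hdiff]
      exact (hlow t le_rfl i).add (hinc i)
  · intro u h i B hB
    rcases Nat.lt_succ_iff_lt_or_eq.1 (Nat.lt_succ_of_le h) with h' | h'
    · have h'' : u + 1 ≤ t := Nat.lt_succ_iff.1 h'
      have key : ∀ F : (Fin t → Ω₁) → ℝ, Measurable F →
          ∫ ω in restr Ω₁ u ((Nat.le_succ u).trans h) ⁻¹' B, F (restr Ω₁ t (Nat.le_succ t) ω)
            ∂((Q₀ ⊗ₘ q).map (snocE Ω₁ t)) =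
          ∫ x in restr Ω₁ u ((Nat.le_succ u).trans h'') ⁻¹' B, F x ∂Q₀ := by
        intro F hF
        conv_rhs => rw [← hmp.map_eq]
        rw [setIntegral_map (measurable_restr _ hB) hF.aestronglyMeasurable
          hmp.measurable.aemeasurable]
        rfl
      have hA : MeasurableSet[filtr Ω₁ t u ((Nat.le_succ u).trans h'')]
          (restr Ω₁ u ((Nat.le_succ u).trans h'') ⁻¹' B) := ⟨B, le_univComp _ hB, rfl⟩
      have e1 := (hSi _ h i).comp (measurable_restr h'')
      have e2 := (hSi _ ((Nat.le_succ u).trans h) i).comp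
        (measurable_restr ((Nat.le_succ u).trans h''))
      exact (key _ e1).trans ((hQ₀.2 u h'' i _ hA).trans (key _ e2).symm)
    · obtain rfl : u = t := Nat.succ_injective h'
      simp only [restr_self, hdiff]
      rw [integral_add (hlow u le_rfl i).integrableOn (hinc i).integrableOn, add_eq_left,
        setIntegral_map (measurable_restr _ hB) (hincm i).aestronglyMeasurable
          (measurable_snocE u).aemeasurable]
      simp only [hunsnoc]
      have hpre : snocE Ω₁ u ⁻¹' (restr Ω₁ u (Nat.le_succ u) ⁻¹' B) = B ×ˢ univ := by
        ext x
        simp only [mem_preimage, mem_prod, mem_univ, and_true]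
        rw [restr_snocE le_rfl, restr_self]
      rw [hpre, Measure.setIntegral_compProd hB .univ (hInt i).integrableOn]
      simp only [Measure.restrict_univ]
      refine (integral_congr_ae (ae_restrict_of_ae ?_)).trans (integral_zero' _ _)
      filter_upwards [hzero] with x hx
      simpa using hx i

end Martingale

end BN

namespace BN

/-! ### The multi-period superhedging alternative -/

section Alternative

open ProbabilityTheory

variable {Ω₁ : Type} [MeasurableSpace Ω₁] [TopologicalSpace Ω₁] [PolishSpace Ω₁] [BorelSpace Ω₁]
  {d : ℕ} {Pt : (t : ℕ) → (Fin t → Ω₁) → Set (ProbabilityMeasure Ω₁)}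
  {S : (t : ℕ) → (Fin t → Ω₁) → Fin d → ℝ}

/-- The claim `f` can be superhedged from zero capital. -/
def Hedgeable (Pt : (t : ℕ) → (Fin t → Ω₁) → Set (ProbabilityMeasure Ω₁))
    (S : (t : ℕ) → (Fin t → Ω₁) → Fin d → ℝ) (t : ℕ) (f : (Fin t → Ω₁) → EReal) : Prop :=
  ∃ H : (u : ℕ) → (Fin u → Ω₁) → Fin d → ℝ, Pred Ω₁ d H ∧
    ∀ P ∈ MeasFam Ω₁ Pt t, ∀ᵐ ω ∂P, f ω ≤ (gain Ω₁ S H t le_rfl ω : EReal)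

/-- Every model is dominated by one with an equivalent martingale measure of arbitrarily strong
integrability under which a minorant of `f` has positive expectation. -/
def Priced (Pt : (t : ℕ) → (Fin t → Ω₁) → Set (ProbabilityMeasure Ω₁))
    (S : (t : ℕ) → (Fin t → Ω₁) → Fin d → ℝ) (t : ℕ) (f : (Fin t → Ω₁) → EReal) : Prop :=
  ∀ P ∈ MeasFam Ω₁ Pt t, ∃ P' ∈ MeasFam Ω₁ Pt t, P ≪ P' ∧
    ∃ c : (Fin t → Ω₁) → ℝ, Measurable c ∧ (∀ᵐ ω ∂P', (c ω : EReal) < f ω) ∧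
      ∀ φ : (Fin t → Ω₁) → ℝ, Measurable φ → (∀ ω, 0 ≤ φ ω) →
        ∃ Q : Measure (Fin t → Ω₁), IsProbabilityMeasure Q ∧ Q ≪ P' ∧ P' ≪ Q ∧
          IsMartMeas Ω₁ S Q ∧ Integrable φ Q ∧ Integrable c Q ∧ 0 < ∫ ω, c ω ∂Q

theorem hedgeable_or_priced_zero (f : (Fin 0 → Ω₁) → EReal) :
    Hedgeable Pt S 0 f ∨ Priced Pt S 0 f := by
  rcases le_or_gt (f Fin.elim0) 0 with h | h
  · left
    refine ⟨fun _ _ => 0, pred_zero, fun P _ => .of_forall fun ω => ?_⟩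
    rw [Subsingleton.elim ω Fin.elim0]
    simpa [gain] using h
  · right
    rintro P (rfl : P = _)
    obtain ⟨c, hc0, hcf⟩ := EReal.lt_iff_exists_real_btwn.1 h
    refine ⟨_, rfl, .rfl, fun _ => c, measurable_const, .of_forall fun ω => ?_, fun φ _ _ => ?_⟩
    · rwa [Subsingleton.elim ω Fin.elim0]
    · refine ⟨_, inferInstance, .rfl, .rfl, ⟨fun t h i => .of_finite, fun t h => ?_⟩, .of_finite,
        .of_finite, ?_⟩
      · exact absurd h (Nat.not_succ_le_zero t)
      · simpa using hc0

variable {t : ℕ} {s : Step (Fin t → Ω₁) Ω₁} {f : (Fin (t + 1) → Ω₁) → EReal}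

theorem Hedgeable.succ (hs : s.Represents (Pt t))
    (hprob : ∀ ν ∈ MeasFam Ω₁ Pt t, IsProbabilityMeasure ν)
    (hS : ∀ u ≤ t + 1, Measurable (S u)) (hf : UpperSemianalyticE f)
    (hgood : ∀ ν ∈ MeasFam Ω₁ Pt t, ∀ᵐ x ∂ν,
      Good s (fun q => incr Ω₁ S t q.1 q.2) (fun q => f (snocE Ω₁ t q)) x)
    (h : Hedgeable Pt S t (price s (fun q => incr Ω₁ S t q.1 q.2) fun q => f (snocE Ω₁ t q))) :
    Hedgeable Pt S (t + 1) f := by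
  obtain ⟨H, hH, hle⟩ := h
  have hΔ := measurable_incr (hS t (Nat.le_succ t)) (hS _ le_rfl)
  obtain ⟨y, hy, hyh⟩ := exists_hedging_strategy (s := s) hΔ
    (hf.comp_continuous (continuous_snocE t))
    (uMeas_gain hH le_rfl fun u hu => hS u (hu.trans (Nat.le_succ t)))
  have hpred := hH.update hy
  refine ⟨_, hpred, hs.forall_of_qs hprob ?_ ?_⟩
  · have h1 := hf.uMeas
    have h2 : UMeas fun ω => (gain Ω₁ S (Function.update H t y) (t + 1) le_rfl ω : EReal) :=
      measurable_coe_real_ereal.comp_uMeas (uMeas_gain hpred le_rfl hS)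
    exact h1.prodMk h2 measurableSet_le'
  · intro ν hν σ hσ
    filter_upwards [hgood ν hν, hle ν hν] with x hg hx
    filter_upwards [hyh x hg hx _ (hσ.p_eq x)] with w hw
    rw [gain_snocE, gain_update, Function.update_self]
    exact hw

theorem Priced.succ (hs : s.Represents (Pt t))
    (hprob : ∀ ν ∈ MeasFam Ω₁ Pt t, IsProbabilityMeasure ν)
    (hS : ∀ u ≤ t + 1, Measurable (S u)) (hf : UpperSemianalyticE f)
    (hNA : LocalNA s (fun q => incr Ω₁ S t q.1 q.2) (MeasFam Ω₁ Pt t))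
    (hbot : s.QS (MeasFam Ω₁ Pt t) fun q => ⊥ < f (snocE Ω₁ t q))
    (h : Priced Pt S t (price s (fun q => incr Ω₁ S t q.1 q.2) fun q => f (snocE Ω₁ t q))) :
    Priced Pt S (t + 1) f := by
  have hΔ := measurable_incr (hS t (Nat.le_succ t)) (hS _ le_rfl)
  have hΔi (i : Fin d) : Measurable fun q : (Fin t → Ω₁) × Ω₁ => incr Ω₁ S t q.1 q.2 i :=
    (measurable_pi_apply i).comp hΔ
  have hf' := hf.comp_continuous (continuous_snocE (Ω₁ := Ω₁) t)
  intro P hP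
  obtain ⟨ν₀, hν₀, σ₀, hσ₀, κ₀, hκ₀, hκσ₀, rfl⟩ := hs.exists_of_mem hprob hP
  obtain ⟨ν, hν, hν₀ν, c₀, hc₀, hlt, hQ₀⟩ := h ν₀ hν₀
  have := hprob ν hν
  have := hprob ν₀ hν₀
  obtain ⟨σ, hσ, hdom, κ, hκ, hκσ, c, hc, hcf, hq⟩ :=
    exists_martingale_step hNA hΔ hf' hbot hν hc₀ hlt hσ₀
  have hunsnoc : ∀ x : (Fin t → Ω₁) × Ω₁, c (restr Ω₁ t (Nat.le_succ t)
      (snocE Ω₁ t x), snocE Ω₁ t x (Fin.last t)) = c x := by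
    intro x
    rw [restr_snocE le_rfl, restr_self, snocE_last]
  have hcm : Measurable fun ω : Fin (t + 1) → Ω₁ =>
    c (restr Ω₁ t (Nat.le_succ t) ω, ω (Fin.last t)) := hc.comp (measurable_unsnoc t)
  refine ⟨_, hs.map_mem hν hσ hκσ, ?_, _, hcm, ?_, ?_⟩
  · refine Measure.AbsolutelyContinuous.map ?_ (measurable_snocE t)
    refine Measure.AbsolutelyContinuous.compProd hν₀ν ?_
    filter_upwards [hκσ₀, hν₀ν.ae_le hκσ] with x h3 h4
    rw [h3, h4]
    exact hdom x
  · refine ae_map_snocE ?_ ?_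
    · exact (measurable_coe_real_ereal.comp_uMeas hcm.uMeas).prodMk hf.uMeas measurableSet_lt'
    · simpa only [hunsnoc] using hcf
  · intro φ hφ hφ0
    let φ' : (Fin t → Ω₁) × Ω₁ → ℝ := fun x =>
      φ (snocE Ω₁ t x) + |c x| + ∑ i, |incr Ω₁ S t x.1 x.2 i|
    have hsum0 (x : (Fin t → Ω₁) × Ω₁) : 0 ≤ ∑ i, |incr Ω₁ S t x.1 x.2 i| :=
      Finset.sum_nonneg fun i _ => abs_nonneg _
    have hφ'0 (x) : 0 ≤ φ' x := add_nonneg (add_nonneg (hφ0 _) (abs_nonneg _)) (hsum0 x)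
    have hφ'm : Measurable φ' := by
      have h1 : Measurable fun x : (Fin t → Ω₁) × Ω₁ => ∑ i, |incr Ω₁ S t x.1 x.2 i| :=
        Finset.measurable_fun_sum _ fun i _ => (hΔi i).abs
      exact ((hφ.comp (measurable_snocE t)).add hc.abs).add h1
    obtain ⟨q, hq1, hqκ, hqae⟩ := hq φ' hφ'm hφ'0
    have hbarm : Measurable fun x => ∫ y, φ' (x, y) ∂q x :=
      (hφ'm.stronglyMeasurable.integral_kernel_prod_right' (κ := q)).measurable
    obtain ⟨Q₀, hQ₀p, hQ₀ν, hνQ₀, hmart, hbar, hc₀i, hpos⟩ :=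
      hQ₀ _ hbarm fun x => integral_nonneg fun y => hφ'0 _
    have hqae' := hQ₀ν.ae_le hqae
    have hφ'i : Integrable φ' (Q₀ ⊗ₘ q) := by
      rw [Measure.integrable_compProd_iff hφ'm.aestronglyMeasurable]
      refine ⟨?_, ?_⟩
      · filter_upwards [hqae'] with x hx using hx.1
      · simpa only [Real.norm_of_nonneg (hφ'0 _)] using hbar
    have hφi : Integrable (fun x => φ (snocE Ω₁ t x)) (Q₀ ⊗ₘ q) := by
      refine hφ'i.mono' (hφ.comp (measurable_snocE t)).aestronglyMeasurable (.of_forall fun x => ?_)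
      rw [Real.norm_of_nonneg (hφ0 _)]
      have := hsum0 x
      have := abs_nonneg (c x)
      simp only [φ']
      linarith
    have hci : Integrable c (Q₀ ⊗ₘ q) := by
      refine hφ'i.mono' hc.aestronglyMeasurable (.of_forall fun x => ?_)
      rw [Real.norm_eq_abs]
      have := hsum0 x
      have := hφ0 (snocE Ω₁ t x)
      simp only [φ']
      linarith
    have hΔint (i : Fin d) : Integrable (fun x => incr Ω₁ S t x.1 x.2 i) (Q₀ ⊗ₘ q) := by
      refine hφ'i.mono' (hΔi i).aestronglyMeasurable (.of_forall fun x => ?_)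
      rw [Real.norm_eq_abs]
      have := Finset.single_le_sum (f := fun i => |incr Ω₁ S t x.1 x.2 i|)
        (fun i _ => abs_nonneg _) (Finset.mem_univ i)
      have := hφ0 (snocE Ω₁ t x)
      have := abs_nonneg (c x)
      simp only [φ']
      linarith
    refine ⟨(Q₀ ⊗ₘ q).map (snocE Ω₁ t),
      Measure.isProbabilityMeasure_map (measurable_snocE t).aemeasurable, ?_, ?_, ?_, ?_, ?_, ?_⟩
    · exact (Measure.AbsolutelyContinuous.compProd hQ₀ν (.of_forall fun x => (hqκ x).1)).map
        (measurable_snocE t)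
    · exact (Measure.AbsolutelyContinuous.compProd hνQ₀ (.of_forall fun x => (hqκ x).2)).map
        (measurable_snocE t)
    · refine isMartMeas_snoc hS hmart hΔint ?_
      filter_upwards [hqae'] with x hx i using (hx.2.1 i).2
    · rwa [integrable_map_measure hφ.aestronglyMeasurable (measurable_snocE t).aemeasurable]
    · rw [integrable_map_measure hcm.aestronglyMeasurable (measurable_snocE t).aemeasurable]
      simpa only [Function.comp_def, hunsnoc] using hci
    · rw [integral_map (measurable_snocE t).aemeasurable hcm.aestronglyMeasurable]
      simp only [hunsnoc]
      rw [Measure.integral_compProd hci]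
      refine hpos.trans_le (integral_mono_ae hc₀i hci.integral_compProd ?_)
      filter_upwards [hqae'] with x hx using hx.2.2.2.le

theorem hedgeable_or_priced {t : ℕ}
    (hs : ∀ u < t, ∃ s : Step (Fin u → Ω₁) Ω₁, s.Represents (Pt u))
    (hS : ∀ u ≤ t, Measurable (S u)) (hNA : NoArb Pt S t) {f : (Fin t → Ω₁) → EReal}
    (hf : UpperSemianalyticE f) (hbot : ∀ P ∈ MeasFam Ω₁ Pt t, ∀ᵐ ω ∂P, ⊥ < f ω) :
    Hedgeable Pt S t f ∨ Priced Pt S t f := by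
  induction t with
  | zero => exact hedgeable_or_priced_zero f
  | succ t ih =>
    obtain ⟨s, h⟩ := hs t t.lt_succ_self
    have hs' := fun u hu => hs u (Nat.lt_trans hu t.lt_succ_self)
    have hprob := isProbabilityMeasure_of_mem hs'
    have hΔ := measurable_incr (hS t (Nat.le_succ t)) (hS _ le_rfl)
    have hbot' := h.qs_of_forall hprob hbot
    have hloc := hNA.localNA h hprob hS
    have hgood : ∀ ν ∈ MeasFam Ω₁ Pt t, ∀ᵐ x ∂ν, Good s _ _ x :=
      fun ν hν => hloc.ae_good hΔ hbot' hν
    rcases ih hs' (fun u hu => hS u (hu.trans (Nat.le_succ t))) (hNA.of_succ h hprob hS)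
      (upperSemianalyticE_price (s := s) hΔ (hf.comp_continuous (continuous_snocE t)))
      (fun ν hν => (hgood ν hν).mono fun x hx => hx.bot_lt_price) with h1 | h1
    · exact .inl (h1.succ h hprob hS hf hgood)
    · exact .inr (h1.succ h hprob hS hf hloc hbot')

end Alternative

end BN

namespace BN

/-! ### Local martingales with integrable negative part -/

section LocalMartingale

variable {α X : Type*} [MeasurableSpace α] [MeasurableSpace X] {μ : Measure α} [IsFiniteMeasure μ]
  {π : α → X}

theorem integral_bdd_mul_eq_zero (hπ : Measurable π) {D : α → ℝ} (hD : Integrable D μ)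
    (hD0 : ∀ B, MeasurableSet B → ∫ a in π ⁻¹' B, D a ∂μ = 0) {k : X → ℝ} (hk : Measurable k)
    {C : ℝ} (hC : ∀ x, ‖k x‖ ≤ C) :
    Integrable (fun a => k (π a) * D a) μ ∧ ∫ a, k (π a) * D a ∂μ = 0 := by
  have hm := hπ.comap_le
  have hkm : StronglyMeasurable[MeasurableSpace.comap π ‹_›] fun a => k (π a) :=
    (hk.comp (comap_measurable π)).stronglyMeasurable
  have hcond : μ[D | MeasurableSpace.comap π ‹_›] =ᵐ[μ] 0 := by
    refine (ae_eq_condExp_of_forall_setIntegral_eq hm hD (fun _ _ _ => integrableOn_zero) ?_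
      aestronglyMeasurable_zero).symm
    rintro _ ⟨B, hB, rfl⟩ -
    simp [hD0 B hB]
  refine ⟨hD.bdd_mul (hk.comp hπ).aestronglyMeasurable (.of_forall fun a => hC _), ?_⟩
  have h1 := condExp_stronglyMeasurable_mul_of_bound hm hkm hD C (.of_forall fun a => hC _)
  have h2 : ∫ a, ((fun a => k (π a)) * D) a ∂μ = 0 := by
    rw [← integral_condExp hm, integral_congr_ae h1, integral_congr_ae (g := fun _ => 0)]
    · simp
    · filter_upwards [hcond] with a ha
      simp [ha]
  exact h2

variable {d : ℕ} {D : Fin d → α → ℝ} {h : X → Fin d → ℝ} {V : X → ℝ} {W : α → ℝ}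

theorem setIntegral_sum_mul_eq_zero (hπ : Measurable π) (hD : ∀ i, Integrable (D i) μ)
    (hD0 : ∀ i B, MeasurableSet B → ∫ a in π ⁻¹' B, D i a ∂μ = 0) (hh : Measurable h)
    {B : Set X} (hB : MeasurableSet B) {C : ℝ} (hC0 : 0 ≤ C) (hC : ∀ x ∈ B, ‖h x‖ ≤ C) :
    IntegrableOn (fun a => ∑ i, h (π a) i * D i a) (π ⁻¹' B) μ ∧
      ∫ a in π ⁻¹' B, ∑ i, h (π a) i * D i a ∂μ = 0 := by
  have hi (i : Fin d) : Measurable fun x => h x i := (measurable_pi_apply i).comp hh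
  have key (i : Fin d) := integral_bdd_mul_eq_zero hπ (hD i) (hD0 i)
    ((hi i).indicator hB) (C := C) (fun x => by
      by_cases hx : x ∈ B
      · rw [indicator_of_mem hx]
        exact (norm_le_pi_norm (h x) i).trans (hC x hx)
      · rwa [indicator_of_notMem hx, norm_zero])
  have heq (i : Fin d) : (fun a => B.indicator (fun x => h x i) (π a) * D i a) =
      (π ⁻¹' B).indicator fun a => h (π a) i * D i a := by
    ext a
    by_cases ha : π a ∈ B
    · rw [indicator_of_mem ha, indicator_of_mem (mem_preimage.2 ha)]
    · rw [indicator_of_notMem ha, indicator_of_notMem (by simpa using ha), zero_mul]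
  simp only [heq] at key
  have hon (i : Fin d) : IntegrableOn (fun a => h (π a) i * D i a) (π ⁻¹' B) μ :=
    (integrable_indicator_iff (hπ hB)).1 (key i).1
  refine ⟨integrable_finsetSum _ fun i _ => hon i, ?_⟩
  rw [integral_finsetSum _ fun i _ => hon i]
  refine Finset.sum_eq_zero fun i _ => ?_
  rw [← integral_indicator (hπ hB)]
  exact (key i).2

/-- Truncation sets for a predictable integrand and the past gain. -/
def truncSet (h : X → Fin d → ℝ) (V : X → ℝ) (n : ℕ) : Set X := {x | ‖h x‖ ≤ n ∧ |V x| ≤ n}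

theorem measurableSet_truncSet (hh : Measurable h) (hV : Measurable V) (n : ℕ) :
    MeasurableSet (truncSet h V n) :=
  (measurableSet_le hh.norm measurable_const).inter (measurableSet_le hV.abs measurable_const)

theorem aecover_truncSet (hπ : Measurable π) (hh : Measurable h) (hV : Measurable V) :
    AECover μ atTop fun n => π ⁻¹' truncSet h V n := by
  refine ⟨.of_forall fun a => ?_, fun n => hπ (measurableSet_truncSet hh hV n)⟩
  obtain ⟨N, hN⟩ := exists_nat_ge (max ‖h (π a)‖ |V (π a)|)
  filter_upwards [eventually_ge_atTop N] with n hn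
  have : (N : ℝ) ≤ n := Nat.cast_le.2 hn
  exact ⟨(le_max_left _ _).trans (hN.trans this), (le_max_right _ _).trans (hN.trans this)⟩

theorem integral_truncSet (hπ : Measurable π) (hD : ∀ i, Integrable (D i) μ)
    (hD0 : ∀ i B, MeasurableSet B → ∫ a in π ⁻¹' B, D i a ∂μ = 0) (hh : Measurable h)
    (hV : Measurable V) (hW : ∀ᵐ a ∂μ, W a = V (π a) + ∑ i, h (π a) i * D i a)
    {B : Set X} (hB : MeasurableSet B) {n : ℕ} (hBn : B ⊆ truncSet h V n) :
    IntegrableOn (fun a => V (π a)) (π ⁻¹' B) μ ∧ IntegrableOn W (π ⁻¹' B) μ ∧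
      ∫ a in π ⁻¹' B, W a ∂μ = ∫ a in π ⁻¹' B, V (π a) ∂μ := by
  have hVi : IntegrableOn (fun a => V (π a)) (π ⁻¹' B) μ := by
    refine Integrable.of_bound (hV.comp hπ).aestronglyMeasurable n ?_
    exact (ae_restrict_iff' (hπ hB)).2 (.of_forall fun a ha => (hBn ha).2)
  obtain ⟨h1, h2⟩ := setIntegral_sum_mul_eq_zero hπ hD hD0 hh hB n.cast_nonneg
    fun x hx => (hBn hx).1
  have hW' := ae_restrict_of_ae (s := π ⁻¹' B) hW
  refine ⟨hVi, (hVi.add h1).congr (hW'.mono fun a ha => ha.symm), ?_⟩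
  rw [integral_congr_ae hW', integral_add hVi h1, h2, add_zero]

theorem integrable_past_neg (hπ : Measurable π) (hD : ∀ i, Integrable (D i) μ)
    (hD0 : ∀ i B, MeasurableSet B → ∫ a in π ⁻¹' B, D i a ∂μ = 0) (hh : Measurable h)
    (hV : Measurable V) (hW : ∀ᵐ a ∂μ, W a = V (π a) + ∑ i, h (π a) i * D i a)
    (hneg : Integrable (fun a => max (-W a) 0) μ) :
    Integrable (fun a => max (-V (π a)) 0) μ := by
  refine (aecover_truncSet (μ := μ) hπ hh hV).integrable_of_integral_bounded_of_nonneg_ae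
    (∫ a, max (-W a) 0 ∂μ) (fun n => ?_) (.of_forall fun a => le_max_right _ _)
    (.of_forall fun n => ?_)
  · exact (integral_truncSet hπ hD hD0 hh hV hW (measurableSet_truncSet hh hV n)
      subset_rfl).1.neg.pos_part
  · have hN : MeasurableSet {x | V x < 0} := measurableSet_lt hV measurable_const
    have hBm := (measurableSet_truncSet hh hV n).inter hN
    obtain ⟨h1, h2, h3⟩ := integral_truncSet hπ hD hD0 hh hV hW hBm inter_subset_left
    have heq : (fun a => max (-V (π a)) 0) = (π ⁻¹' {x | V x < 0}).indicator
        fun a => -V (π a) := by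
      ext a
      by_cases ha : V (π a) < 0
      · rw [indicator_of_mem (by exact ha), max_eq_left (by linarith)]
      · rw [indicator_of_notMem (by exact ha), max_eq_right (by linarith)]
    rw [heq, setIntegral_indicator (hπ hN), ← preimage_inter, integral_neg, ← h3, ← integral_neg]
    calc ∫ a in π ⁻¹' (truncSet h V n ∩ {x | V x < 0}), -W a ∂μ
        ≤ ∫ a in π ⁻¹' (truncSet h V n ∩ {x | V x < 0}), max (-W a) 0 ∂μ :=
          integral_mono h2.neg hneg.integrableOn fun a => le_max_left _ _
      _ ≤ ∫ a, max (-W a) 0 ∂μ :=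
          setIntegral_le_integral hneg (.of_forall fun a => le_max_right _ _)

theorem integrable_of_past (hπ : Measurable π) (hD : ∀ i, Integrable (D i) μ)
    (hD0 : ∀ i B, MeasurableSet B → ∫ a in π ⁻¹' B, D i a ∂μ = 0) (hh : Measurable h)
    (hV : Measurable V) (hW : ∀ᵐ a ∂μ, W a = V (π a) + ∑ i, h (π a) i * D i a)
    (hneg : Integrable (fun a => max (-W a) 0) μ) (hVi : Integrable (fun a => V (π a)) μ) :
    Integrable W μ ∧ ∫ a, W a ∂μ = ∫ a, V (π a) ∂μ := by
  have hcov := aecover_truncSet (μ := μ) hπ hh hV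
  have hon (n : ℕ) := integral_truncSet hπ hD hD0 hh hV hW (measurableSet_truncSet hh hV n)
    subset_rfl
  have hWi : Integrable W μ := by
    refine hcov.integrable_of_integral_norm_bounded
      (∫ a, ‖V (π a)‖ ∂μ + 2 * ∫ a, max (-W a) 0 ∂μ) (fun n => (hon n).2.1) (.of_forall fun n => ?_)
    have heq : (fun a => ‖W a‖) = fun a => W a + 2 * max (-W a) 0 := by
      ext a
      rw [Real.norm_eq_abs]
      rcases le_total 0 (W a) with h0 | h0
      · rw [abs_of_nonneg h0, max_eq_right (by linarith)]; ring
      · rw [abs_of_nonpos h0, max_eq_left (by linarith)]; ring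
    rw [heq, integral_add (hon n).2.1 (hneg.integrableOn.const_mul 2), (hon n).2.2,
      integral_const_mul]
    have e1 : ∫ a in π ⁻¹' truncSet h V n, V (π a) ∂μ ≤ ∫ a, ‖V (π a)‖ ∂μ :=
      (integral_mono (hon n).1 (hon n).1.norm fun a => le_abs_self _).trans
        (setIntegral_le_integral hVi.norm (.of_forall fun a => norm_nonneg _))
    have e2 : ∫ a in π ⁻¹' truncSet h V n, max (-W a) 0 ∂μ ≤ ∫ a, max (-W a) 0 ∂μ :=
      setIntegral_le_integral hneg (.of_forall fun a => le_max_right _ _)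
    linarith
  refine ⟨hWi, tendsto_nhds_unique (hcov.integral_tendsto_of_countably_generated hWi) ?_⟩
  simpa only [(hon _).2.2] using hcov.integral_tendsto_of_countably_generated hVi

end LocalMartingale

section Gain

variable {Ω₁ : Type} [MeasurableSpace Ω₁] [TopologicalSpace Ω₁] [PolishSpace Ω₁] [BorelSpace Ω₁]
  {d T : ℕ} {S : (t : ℕ) → (Fin t → Ω₁) → Fin d → ℝ}
  {H : (u : ℕ) → (Fin u → Ω₁) → Fin d → ℝ}

theorem IsMartMeas.integrable_gain {Q : Measure (Fin T → Ω₁)} [IsProbabilityMeasure Q]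
    (hQ : IsMartMeas Ω₁ S Q) (hS : ∀ t ≤ T, Measurable (S t)) (hH : Pred Ω₁ d H) {t : ℕ}
    (ht : t ≤ T) (hneg : Integrable (fun ω => max (-gain Ω₁ S H t ht ω) 0) Q) :
    Integrable (gain Ω₁ S H t ht) Q ∧ ∫ ω, gain Ω₁ S H t ht ω ∂Q = 0 := by
  induction t with
  | zero =>
    have h0 : gain Ω₁ S H 0 ht = fun _ => 0 := by ext ω; simp [gain]
    simp [h0]
  | succ t ih =>
    have ht' := (Nat.le_succ t).trans ht
    have hπ : Measurable (restr Ω₁ t ht') := measurable_restr ht'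
    have _ := Measure.isProbabilityMeasure_map (μ := Q) hπ.aemeasurable
    have hHa : AEMeasurable (H t) (Q.map (restr Ω₁ t ht')) := UMeas.aemeasurable (hH t) _
    have hVa : AEMeasurable (gain Ω₁ S H t le_rfl) (Q.map (restr Ω₁ t ht')) :=
      (uMeas_gain hH le_rfl fun u hu => hS u (hu.trans ht')).aemeasurable _
    have hHe := ae_of_ae_map hπ.aemeasurable hHa.ae_eq_mk
    have hVe : ∀ᵐ ω ∂Q, gain Ω₁ S H t ht' ω = hVa.mk _ (restr Ω₁ t ht' ω) :=
      ae_of_ae_map hπ.aemeasurable hVa.ae_eq_mk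
    have hD (i : Fin d) := (hQ.1 (t + 1) ht i).sub (hQ.1 t ht' i)
    have hD0 (i : Fin d) (B : Set (Fin t → Ω₁)) (hB : MeasurableSet B) :
        ∫ ω in restr Ω₁ t ht' ⁻¹' B, (S (t + 1) (restr Ω₁ (t + 1) ht ω) i -
          S t (restr Ω₁ t ht' ω) i) ∂Q = 0 := by
      rw [integral_sub (hQ.1 (t + 1) ht i).integrableOn (hQ.1 t ht' i).integrableOn, sub_eq_zero]
      exact hQ.2 t ht i _ ⟨B, le_univComp _ hB, rfl⟩
    have hW : ∀ᵐ ω ∂Q, gain Ω₁ S H (t + 1) ht ω = hVa.mk _ (restr Ω₁ t ht' ω) +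
        ∑ i, hHa.mk _ (restr Ω₁ t ht' ω) i *
          (S (t + 1) (restr Ω₁ (t + 1) ht ω) i - S t (restr Ω₁ t ht' ω) i) := by
      filter_upwards [hHe, hVe] with ω h1 h2
      rw [gain_succ, ← h2, ← h1]
    have h1 := integrable_past_neg hπ hD hD0 hHa.measurable_mk hVa.measurable_mk hW hneg
    obtain ⟨h2, h3⟩ := ih ht' (h1.congr (hVe.mono fun ω hω => by simp only [hω]))
    obtain ⟨h4, h5⟩ := integrable_of_past hπ hD hD0 hHa.measurable_mk hVa.measurable_mk hW hneg
      (h2.congr hVe)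
    exact ⟨h4, h5.trans ((integral_congr_ae hVe).symm.trans h3)⟩

end Gain

end BN

namespace BN

/-! ### Expectations and mixtures -/

theorem expec_eq_zero_iff {α : Type*} [MeasurableSpace α] {Q : Measure α} {f : α → ℝ}
    (hf : Measurable f) : expec Q f = 0 ↔ Integrable f Q ∧ ∫ x, f x ∂Q = 0 := by
  have hInt : Integrable f Q ↔
      ∫⁻ x, ENNReal.ofReal (f x) ∂Q ≠ ⊤ ∧ ∫⁻ x, ENNReal.ofReal (-f x) ∂Q ≠ ⊤ := by
    refine ⟨fun h => ⟨?_, ?_⟩, fun ⟨h1, h2⟩ => ⟨hf.aestronglyMeasurable, ?_⟩⟩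
    · exact (lintegral_ofReal_le_lintegral_enorm f).trans_lt h.2 |>.ne
    · exact (lintegral_ofReal_le_lintegral_enorm (fun x => -f x)).trans_lt h.neg.2 |>.ne
    · rw [HasFiniteIntegral]
      have heq : ∀ x, ‖f x‖ₑ = ENNReal.ofReal (f x) + ENNReal.ofReal (-f x) := by
        intro x
        rw [Real.enorm_eq_ofReal_abs]
        rcases le_total 0 (f x) with h0 | h0
        · rw [abs_of_nonneg h0, ENNReal.ofReal_of_nonpos (p := -f x) (by linarith), add_zero]
        · rw [abs_of_nonpos h0, ENNReal.ofReal_of_nonpos h0, zero_add]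
      simp only [heq]
      rw [lintegral_add_left hf.ennreal_ofReal]
      exact ENNReal.add_lt_top.2 ⟨h1.lt_top, h2.lt_top⟩
  by_cases h : Integrable f Q
  · obtain ⟨h1, h2⟩ := hInt.1 h
    simp only [h, true_and]
    rw [integral_eq_lintegral_pos_part_sub_lintegral_neg_part h, expec]
    lift (∫⁻ x, ENNReal.ofReal (f x) ∂Q) to ℝ≥0 using h1 with a
    lift (∫⁻ x, ENNReal.ofReal (-f x) ∂Q) to ℝ≥0 using h2 with b
    simp only [ENNReal.coe_toReal, EReal.coe_nnreal_eq_coe_real]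
    norm_cast
  · simp only [h, false_and, iff_false]
    intro h0
    apply h
    rw [hInt]
    unfold expec at h0
    by_contra hcon
    rw [not_and_or, not_not, not_not] at hcon
    by_cases hb : ∫⁻ x, ENNReal.ofReal (-f x) ∂Q = ⊤
    · rw [hb] at h0
      simp at h0
    · have ha := hcon.resolve_right hb
      rw [ha] at h0
      lift (∫⁻ x, ENNReal.ofReal (-f x) ∂Q) to ℝ≥0 using hb with b
      rw [EReal.coe_ennreal_top, EReal.coe_nnreal_eq_coe_real, EReal.top_sub_coe] at h0
      exact absurd h0 (by simp)

section Market

variable {Ω₁ : Type} [MeasurableSpace Ω₁] [TopologicalSpace Ω₁]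

theorem IsMartMeas.mixture [OpensMeasurableSpace Ω₁] {d T : ℕ}
    {S : (t : ℕ) → (Fin t → Ω₁) → Fin d → ℝ} {Q₁ Q₂ : Measure (Fin T → Ω₁)}
    (h₁ : IsMartMeas Ω₁ S Q₁) (h₂ : IsMartMeas Ω₁ S Q₂) {a b : ℝ≥0∞} (ha : a ≠ ⊤) (hb : b ≠ ⊤) :
    IsMartMeas Ω₁ S (a • Q₁ + b • Q₂) := by
  refine ⟨fun t h i => ((h₁.1 t h i).smul_measure ha).add_measure ((h₂.1 t h i).smul_measure hb),
    fun t h i A hA => ?_⟩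
  have key (u : ℕ) (hu : u ≤ T) :
      ∫ ω in A, S u (restr Ω₁ u hu ω) i ∂(a • Q₁ + b • Q₂) =
        a.toReal • ∫ ω in A, S u (restr Ω₁ u hu ω) i ∂Q₁ +
          b.toReal • ∫ ω in A, S u (restr Ω₁ u hu ω) i ∂Q₂ := by
    rw [Measure.restrict_add, Measure.restrict_smul, Measure.restrict_smul, integral_add_measure
      ((h₁.1 u hu i).integrableOn.smul_measure ha) ((h₂.1 u hu i).integrableOn.smul_measure hb),
      integral_smul_measure, integral_smul_measure]
  rw [key, key, h₁.2 t h i A hA, h₂.2 t h i A hA]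

variable [PolishSpace Ω₁] [BorelSpace Ω₁] {d e T : ℕ}
  {S : (t : ℕ) → (Fin t → Ω₁) → Fin d → ℝ} {g : Fin e → (Fin T → Ω₁) → ℝ}

/-- A measure is consistent with the market up to option prices and dominates `P`. -/
structure Consistent (PP : Set (Measure (Fin T → Ω₁)))
    (S : (t : ℕ) → (Fin t → Ω₁) → Fin d → ℝ) (g : Fin e → (Fin T → Ω₁) → ℝ)
    (P Q : Measure (Fin T → Ω₁)) : Prop where
  prob : IsProbabilityMeasure Q
  dominated : ∃ P' ∈ PP, Q ≪ P'
  mart : IsMartMeas Ω₁ S Q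
  dominating : P ≪ Q
  integrable : ∀ i, Integrable (g i) Q

theorem Consistent.mixture {PP : Set (Measure (Fin T → Ω₁))}
    (hdir : ∀ P₁ ∈ PP, ∀ P₂ ∈ PP, ∃ P ∈ PP, P₁ ≪ P ∧ P₂ ≪ P) {P Q₁ Q₂ : Measure (Fin T → Ω₁)}
    (h₁ : Consistent PP S g P Q₁) (h₂ : Consistent PP S g P Q₂) {a b : ℝ} (ha : 0 ≤ a)
    (hb : 0 ≤ b) (hab : a + b = 1) :
    Consistent PP S g P (ENNReal.ofReal a • Q₁ + ENNReal.ofReal b • Q₂) where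
  prob := by
    have := h₁.prob
    have := h₂.prob
    refine ⟨?_⟩
    simp [← ENNReal.ofReal_add ha hb, hab]
  dominated := by
    obtain ⟨P₁, hP₁, hd₁⟩ := h₁.dominated
    obtain ⟨P₂, hP₂, hd₂⟩ := h₂.dominated
    obtain ⟨P', hP', h1, h2⟩ := hdir P₁ hP₁ P₂ hP₂
    refine ⟨P', hP', Measure.AbsolutelyContinuous.add_left ?_ ?_⟩
    · exact (hd₁.trans h1).smul_left _
    · exact (hd₂.trans h2).smul_left _
  mart := h₁.mart.mixture h₂.mart ENNReal.ofReal_ne_top ENNReal.ofReal_ne_top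
  dominating := by
    intro A hA
    simp only [Measure.add_apply, Measure.smul_apply, smul_eq_mul, add_eq_zero, mul_eq_zero,
      ENNReal.ofReal_eq_zero] at hA
    rcases hA.1 with h | h
    · rcases hA.2 with h' | h'
      · linarith
      · exact h₂.dominating h'
    · exact h₁.dominating h
  integrable i := ((h₁.integrable i).smul_measure ENNReal.ofReal_ne_top).add_measure
    ((h₂.integrable i).smul_measure ENNReal.ofReal_ne_top)

/-- The option prices attainable by consistent measures form a convex set. -/
theorem convex_prices {PP : Set (Measure (Fin T → Ω₁))}
    (hdir : ∀ P₁ ∈ PP, ∀ P₂ ∈ PP, ∃ P ∈ PP, P₁ ≪ P ∧ P₂ ≪ P) (P : Measure (Fin T → Ω₁)) :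
    Convex ℝ {γ : Fin e → ℝ | ∃ Q, Consistent PP S g P Q ∧ ∀ i, γ i = ∫ ω, g i ω ∂Q} := by
  rintro γ₁ ⟨Q₁, h₁, hγ₁⟩ γ₂ ⟨Q₂, h₂, hγ₂⟩ a b ha hb hab
  refine ⟨_, h₁.mixture hdir h₂ ha hb hab, fun i => ?_⟩
  rw [integral_add_measure ((h₁.integrable i).smul_measure ENNReal.ofReal_ne_top)
    ((h₂.integrable i).smul_measure ENNReal.ofReal_ne_top), integral_smul_measure,
    integral_smul_measure, ENNReal.toReal_ofReal ha, ENNReal.toReal_ofReal hb]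
  simp [hγ₁, hγ₂]

variable {Pt : (t : ℕ) → (Fin t → Ω₁) → Set (ProbabilityMeasure Ω₁)}

theorem Priced.exists_consistent {f : (Fin T → Ω₁) → EReal} (h : Priced Pt S T f)
    (hg : ∀ i, Measurable (g i)) {P : Measure (Fin T → Ω₁)} (hP : P ∈ MeasFam Ω₁ Pt T) :
    ∃ Q, Consistent (MeasFam Ω₁ Pt T) S g P Q ∧ ∃ c : (Fin T → Ω₁) → ℝ,
      (∀ᵐ ω ∂Q, (c ω : EReal) < f ω) ∧ Integrable c Q ∧ 0 < ∫ ω, c ω ∂Q := by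
  obtain ⟨P', hP', hPP', c, -, hcf, hQ⟩ := h P hP
  have hφm : Measurable fun ω => ∑ i, |g i ω| :=
    Finset.measurable_fun_sum _ fun i _ => (hg i).abs
  obtain ⟨Q, hQp, hQP', hP'Q, hmart, hφ, hc, hpos⟩ := hQ _ hφm
    fun ω => Finset.sum_nonneg fun i _ => abs_nonneg _
  refine ⟨Q, ⟨hQp, ⟨P', hP', hQP'⟩, hmart, hPP'.trans hP'Q, fun i => ?_⟩, c, hQP'.ae_le hcf, hc,
    hpos⟩
  refine hφ.mono' (hg i).aestronglyMeasurable (.of_forall fun ω => ?_)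
  exact Finset.single_le_sum (f := fun i => |g i ω|) (fun i _ => abs_nonneg _) (Finset.mem_univ i)

theorem uMeas_payoff (hS : ∀ t ≤ T, Measurable (S t)) (hg : ∀ i, Measurable (g i))
    {H : (u : ℕ) → (Fin u → Ω₁) → Fin d → ℝ} (hH : Pred Ω₁ d H) (h : Fin e → ℝ) :
    UMeas fun ω => gain Ω₁ S H T le_rfl ω + ∑ i, h i * g i ω :=
  (uMeas_gain hH le_rfl hS).add (UMeas.sum fun i => ((hg i).const_mul (h i)).uMeas)

theorem NA.forall_ae {PP : Set (Measure (Fin T → Ω₁))} (hNA : NA Ω₁ PP S g)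
    (hS : ∀ t ≤ T, Measurable (S t)) (hg : ∀ i, Measurable (g i))
    {H : (u : ℕ) → (Fin u → Ω₁) → Fin d → ℝ} (hH : Pred Ω₁ d H) (h : Fin e → ℝ)
    (h0 : ∀ P ∈ PP, ∀ᵐ ω ∂P, 0 ≤ gain Ω₁ S H T le_rfl ω + ∑ i, h i * g i ω) :
    ∀ P ∈ PP, ∀ᵐ ω ∂P, gain Ω₁ S H T le_rfl ω + ∑ i, h i * g i ω = 0 := by
  have hm := uMeas_payoff hS hg hH h
  exact (quasiSure_iff (hm (measurableSet_singleton 0))).1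
    (hNA H hH h ((quasiSure_iff (hm measurableSet_Ici)).2 h0))

theorem NA.noArb (hNA : NA Ω₁ (MeasFam Ω₁ Pt T) S g) (hS : ∀ t ≤ T, Measurable (S t))
    (hg : ∀ i, Measurable (g i)) : NoArb Pt S T := by
  intro H hH h0
  have := hNA.forall_ae hS hg hH 0 (by simpa using h0)
  simpa using this

theorem IsMartMeas.payoff_ae_eq_zero {Q : Measure (Fin T → Ω₁)} [IsProbabilityMeasure Q]
    (hQ : IsMartMeas Ω₁ S Q) (hS : ∀ t ≤ T, Measurable (S t)) (hg : ∀ i, Integrable (g i) Q)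
    (hg0 : ∀ i, ∫ ω, g i ω ∂Q = 0) {H : (u : ℕ) → (Fin u → Ω₁) → Fin d → ℝ} (hH : Pred Ω₁ d H)
    (h : Fin e → ℝ) (h0 : ∀ᵐ ω ∂Q, 0 ≤ gain Ω₁ S H T le_rfl ω + ∑ i, h i * g i ω) :
    ∀ᵐ ω ∂Q, gain Ω₁ S H T le_rfl ω + ∑ i, h i * g i ω = 0 := by
  have hhg : Integrable (fun ω => ∑ i, h i * g i ω) Q :=
    integrable_finsetSum _ fun i _ => (hg i).const_mul (h i)
  have hm : AEMeasurable (gain Ω₁ S H T le_rfl) Q := (uMeas_gain hH le_rfl hS).aemeasurable Q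
  have hneg : Integrable (fun ω => max (-gain Ω₁ S H T le_rfl ω) 0) Q := by
    refine hhg.norm.mono' (hm.neg.max aemeasurable_const).aestronglyMeasurable ?_
    filter_upwards [h0] with ω hω
    rw [Real.norm_of_nonneg (le_max_right _ _), Real.norm_eq_abs]
    exact max_le ((by linarith : -gain Ω₁ S H T le_rfl ω ≤ _).trans (le_abs_self _)) (abs_nonneg _)
  obtain ⟨h1, h2⟩ := hQ.integrable_gain hS hH le_rfl hneg
  have h3 : ∫ ω, ∑ i, h i * g i ω ∂Q = 0 := by
    rw [integral_finsetSum _ fun i _ => (hg i).const_mul (h i)]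
    simp [integral_const_mul, hg0]
  refine (integral_eq_zero_iff_of_nonneg_ae h0 (h1.add hhg)).1 ?_
  rw [← add_zero (0 : ℝ)]
  nth_rewrite 1 [← h2]
  rw [← h3]
  exact integral_add h1 hhg

theorem NA.zero_mem_prices (hNA : NA Ω₁ (MeasFam Ω₁ Pt T) S g)
    (hs : ∀ u < T, ∃ s : Step (Fin u → Ω₁) Ω₁, s.Represents (Pt u))
    (hS : ∀ t ≤ T, Measurable (S t)) (hg : ∀ i, Measurable (g i)) {P : Measure (Fin T → Ω₁)}
    (hP : P ∈ MeasFam Ω₁ Pt T) :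
    ∃ Q, Consistent (MeasFam Ω₁ Pt T) S g P Q ∧ ∀ i, ∫ ω, g i ω ∂Q = 0 := by
  have hprob := isProbabilityMeasure_of_mem hs
  have hNA' := hNA.noArb hS hg
  have hconv := convex_prices (S := S) (g := g) (measFam_directed hs) P
  by_contra hcon
  have hne : {γ : Fin e → ℝ | ∃ Q, Consistent (MeasFam Ω₁ Pt T) S g P Q ∧
      ∀ i, γ i = ∫ ω, g i ω ∂Q}.Nonempty := by
    rcases hedgeable_or_priced hs hS hNA' (upperSemianalyticE_const 1)
      (fun P _ => .of_forall fun ω => EReal.bot_lt_coe 1) with ⟨H, hH, hle⟩ | h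
    · exfalso
      have hle' : ∀ P ∈ MeasFam Ω₁ Pt T, ∀ᵐ ω ∂P, 1 ≤ gain Ω₁ S H T le_rfl ω :=
        fun P hP => (hle P hP).mono fun ω hω => (EReal.coe_le_coe_iff (x := 1)).1 hω
      have h0 := hNA' H hH fun P hP => (hle' P hP).mono fun ω hω => zero_le_one.trans hω
      have := hprob P hP
      obtain ⟨ω, h1, h2⟩ := ((hle' P hP).and (h0 P hP)).exists
      linarith
    · obtain ⟨Q, hQ, -⟩ := h.exists_consistent hg hP
      exact ⟨_, Q, hQ, fun i => rfl⟩
  obtain ⟨ℓ, hℓ, γ, ⟨Q₁, hQ₁, hγ⟩, hpos⟩ := exists_properly_separating hconv hne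
    fun ⟨Q, hQ, h0⟩ => hcon ⟨Q, hQ, fun i => (h0 i).symm⟩
  let h : Fin e → ℝ := fun i => ℓ (Pi.single i 1)
  have hℓh (γ : Fin e → ℝ) : ℓ γ = ∑ i, h i * γ i := by
    conv_lhs => rw [← Finset.univ_sum_single γ, map_sum]
    refine Finset.sum_congr rfl fun i _ => ?_
    rw [mul_comm, ← smul_eq_mul, ← map_smul, ← Pi.single_smul, smul_eq_mul, mul_one]
  have hhgm : Measurable fun ω => ∑ i, h i * g i ω :=
    Finset.measurable_fun_sum _ fun i _ => (hg i).const_mul (h i)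
  have hInt {Q} (hQ : Consistent (MeasFam Ω₁ Pt T) S g P Q) :
      Integrable (fun ω => ∑ i, h i * g i ω) Q ∧
        ∫ ω, ∑ i, h i * g i ω ∂Q = ℓ fun i => ∫ ω, g i ω ∂Q := by
    refine ⟨integrable_finsetSum _ fun i _ => (hQ.integrable i).const_mul (h i), ?_⟩
    rw [integral_finsetSum _ fun i _ => (hQ.integrable i).const_mul (h i), hℓh]
    simp only [integral_const_mul]
  have hfm : Measurable fun ω => ((-∑ i, h i * g i ω : ℝ) : EReal) :=
    measurable_coe_real_ereal.comp hhgm.neg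
  have hf : UpperSemianalyticE fun ω => ((-∑ i, h i * g i ω : ℝ) : EReal) := fun c =>
    (measurableSet_lt measurable_const hfm).analyticSet
  rcases hedgeable_or_priced hs hS hNA' hf
    (fun P _ => .of_forall fun ω => EReal.bot_lt_coe _) with ⟨H, hH, hle⟩ | hpr
  · have h0 := hNA.forall_ae hS hg hH h fun P hP => (hle P hP).mono fun ω hω => by
      have := EReal.coe_le_coe_iff.1 hω
      linarith
    obtain ⟨P', hP', hQP'⟩ := hQ₁.dominated
    have hQ0 : ∀ᵐ ω ∂Q₁, gain Ω₁ S H T le_rfl ω + ∑ i, h i * g i ω = 0 :=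
      hQP'.ae_le (h0 P' hP')
    have := hQ₁.prob
    obtain ⟨e1, e2⟩ := hInt hQ₁
    have hgain : gain Ω₁ S H T le_rfl =ᵐ[Q₁] fun ω => -∑ i, h i * g i ω :=
      hQ0.mono fun ω hω => by linarith
    have hgi := e1.neg.congr hgain.symm
    have := (hQ₁.mart.integrable_gain hS hH le_rfl hgi.neg.pos_part).2
    rw [integral_congr_ae hgain, integral_neg, e2, ← funext hγ] at this
    linarith
  · obtain ⟨Q, hQ, c, hcf, hci, hcpos⟩ := hpr.exists_consistent hg hP
    obtain ⟨e1, e2⟩ := hInt hQ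
    have h1 := hℓ _ ⟨Q, hQ, fun i => rfl⟩
    have h2 : ∫ ω, c ω ∂Q ≤ ∫ ω, -∑ i, h i * g i ω ∂Q :=
      integral_mono_ae hci e1.neg (hcf.mono fun ω hω => (EReal.coe_lt_coe_iff.1 hω).le)
    rw [integral_neg, e2] at h2
    linarith

theorem na_of_isPolar_imp {PP : Set (Measure (Fin T → Ω₁))} (hS : ∀ t ≤ T, Measurable (S t))
    (hg : ∀ i, Measurable (g i))
    (h : ∀ N : Set (Fin T → Ω₁), IsPolar PP (univComp (Fin T → Ω₁)) N ↔
      IsPolar (QSet Ω₁ PP S g) (univComp (Fin T → Ω₁)) N) : NA Ω₁ PP S g := by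
  intro H hH y hy
  have h1 : QuasiSure (QSet Ω₁ PP S g) (univComp (Fin T → Ω₁)) _ := (h _).1 hy
  have hm := uMeas_payoff hS hg hH y
  have h2 := (quasiSure_iff (R := fun ω => 0 ≤ gain Ω₁ S H T le_rfl ω + ∑ i, y i * g i ω)
    (hm measurableSet_Ici)).1 h1
  refine (h _).2 ((quasiSure_iff (hm (measurableSet_singleton 0))).2 ?_)
  intro Q hQ
  obtain ⟨hQp, -, hmart, hexp⟩ := id hQ
  have hInt (i : Fin e) := (expec_eq_zero_iff (hg i)).1 (hexp i)
  exact hmart.payoff_ae_eq_zero hS (fun i => (hInt i).1) (fun i => (hInt i).2) hH y (h2 Q hQ)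

theorem isPolar_iff_of_dominating {PP : Set (Measure (Fin T → Ω₁))}
    (h : ∀ P ∈ PP, ∃ Q ∈ QSet Ω₁ PP S g, P ≪ Q) (N : Set (Fin T → Ω₁)) :
    IsPolar PP (univComp (Fin T → Ω₁)) N ↔
      IsPolar (QSet Ω₁ PP S g) (univComp (Fin T → Ω₁)) N := by
  refine ⟨fun ⟨A, hA, hN, h0⟩ => ⟨A, hA, hN, ?_⟩, fun ⟨A, hA, hN, h0⟩ => ⟨A, hA, hN, ?_⟩⟩
  · rintro Q ⟨-, ⟨P, hP, hQP⟩, -⟩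
    exact hQP (h0 P hP)
  · intro P hP
    obtain ⟨Q, hQ, hPQ⟩ := h P hP
    exact hPQ (h0 Q hQ)

end Market

end BN

open BN in
/-- **First Fundamental Theorem of Asset Pricing** (nondominated, with options).
In the multi-period market with semistatic trading, the following are equivalent:
(i) `NA(𝒫)` holds; (ii) for every `P ∈ 𝒫` there is `Q ∈ 𝒬` with `P ≪ Q`;
(ii') `𝒫` and `𝒬` have the same polar sets. -/
theorem first_fundamental_theorem_asset_pricing
    (Ω₁ : Type) [MeasurableSpace Ω₁] [TopologicalSpace Ω₁] [PolishSpace Ω₁]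
    [BorelSpace Ω₁] [Nonempty Ω₁] (T d e : ℕ)
    (Pt : (t : ℕ) → (Fin t → Ω₁) → Set (ProbabilityMeasure Ω₁))
    (hPtne : ∀ t, t < T → ∀ ω, (Pt t ω).Nonempty)
    (hPtconv : ∀ t, t < T → ∀ ω, ConvexPM (Pt t ω))
    (hPtgraph : ∀ t, t < T →
      AnalyticSet {p : (Fin t → Ω₁) × ProbabilityMeasure Ω₁ | p.2 ∈ Pt t p.1})
    (S : (t : ℕ) → (Fin t → Ω₁) → Fin d → ℝ) (hS : ∀ t, t ≤ T → Measurable (S t))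
    (g : Fin e → (Fin T → Ω₁) → ℝ) (hg : ∀ i, Measurable (g i)) :
    (NA Ω₁ (MeasFam Ω₁ Pt T) S g ↔
      ∀ P ∈ MeasFam Ω₁ Pt T, ∃ Q ∈ QSet Ω₁ (MeasFam Ω₁ Pt T) S g, P ≪ Q) ∧
    (NA Ω₁ (MeasFam Ω₁ Pt T) S g ↔
      ∀ N : Set (Fin T → Ω₁),
        IsPolar (MeasFam Ω₁ Pt T) (univComp (Fin T → Ω₁)) N ↔
          IsPolar (QSet Ω₁ (MeasFam Ω₁ Pt T) S g) (univComp (Fin T → Ω₁)) N) := by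
  have hs : ∀ u < T, ∃ s : Step (Fin u → Ω₁) Ω₁, s.Represents (Pt u) := fun u hu =>
    exists_represents (hPtne u hu) (hPtconv u hu) (hPtgraph u hu)
  have h12 : NA Ω₁ (MeasFam Ω₁ Pt T) S g →
      ∀ P ∈ MeasFam Ω₁ Pt T, ∃ Q ∈ QSet Ω₁ (MeasFam Ω₁ Pt T) S g, P ≪ Q := by
    intro hNA P hP
    obtain ⟨Q, hQ, h0⟩ := hNA.zero_mem_prices hs hS hg hP
    exact ⟨Q, ⟨hQ.prob, hQ.dominated, hQ.mart, fun i =>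
      (expec_eq_zero_iff (hg i)).2 ⟨hQ.integrable i, h0 i⟩⟩, hQ.dominating⟩
  exact ⟨⟨h12, fun h => na_of_isPolar_imp hS hg (isPolar_iff_of_dominating h)⟩,
    fun hNA => isPolar_iff_of_dominating (h12 hNA), na_of_isPolar_imp hS hg⟩
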